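/- Let T and T′ be Sierpiński curves, let S ⊆ T be a subset which in the subspace topology is a Sierpiński curve entwined in T, and let S′ ⊆ T′ be a subset which in the subspace topology is a Sierpiński curve entwined in T′. Then every homeomorphism φ : S → S′ extends to a homeomorphism ψ : T → T′ (i.e. ψ restricted to S equals φ). -/

import Mathlib

open Set Metric Filter Topology

/-- The unit sphere S² in ℝ³. -/
abbrev Sphere2 : Set (EuclideanSpace ℝ (Fin 3)) := Metric.sphere 0 1

/-- The closed unit disk in ℝ². -/
abbrev UnitDisk2 : Set (EuclideanSpace ℝ (Fin 2)) := Metric.closedBall 0 1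

/-- The unit circle in ℝ². -/
abbrev UnitCircle : Set (EuclideanSpace ℝ (Fin 2)) := Metric.sphere 0 1

/-- A closed disk in S²: a subset homeomorphic to the closed unit disk in ℝ². -/
def IsClosedDisk (E : Set ↥Sphere2) : Prop := Nonempty (↥E ≃ₜ ↥UnitDisk2)

/-- A family of open sets in S² realizing a Sierpiński curve as `S² \ ⋃ᵢ Dᵢ`:
each `Dᵢ` is the interior of a closed disk, the closures are pairwise disjoint,
the diameters tend to `0`, and the union of the closures is dense. -/
def IsSierpinskiFamily (D : ℕ → Set ↥Sphere2) : Prop :=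
  (∀ i, ∃ E : Set ↥Sphere2, IsClosedDisk E ∧ D i = interior E) ∧
  (Pairwise fun i j => Disjoint (closure (D i)) (closure (D j))) ∧
  Tendsto (fun i => Metric.diam (D i)) atTop (𝓝 0) ∧
  Dense (⋃ i, closure (D i))

/-- A Sierpiński curve: a space homeomorphic to `S² \ ⋃ᵢ Dᵢ` for some Sierpiński family. -/
def IsSierpinskiCurve (X : Type*) [TopologicalSpace X] : Prop :=
  ∃ D : ℕ → Set ↥Sphere2, IsSierpinskiFamily D ∧ Nonempty (X ≃ₜ ↥((⋃ i, D i)ᶜ))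

/-- A peripheral circle of the space `X`: a subspace homeomorphic to the circle whose
complement is connected. -/
def IsPeriphCircle (X : Type*) [TopologicalSpace X] (γ : Set X) : Prop :=
  Nonempty (↥γ ≃ₜ ↥UnitCircle) ∧ IsConnected γᶜ

/-- `γ` is a peripheral circle of the subset `S` (with its subspace topology). -/
def IsPeriphCircleIn {X : Type*} [TopologicalSpace X] (S γ : Set X) : Prop :=
  γ ⊆ S ∧ IsPeriphCircle ↥S (Subtype.val ⁻¹' γ)

/-- The function `f` has a continuous logarithm on `K`. -/
def HasLog {X : Type*} [TopologicalSpace X] (K : Set X) (f : X → ℂ) : Prop :=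
  ∃ h : X → ℂ, ContinuousOn h K ∧ ∀ z ∈ K, Complex.exp (h z) = f z

namespace HasLog

variable {X Y : Type*} [TopologicalSpace X] [TopologicalSpace Y] {K L : Set X} {f g : X → ℂ}

lemma mono (h : HasLog L f) (hKL : K ⊆ L) : HasLog K f := by
  obtain ⟨h, hc, he⟩ := h
  exact ⟨h, hc.mono hKL, fun z hz => he z (hKL hz)⟩

lemma congr (h : HasLog K f) (hfg : EqOn f g K) : HasLog K g := by
  obtain ⟨h, hc, he⟩ := h
  exact ⟨h, hc, fun z hz => (he z hz).trans (hfg hz)⟩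

lemma mul (hf : HasLog K f) (hg : HasLog K g) : HasLog K (fun z => f z * g z) := by
  obtain ⟨h, hc, he⟩ := hf
  obtain ⟨k, kc, ke⟩ := hg
  exact ⟨fun z => h z + k z, hc.add kc, fun z hz => by simp [Complex.exp_add, he z hz, ke z hz]⟩

lemma zpow (hf : HasLog K f) (n : ℤ) : HasLog K (fun z => f z ^ n) := by
  obtain ⟨h, hc, he⟩ := hf
  exact ⟨fun z => n * h z, continuousOn_const.mul hc, fun z hz => by
    rw [Complex.exp_int_mul, he z hz]⟩

lemma inv (hf : HasLog K f) : HasLog K (fun z => (f z)⁻¹) := by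
  simpa using hf.zpow (-1)

lemma comp {f : Y → ℂ} {L : Set Y} (hf : HasLog L f) {p : X → Y} (hp : ContinuousOn p K)
    (hm : MapsTo p K L) : HasLog K (fun x => f (p x)) := by
  obtain ⟨h, hc, he⟩ := hf
  exact ⟨fun z => h (p z), hc.comp hp hm, fun z hz => he _ (hm hz)⟩

lemma of_convex {E : Type*} [NormedAddCommGroup E] [NormedSpace ℝ E] {f : E → ℂ}
    (hf : Continuous f) (h0 : ∀ z, f z ≠ 0) : HasLog univ f := by
  have hs : IsSimplyConnected (univ : Set E) := by
    have := (convex_univ (𝕜 := ℝ) (E := E)).contractibleSpace ⟨0, mem_univ _⟩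
    exact SimplyConnectedSpace.ofContractible _
  obtain ⟨h, hc, he⟩ := Complex.exists_continuousOn_eqOn_exp_comp hs isOpen_univ
    hf.continuousOn (by rintro ⟨z, -, hz⟩; exact h0 z hz)
  exact ⟨h, hc, fun z hz => he hz⟩

end HasLog

lemma continuousOn_invFunOn_of_isCompact {X Y : Type*} [TopologicalSpace X] [Nonempty X]
    [TopologicalSpace Y] [T2Space Y] {K : Set X} (hK : IsCompact K) {γ : X → Y}
    (hc : ContinuousOn γ K) (hi : InjOn γ K) :
    ContinuousOn (Function.invFunOn γ K) (γ '' K) := by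
  rw [continuousOn_iff_isClosed]
  intro C hC
  refine ⟨γ '' (K ∩ C), ((hK.inter_right hC).image_of_continuousOn
    (hc.mono inter_subset_left)).isClosed, ?_⟩
  ext y
  constructor
  · rintro ⟨hy, x, hx, rfl⟩
    exact ⟨⟨x, ⟨hx, by simpa [hi.leftInvOn_invFunOn hx] using hy⟩, rfl⟩, x, hx, rfl⟩
  · rintro ⟨⟨x, ⟨hx, hxC⟩, rfl⟩, -⟩
    exact ⟨by simpa [hi.leftInvOn_invFunOn hx] using hxC, x, hx, rfl⟩

lemma HasLog.image {X Y : Type*} [TopologicalSpace X] [Nonempty X]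
    [TopologicalSpace Y] [T2Space Y] {K : Set X} (hK : IsCompact K) {γ : X → Y}
    (hc : ContinuousOn γ K) (hi : InjOn γ K) {f : Y → ℂ} (hf : HasLog K (fun x => f (γ x))) :
    HasLog (γ '' K) f := by
  refine (hf.comp (continuousOn_invFunOn_of_isCompact hK hc hi) ?_).congr ?_
  · rintro _ ⟨x, hx, rfl⟩
    simpa [hi.leftInvOn_invFunOn hx] using hx
  · rintro _ ⟨x, hx, rfl⟩
    simp [hi.leftInvOn_invFunOn hx]

lemma hasLog_closedBall {f : ℂ → ℂ} {a : ℂ} {r : ℝ} (hr : 0 < r)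
    (hf : ContinuousOn f (closedBall a r)) (h0 : ∀ z ∈ closedBall a r, f z ≠ 0) :
    HasLog (closedBall a r) f := by
  set ρ : ℂ → ℂ := fun z => a + ((r / max r ‖z - a‖ : ℝ) : ℂ) * (z - a) with hρ
  have hpos : ∀ z : ℂ, 0 < max r ‖z - a‖ := fun z => lt_max_of_lt_left hr
  have hρc : Continuous ρ := by
    refine continuous_const.add (Continuous.mul (Complex.continuous_ofReal.comp
      (continuous_const.div (by fun_prop) fun z => (hpos z).ne')) (by fun_prop))
  have hm : ∀ z, ρ z ∈ closedBall a r := by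
    intro z
    simp only [hρ, mem_closedBall, dist_self_add_left, norm_mul, Complex.norm_real,
      Real.norm_eq_abs, abs_of_pos (div_pos hr (hpos z))]
    rw [div_mul_eq_mul_div, div_le_iff₀ (hpos z)]
    exact mul_le_mul_of_nonneg_left (le_max_right _ _) hr.le
  have he : ∀ z ∈ closedBall a r, ρ z = z := by
    intro z hz
    rw [mem_closedBall, dist_eq_norm] at hz
    simp [hρ, max_eq_left hz, hr.ne']
  refine ((HasLog.of_convex (hf.comp_continuous hρc hm) fun z => h0 _ (hm z)).mono
    (subset_univ (closedBall a r))).congr ?_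
  intro z hz
  simp [he z hz]

lemma hasLog_Icc {f : ℝ → ℂ} (hf : ContinuousOn f (Icc 0 1)) (h0 : ∀ t ∈ Icc (0 : ℝ) 1, f t ≠ 0) :
    HasLog (Icc (0 : ℝ) 1) f := by
  refine ((HasLog.of_convex (f := IccExtend zero_le_one ((Icc (0:ℝ) 1).domRestrict f))
    (hf.domRestrict.Icc_extend') fun z => ?_).mono (subset_univ _)).congr ?_
  · exact h0 _ (Subtype.prop _)
  · intro z hz
    simp [IccExtend_of_mem _ _ hz]

lemma exp_eq_exp_on_preconnected {X : Type*} [TopologicalSpace X] {K : Set X}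
    (hK : IsPreconnected K) {h k : X → ℂ} (hh : ContinuousOn h K) (hk : ContinuousOn k K)
    (he : ∀ z ∈ K, Complex.exp (h z) = Complex.exp (k z)) :
    ∃ c : ℂ, Complex.exp c = 1 ∧ ∀ z ∈ K, h z = k z + c := by
  have key : ∀ z ∈ K, ∃ n : ℤ, h z = k z + n * (2 * Real.pi * Complex.I) := fun z hz =>
    Complex.exp_eq_exp_iff_exists_int.mp (he z hz)
  have hd : IsDiscrete (range ((↑) : ℤ → ℝ)) := by
    have := Int.isClosedEmbedding_coe_real.isEmbedding.toHomeomorph.symm.isEmbedding.discreteTopology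
    exact ⟨this⟩
  obtain ⟨y, ⟨n, rfl⟩, hy⟩ := hK.eqOn_const_of_mapsTo hd
    (f := fun z => ((h z - k z) / (2 * Real.pi * Complex.I)).re)
    (Complex.continuous_re.comp_continuousOn ((hh.sub hk).div_const _)) (by
      intro z hz
      obtain ⟨n, hn⟩ := key z hz
      exact ⟨n, by simp only [hn, add_sub_cancel_left, mul_div_cancel_right₀ _ Complex.two_pi_I_ne_zero]; simp⟩) (range_nonempty _)
  refine ⟨n * (2 * Real.pi * Complex.I), Complex.exp_int_mul_two_pi_mul_I n, fun z hz => ?_⟩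
  obtain ⟨m, hm⟩ := key z hz
  have := hy hz
  simp only [hm, add_sub_cancel_left, mul_div_cancel_right₀ _ Complex.two_pi_I_ne_zero,
    Function.const_apply, Complex.intCast_re] at this
  have : m = n := by exact_mod_cast this
  rw [hm, this]

lemma HasLog.union {X : Type*} [TopologicalSpace X] {K L : Set X} (hK : IsClosed K)
    (hL : IsClosed L) (hKL : IsPreconnected (K ∩ L)) {f : X → ℂ} (h1 : HasLog K f)
    (h2 : HasLog L f) : HasLog (K ∪ L) f := by
  classical
  obtain ⟨h, hc, he⟩ := h1
  obtain ⟨k, kc, ke⟩ := h2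
  obtain ⟨c, hc1, hck⟩ := exp_eq_exp_on_preconnected hKL (hc.mono inter_subset_left)
    (kc.mono inter_subset_right) fun z hz => (he z hz.1).trans (ke z hz.2).symm
  have e1 : EqOn (K.piecewise h (fun z => k z + c)) h K := fun z hz => by simp [hz]
  have e2 : EqOn (K.piecewise h (fun z => k z + c)) (fun z => k z + c) L := fun z hz => by
    by_cases hzK : z ∈ K
    · simp [hzK, hck z ⟨hzK, hz⟩]
    · simp [hzK]
  refine ⟨K.piecewise h (fun z => k z + c), ?_, ?_⟩
  · exact (hc.congr e1).union_of_isClosed ((kc.add continuousOn_const).congr e2) hK hL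
  · rintro z (hz | hz)
    · rw [e1 hz, he z hz]
    · rw [e2 hz, Complex.exp_add, hc1, mul_one, ke z hz]

lemma not_hasLog_sphere {a : ℂ} {r : ℝ} (hr : 0 < r) {n : ℤ}
    (h : HasLog (sphere a r) (fun z => (z - a) ^ n)) : n = 0 := by
  set p : ℝ → ℂ := fun t => a + r * Complex.exp (t * (2 * Real.pi * Complex.I)) with hp
  have hpc : Continuous p := by fun_prop
  have hps : ∀ t, p t ∈ sphere a r := by
    intro t
    have : (t : ℂ) * (2 * Real.pi * Complex.I) = ((t * (2 * Real.pi) : ℝ) : ℂ) * Complex.I := by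
      push_cast; ring
    simp only [hp, mem_sphere_iff_norm, add_sub_cancel_left, norm_mul, this,
      Complex.norm_exp_ofReal_mul_I]
    simp [abs_of_pos hr]
  obtain ⟨h, hc, he⟩ := h
  have hr' : (r : ℂ) ≠ 0 := by exact_mod_cast hr.ne'
  have hc2 : Continuous fun t => h (p t) := hc.comp_continuous hpc hps
  obtain ⟨c, -, hcc⟩ := exp_eq_exp_on_preconnected isPreconnected_univ (h := fun t => h (p t))
    (k := fun t : ℝ => n * (Complex.log r + t * (2 * Real.pi * Complex.I)))
    hc2.continuousOn (by fun_prop) (fun t _ => by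
      simp only [he _ (hps t), Complex.exp_int_mul, Complex.exp_add, Complex.exp_log hr']
      simp [hp])
  have h0 := hcc 0 (mem_univ _)
  have h1 := hcc 1 (mem_univ _)
  have hp01 : p 0 = p 1 := by simp [hp]
  rw [hp01, h1] at h0
  have h2 : (n : ℂ) * (2 * Real.pi * Complex.I) = 0 := by
    have := add_right_cancel h0
    simp only [Complex.ofReal_one, Complex.ofReal_zero] at this
    linear_combination this
  have := (mul_eq_zero.mp h2).resolve_right Complex.two_pi_I_ne_zero
  exact_mod_cast this

/-- The points off `K` whose component in the complement of `K` is bounded. -/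
def inside (K : Set ℂ) : Set ℂ := {z | z ∉ K ∧ Bornology.IsBounded (pathComponentIn Kᶜ z)}

/-- The points off `K` whose component in the complement of `K` is unbounded. -/
def outside (K : Set ℂ) : Set ℂ := {z | z ∉ K ∧ ¬ Bornology.IsBounded (pathComponentIn Kᶜ z)}

/-- The union of `K` with the bounded components of its complement. -/
def fill (K : Set ℂ) : Set ℂ := K ∪ inside K

lemma compl_eq_inside_union_outside (K : Set ℂ) : Kᶜ = inside K ∪ outside K := by
  ext z; simp only [inside, outside, mem_compl_iff, mem_union, mem_ofPred_eq]; tauto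

lemma disjoint_inside_outside (K : Set ℂ) : Disjoint (inside K) (outside K) :=
  disjoint_left.mpr fun _ h h' => h'.2 h.2

lemma JoinedIn.mem_inside {K : Set ℂ} {x y : ℂ} (h : JoinedIn Kᶜ x y) (hx : x ∈ inside K) :
    y ∈ inside K := by
  refine ⟨h.target_mem, ?_⟩
  rw [pathComponentIn_congr (show y ∈ pathComponentIn Kᶜ x from h)]
  exact hx.2

lemma JoinedIn.mem_outside {K : Set ℂ} {x y : ℂ} (h : JoinedIn Kᶜ x y) (hx : x ∈ outside K) :
    y ∈ outside K := by
  refine ⟨h.target_mem, ?_⟩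
  rw [pathComponentIn_congr (show y ∈ pathComponentIn Kᶜ x from h)]
  exact hx.2

lemma isPathConnected_norm_gt {R : ℝ} (hR : 0 < R) : IsPathConnected {z : ℂ | R < ‖z‖} := by
  have h1 : {z : ℂ | R < ‖z‖} = Complex.exp '' {w : ℂ | Real.log R < w.re} := by
    ext z
    constructor
    · intro hz
      have hz : R < ‖z‖ := hz
      have hz0 : z ≠ 0 := fun h => by simp [h] at hz; linarith
      exact ⟨Complex.log z, by simpa [Complex.log_re] using Real.log_lt_log hR hz, Complex.exp_log hz0⟩
    · rintro ⟨w, hw, rfl⟩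
      have hw : Real.log R < w.re := hw
      simpa [Complex.norm_exp] using (Real.log_lt_iff_lt_exp hR).mp hw
  rw [h1]
  refine IsPathConnected.image ((convex_halfSpace_re_gt _).isPathConnected
    ⟨((Real.log R + 1 : ℝ) : ℂ), ?_⟩) Complex.continuous_exp
  simp only [mem_ofPred_eq, Complex.ofReal_re]; linarith

lemma joinedIn_of_mem_outside {K : Set ℂ} (hK : Bornology.IsBounded K) {x y : ℂ}
    (hx : x ∈ outside K) (hy : y ∈ outside K) : JoinedIn Kᶜ x y := by
  obtain ⟨R, hR0, hR⟩ := hK.exists_pos_norm_le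
  have far : ∀ w ∈ outside K, ∃ z, JoinedIn Kᶜ w z ∧ R < ‖z‖ := by
    intro w hw
    by_contra hcon
    push Not at hcon
    exact hw.2 (isBounded_iff_forall_norm_le.mpr ⟨R, hcon⟩)
  obtain ⟨u, hu, hu'⟩ := far x hx
  obtain ⟨v, hv, hv'⟩ := far y hy
  have : JoinedIn Kᶜ u v := ((isPathConnected_norm_gt hR0).joinedIn u hu' v hv').mono
    fun z hz hzK => (lt_irrefl _ (hz.trans_le (hR z hzK)))
  exact hu.trans (this.trans hv.symm)

lemma mem_outside_of_norm {K : Set ℂ} {R : ℝ} (hR : 0 < R) (hK : K ⊆ closedBall 0 R) {z : ℂ}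
    (hz : R < ‖z‖) : z ∈ outside K := by
  have hd : {z : ℂ | R < ‖z‖} ⊆ Kᶜ := fun w hw hwK => by
    have := hK hwK
    simp only [mem_closedBall, dist_zero_right] at this
    exact absurd (lt_of_lt_of_le hw this) (lt_irrefl _)
  refine ⟨hd hz, fun hb => ?_⟩
  have hsub : {z : ℂ | R < ‖z‖} ⊆ pathComponentIn Kᶜ z := fun w hw =>
    ((isPathConnected_norm_gt hR).joinedIn z hz w hw).mono hd
  obtain ⟨M, hM⟩ := isBounded_iff_forall_norm_le.mp (hb.subset hsub)
  have h0 : 0 ≤ |M| := abs_nonneg M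
  have h1 := hM ((R + |M| + 1 : ℝ) : ℂ) (by
    simp only [mem_ofPred_eq, Complex.norm_real, Real.norm_eq_abs]; rw [abs_of_pos (by linarith)]; linarith)
  rw [Complex.norm_real, Real.norm_eq_abs, abs_of_pos (by linarith)] at h1
  linarith [le_abs_self M]

lemma inside_subset_closedBall {K : Set ℂ} {R : ℝ} (hR : 0 < R) (hK : K ⊆ closedBall 0 R) :
    inside K ⊆ closedBall 0 R := by
  intro z hz
  by_contra h
  simp only [mem_closedBall, dist_zero_right, not_le] at h
  exact disjoint_left.mp (disjoint_inside_outside K) hz (mem_outside_of_norm hR hK h)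

lemma isBounded_fill {K : Set ℂ} (hK : Bornology.IsBounded K) : Bornology.IsBounded (fill K) := by
  obtain ⟨R, hR0, hR⟩ := hK.exists_pos_norm_le
  have hK' : K ⊆ closedBall 0 R := fun z hz => by simpa using hR z hz
  exact isBounded_closedBall.subset (union_subset hK' (inside_subset_closedBall hR0 hK'))

lemma outside_nonempty {K : Set ℂ} (hK : Bornology.IsBounded K) : (outside K).Nonempty := by
  obtain ⟨R, hR0, hR⟩ := hK.exists_pos_norm_le
  refine ⟨((R + 1 : ℝ) : ℂ), mem_outside_of_norm hR0 (fun z hz => by simpa using hR z hz) ?_⟩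
  rw [Complex.norm_real, Real.norm_eq_abs, abs_of_pos (by linarith)]
  linarith

lemma isOpen_inside {K : Set ℂ} (hK : IsClosed K) : IsOpen (inside K) := by
  rw [isOpen_iff_mem_nhds]
  intro z hz
  filter_upwards [(hK.isOpen_compl.pathComponentIn z).mem_nhds (mem_pathComponentIn_self hz.1)]
    with w hw
  exact JoinedIn.mem_inside hw hz

lemma isOpen_outside {K : Set ℂ} (hK : IsClosed K) : IsOpen (outside K) := by
  rw [isOpen_iff_mem_nhds]
  intro z hz
  filter_upwards [(hK.isOpen_compl.pathComponentIn z).mem_nhds (mem_pathComponentIn_self hz.1)]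
    with w hw
  exact JoinedIn.mem_outside hw hz

lemma fill_eq_compl_outside (K : Set ℂ) : fill K = (outside K)ᶜ := by
  ext z; simp only [fill, inside, outside, mem_compl_iff, mem_union, mem_ofPred_eq]; tauto

lemma isClosed_fill {K : Set ℂ} (hK : IsClosed K) : IsClosed (fill K) := by
  rw [fill_eq_compl_outside]; exact (isOpen_outside hK).isClosed_compl

lemma isCompact_fill {K : Set ℂ} (hK : IsCompact K) : IsCompact (fill K) :=
  Metric.isCompact_of_isClosed_isBounded (isClosed_fill hK.isClosed) (isBounded_fill hK.isBounded)

/-- The closure of a component of the complement of `K` only adds points of `K`. -/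
lemma isClosed_pathComponentIn_union {K : Set ℂ} (hK : IsClosed K) (a : ℂ) :
    IsClosed (pathComponentIn Kᶜ a ∪ K) := by
  rw [← isOpen_compl_iff, isOpen_iff_mem_nhds]
  intro z hz
  simp only [mem_compl_iff, mem_union, not_or] at hz
  filter_upwards [(hK.isOpen_compl.pathComponentIn z).mem_nhds (mem_pathComponentIn_self hz.2)]
    with w hw
  have hw : JoinedIn Kᶜ z w := hw
  simp only [mem_compl_iff, mem_union, not_or]
  exact ⟨fun h => hz.1 (JoinedIn.trans h hw.symm), hw.target_mem⟩

lemma zpow_eq_zero_of_hasLog {K : Set ℂ} (hK : IsClosed K) {a : ℂ} (ha : a ∈ inside K)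
    {g : ℂ → ℂ} (hg : ContinuousOn g (pathComponentIn Kᶜ a ∪ K))
    (hg0 : ∀ z ∈ pathComponentIn Kᶜ a ∪ K, g z ≠ 0) {n : ℤ}
    (h : HasLog K (fun z => (z - a) ^ n * g z)) : n = 0 := by
  classical
  set U := pathComponentIn Kᶜ a with hU
  have hUo : IsOpen U := hK.isOpen_compl.pathComponentIn a
  have haU : a ∈ U := mem_pathComponentIn_self ha.1
  obtain ⟨h, hc, he⟩ := h
  obtain ⟨H, hH⟩ := ContinuousMap.exists_restrict_eq hK ⟨K.domRestrict h, hc.domRestrict⟩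
  have hHK : ∀ z ∈ K, H z = h z := fun z hz => congrArg (fun F : C(K, ℂ) => F ⟨z, hz⟩) hH
  set F : ℂ → ℂ := (U ∪ K).piecewise (fun z => Complex.exp (H z) / g z) (fun z => (z - a) ^ n)
  have hne : ∀ z ∈ Uᶜ, z - a ≠ 0 := fun z hz h => hz (by rwa [sub_eq_zero.mp h])
  have e1 : EqOn F (fun z => Complex.exp (H z) / g z) (U ∪ K) := fun z hz => by simp [F, hz]
  have e2 : EqOn F (fun z => (z - a) ^ n) Uᶜ := fun z hz => by
    by_cases hzK : z ∈ U ∪ K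
    · have hzK' : z ∈ K := hzK.resolve_left hz
      simp only [F, piecewise_eq_of_mem _ _ _ hzK, hHK z hzK', he z hzK']
      field_simp [hg0 z hzK]
    · simp [F, hzK]
  have hF0 : ∀ z, F z ≠ 0 := by
    intro z
    by_cases hz : z ∈ U
    · rw [e1 (Or.inl hz)]
      exact div_ne_zero (Complex.exp_ne_zero _) (hg0 z (Or.inl hz))
    · rw [e2 hz]; exact zpow_ne_zero _ (hne z hz)
  have hFc : Continuous F := by
    have : ContinuousOn F ((U ∪ K) ∪ Uᶜ) := by
      refine ContinuousOn.union_of_isClosed ?_ ?_ (isClosed_pathComponentIn_union hK a)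
        hUo.isClosed_compl
      · exact ((Complex.continuous_exp.comp H.continuous).continuousOn.div hg hg0).congr e1
      · exact ((continuousOn_id.sub continuousOn_const).zpow₀ n fun z hz => Or.inl (hne z hz)).congr e2
    rwa [show (U ∪ K) ∪ Uᶜ = univ by rw [union_right_comm, union_compl_self, univ_union],
      ← continuousOn_univ.symm.eq] at this
  obtain ⟨R, hR⟩ := ha.2.subset_ball a
  have hR0 : 0 < R := pos_of_mem_ball (hR haU)
  refine not_hasLog_sphere hR0 (((hasLog_closedBall (a := a) hR0 hFc.continuousOn
    fun z _ => hF0 z).mono sphere_subset_closedBall).congr fun z hz => e2 fun hzU => ?_)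
  have := hR hzU
  rw [mem_sphere] at hz
  rw [mem_ball] at this
  linarith

lemma hasLog_div_of_joinedIn {K : Set ℂ} (hK : IsClosed K) {a b : ℂ} (h : JoinedIn Kᶜ a b) :
    HasLog K (fun z => (z - a) / (z - b)) := by
  obtain ⟨γ, hγ⟩ := h
  have hne : ∀ t, ∀ z ∈ K, z - γ t ≠ 0 := fun t z hz h => hγ t (by rwa [← sub_eq_zero.mp h])
  have key := (isPreconnected_univ (α := unitInterval)).induction₂
    (fun s t => HasLog K (fun z => (z - γ s) / (z - γ t))) ?_ ?_ ?_ (mem_univ 0) (mem_univ 1)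
  · simpa using key
  · intro s _
    rw [nhdsWithin_univ]
    obtain ⟨r, hr, hball⟩ := Metric.isOpen_iff.mp hK.isOpen_compl (γ s) (hγ s)
    filter_upwards [γ.continuous.continuousAt.preimage_mem_nhds (ball_mem_nhds _ hr)] with t ht
    have hlog : HasLog K (fun z => (z - γ t) / (z - γ s)) := by
      have hs : ∀ z ∈ K, (z - γ t) / (z - γ s) ∈ Complex.slitPlane := by
        intro z hz
        have h1 : r ≤ ‖z - γ s‖ := by
          by_contra hlt
          exact hball (by simpa [dist_eq_norm] using hlt) hz
        have h2 : (z - γ t) / (z - γ s) = 1 - (γ t - γ s) / (z - γ s) := by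
          field_simp [hne s z hz]; ring
        rw [h2]
        refine Complex.mem_slitPlane_of_norm_lt_one (z := -((γ t - γ s) / (z - γ s))) ?_
          |> fun h => by simpa [sub_eq_add_neg] using h
        rw [norm_neg, norm_div, div_lt_one (by linarith)]
        have : ‖γ t - γ s‖ < r := by simpa [dist_eq_norm] using ht
        linarith
      refine ⟨fun z => Complex.log ((z - γ t) / (z - γ s)), ContinuousOn.clog ?_ hs, fun z hz =>
        Complex.exp_log (Complex.slitPlane_ne_zero (hs z hz))⟩
      exact (continuousOn_id.sub continuousOn_const).div (continuousOn_id.sub continuousOn_const)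
        (hne s)
    exact (hlog.inv).congr fun z _ => by simp
  · intro s t u _ _ _ h1 h2
    exact (h1.mul h2).congr fun z hz => by field_simp [hne t z hz]
  · intro s t _ _ h1
    exact (h1.inv).congr fun z _ => by simp

lemma joinedIn_of_hasLog_div {K : Set ℂ} (hK : IsCompact K) {a b : ℂ} (ha : a ∉ K) (hb : b ∉ K)
    (h : HasLog K (fun z => (z - a) / (z - b))) : JoinedIn Kᶜ a b := by
  have key : ∀ a b : ℂ, a ∈ inside K → b ∉ K → HasLog K (fun z => (z - a) / (z - b)) →
      JoinedIn Kᶜ a b := by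
    intro a b ha hb h
    by_contra hcon
    have hne : ∀ z ∈ pathComponentIn Kᶜ a ∪ K, z - b ≠ 0 := by
      rintro z hz h0
      rw [sub_eq_zero] at h0
      subst h0
      exact hz.elim hcon hb
    have := zpow_eq_zero_of_hasLog hK.isClosed ha (n := 1) (g := fun z => (z - b)⁻¹)
      ((continuousOn_id.sub continuousOn_const).inv₀ hne) (fun z hz => inv_ne_zero (hne z hz))
      (h.congr fun z _ => by simp [div_eq_mul_inv])
    exact one_ne_zero this
  by_cases ha' : a ∈ inside K
  · exact key a b ha' hb h
  by_cases hb' : b ∈ inside K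
  · exact (key b a hb' ha (h.inv.congr fun z _ => by simp)).symm
  have h1 : a ∈ Kᶜ := ha
  have h2 : b ∈ Kᶜ := hb
  rw [compl_eq_inside_union_outside] at h1 h2
  exact joinedIn_of_mem_outside hK.isBounded (h1.resolve_left ha') (h2.resolve_left hb')

/-- **Janiszewski's theorem**. -/
theorem joinedIn_compl_union {K L : Set ℂ} (hK : IsCompact K) (hL : IsCompact L)
    (hKL : IsPreconnected (K ∩ L)) {a b : ℂ} (h1 : JoinedIn Kᶜ a b) (h2 : JoinedIn Lᶜ a b) :
    JoinedIn (K ∪ L)ᶜ a b :=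
  joinedIn_of_hasLog_div (hK.union hL) (fun h => h.elim h1.source_mem h2.source_mem)
    (fun h => h.elim h1.target_mem h2.target_mem)
    ((hasLog_div_of_joinedIn hK.isClosed h1).union hK.isClosed hL.isClosed hKL
      (hasLog_div_of_joinedIn hL.isClosed h2))

section Arcs

variable {E F : Type*} [TopologicalSpace E] [TopologicalSpace F]

/-- `A` is an arc with endpoints `a` and `b`. -/
def IsArc (A : Set E) (a b : E) : Prop :=
  ∃ γ : ℝ → E, ContinuousOn γ (Icc 0 1) ∧ InjOn γ (Icc 0 1) ∧ γ 0 = a ∧ γ 1 = b ∧ γ '' Icc 0 1 = A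

/-- `J` is a Jordan curve, i.e. an injective continuous image of `ℝ / ℤ`. -/
def IsJordanCurve (J : Set E) : Prop :=
  ∃ f : ℝ → E, Continuous f ∧ (∀ s t, f s = f t ↔ ∃ n : ℤ, s = t + n) ∧ range f = J

lemma isArc_image_Icc {γ : ℝ → E} {s t : ℝ} (hst : s < t) (hc : ContinuousOn γ (Icc s t))
    (hi : InjOn γ (Icc s t)) : IsArc (γ '' Icc s t) (γ s) (γ t) := by
  have hm : MapsTo (fun x : ℝ => s + x * (t - s)) (Icc 0 1) (Icc s t) := by
    rintro x ⟨h0, h1⟩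
    constructor <;> nlinarith
  refine ⟨fun x => γ (s + x * (t - s)), hc.comp (by fun_prop) hm, ?_, by simp, by simp, ?_⟩
  · intro x hx y hy hxy
    have := hi (hm hx) (hm hy) hxy
    have h2 : (x - y) * (t - s) = 0 := by linarith
    rcases mul_eq_zero.mp h2 with h | h <;> linarith
  · apply Subset.antisymm
    · rintro _ ⟨x, hx, rfl⟩
      exact ⟨_, hm hx, rfl⟩
    · rintro _ ⟨y, ⟨hy0, hy1⟩, rfl⟩
      have hts : 0 < t - s := by linarith
      refine ⟨(y - s) / (t - s), ⟨div_nonneg (by linarith) hts.le,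
        (div_le_one hts).mpr (by linarith)⟩, ?_⟩
      simp only [div_mul_cancel₀ _ hts.ne']
      congr 1
      ring

namespace IsArc

variable {A B : Set E} {a b c : E}

lemma isCompact (h : IsArc A a b) : IsCompact A := by
  obtain ⟨γ, hc, -, -, -, rfl⟩ := h
  exact isCompact_Icc.image_of_continuousOn hc

lemma left_mem (h : IsArc A a b) : a ∈ A := by
  obtain ⟨γ, -, -, rfl, -, rfl⟩ := h
  exact ⟨0, by simp, rfl⟩

lemma right_mem (h : IsArc A a b) : b ∈ A := by
  obtain ⟨γ, -, -, -, rfl, rfl⟩ := h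
  exact ⟨1, by simp, rfl⟩

lemma ne (h : IsArc A a b) : a ≠ b := by
  obtain ⟨γ, -, hi, rfl, rfl, -⟩ := h
  exact fun h => zero_ne_one (hi (by simp) (by simp) h)

lemma symm (h : IsArc A a b) : IsArc A b a := by
  obtain ⟨γ, hc, hi, rfl, rfl, rfl⟩ := h
  have hm : MapsTo (fun x : ℝ => 1 - x) (Icc 0 1) (Icc 0 1) := by
    rintro x ⟨h0, h1⟩; constructor <;> linarith
  refine ⟨fun x => γ (1 - x), hc.comp (by fun_prop) hm, ?_, by simp, by simp, ?_⟩
  · intro x hx y hy hxy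
    have := hi (hm hx) (hm hy) hxy
    linarith
  · apply Subset.antisymm
    · rintro _ ⟨x, hx, rfl⟩
      exact ⟨_, hm hx, rfl⟩
    · rintro _ ⟨x, hx, rfl⟩
      exact ⟨1 - x, hm hx, by simp⟩

lemma image (h : IsArc A a b) {g : E → F} (hg : ContinuousOn g A) (hi : InjOn g A) :
    IsArc (g '' A) (g a) (g b) := by
  obtain ⟨γ, hc, hi', rfl, rfl, rfl⟩ := h
  exact ⟨g ∘ γ, hg.comp hc (mapsTo_image _ _), hi.comp hi' (mapsTo_image _ _), rfl, rfl,
    image_comp _ _ _⟩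

lemma joinedIn (h : IsArc A a b) : JoinedIn A a b := by
  obtain ⟨γ, hc, -, rfl, rfl, rfl⟩ := h
  exact JoinedIn.ofLine hc rfl rfl Subset.rfl

lemma isConnected (h : IsArc A a b) : IsConnected A := by
  obtain ⟨γ, hc, -, -, -, rfl⟩ := h
  exact (isConnected_Icc zero_le_one).image _ hc

/-- The open arc is connected and dense in the arc. -/
lemma diff_ends (h : IsArc A a b) : IsConnected (A \ {a, b}) ∧ A ⊆ closure (A \ {a, b}) := by
  obtain ⟨γ, hc, hi, rfl, rfl, rfl⟩ := h
  have h1 : γ '' Icc 0 1 \ {γ 0, γ 1} = γ '' Ioo 0 1 := by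
    rw [← Icc_sdiff_both, hi.image_sdiff_subset (by
      intro x hx; rcases hx with rfl | rfl <;> simp), image_pair]
  rw [h1]
  refine ⟨(isConnected_Ioo zero_lt_one).image _ (hc.mono Ioo_subset_Icc_self), ?_⟩
  rw [← closure_Ioo (zero_ne_one' ℝ)] at hc ⊢
  exact hc.image_closure

lemma trans [T2Space E] (hA : IsArc A a b) (hB : IsArc B b c) (hAB : A ∩ B ⊆ {b}) : IsArc (A ∪ B) a c := by
  obtain ⟨γ, γc, γi, rfl, hγb, rfl⟩ := hA
  obtain ⟨δ, δc, δi, hδb, rfl, rfl⟩ := hB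
  set f : ℝ → E := fun t => if t ≤ 1 then γ t else δ (t - 1) with hf
  have e1 : EqOn f γ (Icc 0 1) := fun t ht => by simp [hf, ht.2]
  have e2 : EqOn f (fun t => δ (t - 1)) (Icc 1 2) := fun t ht => by
    rcases ht.1.eq_or_lt with rfl | h
    · simp [hf, hγb, hδb]
    · simp [hf, not_le.mpr h]
  have hm : MapsTo (fun t : ℝ => t - 1) (Icc 1 2) (Icc 0 1) := by
    rintro x ⟨h0, h1⟩; constructor <;> simp <;> linarith
  have hU : Icc (0:ℝ) 1 ∪ Icc 1 2 = Icc 0 2 := Icc_union_Icc_eq_Icc zero_le_one one_le_two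
  have hfc : ContinuousOn f (Icc 0 2) := by
    rw [← hU]
    exact (γc.congr e1).union_of_isClosed ((δc.comp (by fun_prop) hm).congr e2) isClosed_Icc isClosed_Icc
  have im1 : f '' Icc 0 1 = γ '' Icc 0 1 := e1.image_eq
  have im2 : f '' Icc 1 2 = δ '' Icc 0 1 := by
    rw [e2.image_eq]
    apply Subset.antisymm
    · rintro _ ⟨x, hx, rfl⟩
      exact ⟨_, hm hx, rfl⟩
    · rintro _ ⟨x, hx, rfl⟩
      exact ⟨x + 1, ⟨by linarith [hx.1], by linarith [hx.2]⟩, by simp⟩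
  have i1 : InjOn f (Icc 0 1) := γi.congr e1.symm
  have i2 : InjOn f (Icc 1 2) := by
    intro x hx y hy hxy
    rw [e2 hx, e2 hy] at hxy
    have := δi (hm hx) (hm hy) hxy
    linarith
  have cross : ∀ x ∈ Icc (0:ℝ) 1, ∀ y ∈ Icc (1:ℝ) 2, f x = f y → x = y := by
    intro x hx y hy hxy
    have h1 : f x ∈ γ '' Icc 0 1 := im1 ▸ mem_image_of_mem f hx
    have h2 : f y ∈ δ '' Icc 0 1 := im2 ▸ mem_image_of_mem f hy
    have h3 : f x = b := hAB ⟨h1, hxy ▸ h2⟩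
    have f1 : f 1 = b := by rw [e1 ⟨zero_le_one, le_rfl⟩, hγb]
    have hx1 : x = 1 := i1 hx ⟨zero_le_one, le_rfl⟩ (h3.trans f1.symm)
    have hy1 : y = 1 := i2 hy ⟨le_rfl, one_le_two⟩ (hxy.symm.trans (h3.trans f1.symm))
    rw [hx1, hy1]
  have hfi : InjOn f (Icc 0 2) := by
    rw [← hU]
    rintro x (hx | hx) y (hy | hy) hxy
    · exact i1 hx hy hxy
    · exact cross x hx y hy hxy
    · exact (cross y hy x hx hxy.symm).symm
    · exact i2 hx hy hxy
  have := isArc_image_Icc two_pos hfc hfi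
  rw [← hU, image_union, im1, im2] at this
  convert this using 1
  · simp [hf]
  · simp [hf]; norm_num

end IsArc

namespace IsJordanCurve

variable {J : Set E}

lemma isCompact (h : IsJordanCurve J) : IsCompact J := by
  obtain ⟨f, hc, hi, rfl⟩ := h
  have : range f = f '' Icc 0 1 := by
    apply Subset.antisymm
    · rintro _ ⟨x, rfl⟩
      exact ⟨Int.fract x, ⟨Int.fract_nonneg x, (Int.fract_lt_one x).le⟩,
        (hi _ _).mpr ⟨-⌊x⌋, by push_cast; rw [Int.fract]; ring⟩⟩
    · exact image_subset_range _ _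
  rw [this]
  exact isCompact_Icc.image hc

lemma isConnected (h : IsJordanCurve J) : IsConnected J := by
  obtain ⟨f, hc, -, rfl⟩ := h
  exact isConnected_range hc

lemma image (h : IsJordanCurve J) {g : E → F} (hg : ContinuousOn g J) (hi : InjOn g J) :
    IsJordanCurve (g '' J) := by
  obtain ⟨f, hc, hf, rfl⟩ := h
  refine ⟨g ∘ f, hg.comp_continuous hc (fun x => mem_range_self x), fun s t => ?_, range_comp _ _⟩
  rw [← hf]
  exact hi.eq_iff (mem_range_self _) (mem_range_self _)

lemma injOn_Icc {E : Type*} {f : ℝ → E} (hf : ∀ s t, f s = f t ↔ ∃ n : ℤ, s = t + n) {s t : ℝ}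
    (h : t < s + 1) : InjOn f (Icc s t) := by
  intro x hx y hy hxy
  obtain ⟨n, hn⟩ := (hf x y).mp hxy
  have h1 : (n : ℝ) < 1 := by linarith [hx.2, hy.1]
  have h2 : (-1 : ℝ) < n := by linarith [hx.1, hy.2]
  have h1' : n < 1 := by exact_mod_cast h1
  have h2' : -1 < n := by exact_mod_cast h2
  have : n = 0 := by omega
  simpa [this] using hn

lemma split_aux {f : ℝ → E} (hc : Continuous f)
    (hf : ∀ s t, f s = f t ↔ ∃ n : ℤ, s = t + n) {s t : ℝ} (hst : s < t) (hts : t < s + 1) :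
    IsArc (f '' Icc s t) (f s) (f t) ∧ IsArc (f '' Icc t (s + 1)) (f s) (f t) ∧
      f '' Icc s t ∩ f '' Icc t (s + 1) = {f s, f t} ∧
      range f = f '' Icc s t ∪ f '' Icc t (s + 1) := by
  have hs1 : f (s + 1) = f s := (hf _ _).mpr ⟨1, by simp⟩
  refine ⟨isArc_image_Icc hst hc.continuousOn (injOn_Icc hf hts), ?_, ?_, ?_⟩
  · have := isArc_image_Icc hts hc.continuousOn (injOn_Icc hf (by linarith))
    rw [hs1] at this
    exact this.symm
  · apply Subset.antisymm
    · rintro _ ⟨⟨x, hx, rfl⟩, y, hy, hxy⟩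
      obtain ⟨n, hn⟩ := (hf y x).mp hxy
      have h1 : (n : ℝ) ≤ 1 := by linarith [hx.1, hy.2]
      have h2 : (0 : ℝ) ≤ n := by linarith [hx.2, hy.1]
      have h1' : n ≤ 1 := by exact_mod_cast h1
      have h2' : 0 ≤ n := by exact_mod_cast h2
      have h3 : n = 0 ∨ n = 1 := by omega
      rcases h3 with rfl | rfl
      · right
        have : x = t := by
          have := hx.2; have := hy.1; simp at hn; linarith
        simp [this]
      · left
        have : x = s := by
          have := hx.1; have := hy.2; simp at hn; linarith
        rw [this]
    · rintro z (rfl | rfl)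
      · exact ⟨⟨s, ⟨le_rfl, hst.le⟩, rfl⟩, s + 1, ⟨hts.le, le_rfl⟩, hs1⟩
      · exact ⟨⟨t, ⟨hst.le, le_rfl⟩, rfl⟩, t, ⟨le_rfl, hts.le⟩, rfl⟩
  · rw [← image_union, Icc_union_Icc_eq_Icc hst.le hts.le]
    apply Subset.antisymm
    · rintro _ ⟨x, rfl⟩
      refine ⟨s + Int.fract (x - s), ⟨by linarith [Int.fract_nonneg (x - s)],
        by linarith [Int.fract_lt_one (x - s)]⟩, (hf _ _).mpr ⟨-⌊x - s⌋, ?_⟩⟩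
      push_cast; rw [Int.fract]; ring
    · exact image_subset_range _ _

/-- A Jordan curve splits at two points into two arcs. -/
lemma split (h : IsJordanCurve J) {p q : E} (hp : p ∈ J) (hq : q ∈ J) (hpq : p ≠ q) :
    ∃ A B, IsArc A p q ∧ IsArc B p q ∧ A ∩ B = {p, q} ∧ J = A ∪ B := by
  obtain ⟨f, hc, hf, rfl⟩ := h
  obtain ⟨s, rfl⟩ := hp
  obtain ⟨t, rfl⟩ := hq
  set t' := s + Int.fract (t - s) with ht'
  have e : f t' = f t := (hf _ _).mpr ⟨-⌊t - s⌋, by push_cast; rw [ht', Int.fract]; ring⟩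
  have h1 : t' < s + 1 := by linarith [Int.fract_lt_one (t - s)]
  have h2 : s < t' := by
    rcases (Int.fract_nonneg (t - s)).eq_or_lt with h | h
    · exfalso; apply hpq; rw [← e, ht', ← h, add_zero]
    · linarith
  have := split_aux hc hf h2 h1
  rw [e] at this
  exact ⟨_, _, this⟩

/-- A point of a Jordan curve has arbitrarily small arc neighbourhoods. -/
lemma small_arc (h : IsJordanCurve J) {p : E} (hp : p ∈ J) {U : Set E} (hU : U ∈ 𝓝 p) :
    ∃ A B a b, IsArc A a b ∧ IsArc B a b ∧ A ∩ B = {a, b} ∧ J = A ∪ B ∧ p ∈ B \ {a, b} ∧ B ⊆ U := by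
  obtain ⟨f, hc, hf, rfl⟩ := h
  obtain ⟨s, rfl⟩ := hp
  obtain ⟨δ, hδ, hball⟩ := Metric.mem_nhds_iff.mp (hc.continuousAt.preimage_mem_nhds hU)
  set η := min (δ / 2) (1 / 4)
  have hη : 0 < η := lt_min (by linarith) (by norm_num)
  have hη1 : η ≤ 1 / 4 := min_le_right _ _
  have hη2 : η ≤ δ / 2 := min_le_left _ _
  have h := split_aux hc hf (s := s - η) (t := s + η) (by linarith) (by linarith)
  refine ⟨_, _, _, _, h.2.1, h.1, by rw [inter_comm]; exact h.2.2.1,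
    by rw [union_comm]; exact h.2.2.2, ⟨⟨s, ⟨by linarith, by linarith⟩, rfl⟩, ?_⟩, ?_⟩
  · have inj := injOn_Icc hf (s := s - η) (t := s + η) (by linarith)
    rintro (h | h)
    · have := inj ⟨by linarith, by linarith⟩ ⟨by linarith, by linarith⟩ h
      linarith
    · have := inj ⟨by linarith, by linarith⟩ ⟨by linarith, by linarith⟩ h
      linarith
  · rintro _ ⟨x, hx, rfl⟩
    apply hball
    rw [mem_ball, Real.dist_eq, abs_lt]
    constructor <;> linarith [hx.1, hx.2]

end IsJordanCurve

/-- Two arcs that only share their endpoints form a Jordan curve. -/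
lemma IsArc.union_isJordanCurve {A B : Set E} {a b : E} (hA : IsArc A a b) (hB : IsArc B a b)
    (hAB : A ∩ B ⊆ {a, b}) : IsJordanCurve (A ∪ B) := by
  obtain ⟨γ, γc, γi, rfl, rfl, rfl⟩ := hA
  obtain ⟨δ, δc, δi, hδ0, hδ1, rfl⟩ := hB
  set f : ℝ → E := fun t => if t ≤ 1/2 then γ (2 * t) else δ (2 - 2 * t) with hf
  have m1 : MapsTo (fun t : ℝ => 2 * t) (Icc 0 (1/2)) (Icc 0 1) := by
    rintro x ⟨h0, h1⟩; constructor <;> simp only <;> linarith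
  have m2 : MapsTo (fun t : ℝ => 2 - 2 * t) (Icc (1/2) 1) (Icc 0 1) := by
    rintro x ⟨h0, h1⟩; constructor <;> simp only <;> linarith
  have e1 : EqOn f (fun t => γ (2 * t)) (Icc 0 (1/2)) := fun t ht => if_pos ht.2
  have e2 : EqOn f (fun t => δ (2 - 2 * t)) (Icc (1/2) 1) := fun t ht => by
    rcases ht.1.eq_or_lt with rfl | h
    · simp only [hf, le_refl, if_true]; norm_num; exact hδ1.symm
    · simp only [hf, if_neg (not_le.mpr h)]
  have hU : Icc (0:ℝ) (1/2) ∪ Icc (1/2) 1 = Icc 0 1 :=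
    Icc_union_Icc_eq_Icc (by norm_num) (by norm_num)
  have hfc : ContinuousOn f (Icc 0 1) := by
    rw [← hU]
    exact ((γc.comp (by fun_prop) m1).congr e1).union_of_isClosed
      ((δc.comp (by fun_prop) m2).congr e2) isClosed_Icc isClosed_Icc
  have f0 : f 0 = γ 0 := by simp [hf]
  have f1 : f 1 = γ 0 := by rw [e2 ⟨by norm_num, le_rfl⟩, ← hδ0]; norm_num
  have cross : ∀ x ∈ Icc (0:ℝ) (1/2), ∀ y ∈ Ioo (1/2:ℝ) 1, f x ≠ f y := by
    intro x hx y hy hxy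
    have hy' : y ∈ Icc (1/2:ℝ) 1 := Ioo_subset_Icc_self hy
    rw [e1 hx, e2 hy'] at hxy
    have h3 : δ (2 - 2 * y) ∈ ({γ 0, γ 1} : Set E) := hAB ⟨⟨_, m1 hx, hxy⟩, ⟨_, m2 hy', rfl⟩⟩
    rcases h3 with h | h
    · have := δi (m2 hy') (by simp) (h.trans hδ0.symm)
      simp only at this; linarith [hy.2]
    · have := δi (m2 hy') (by simp) ((mem_singleton_iff.mp h).trans hδ1.symm)
      simp only at this; linarith [hy.1]
  have hinj : ∀ x ∈ Ico (0:ℝ) 1, ∀ y ∈ Ico (0:ℝ) 1, f x = f y → x = y := by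
    intro x hx y hy hxy
    rcases le_or_gt x (1/2) with h | h <;> rcases le_or_gt y (1/2) with h' | h'
    · rw [e1 ⟨hx.1, h⟩, e1 ⟨hy.1, h'⟩] at hxy
      have := γi (m1 ⟨hx.1, h⟩) (m1 ⟨hy.1, h'⟩) hxy
      simp only at this; linarith
    · exact absurd hxy (cross x ⟨hx.1, h⟩ y ⟨h', hy.2⟩)
    · exact absurd hxy.symm (cross y ⟨hy.1, h'⟩ x ⟨h, hx.2⟩)
    · rw [e2 ⟨h.le, hx.2.le⟩, e2 ⟨h'.le, hy.2.le⟩] at hxy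
      have := δi (m2 ⟨h.le, hx.2.le⟩) (m2 ⟨h'.le, hy.2.le⟩) hxy
      simp only at this; linarith
  refine ⟨fun x => f (Int.fract x), hfc.comp_fract'' (by rw [f0, f1]), fun s t => ?_, ?_⟩
  · constructor
    · intro h
      have := hinj _ ⟨Int.fract_nonneg s, Int.fract_lt_one s⟩ _
        ⟨Int.fract_nonneg t, Int.fract_lt_one t⟩ h
      obtain ⟨n, hn⟩ := Int.fract_eq_fract.mp this
      exact ⟨n, by linarith⟩
    · rintro ⟨n, rfl⟩
      simp
  · apply Subset.antisymm
    · rintro _ ⟨x, rfl⟩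
      have hx : Int.fract x ∈ Icc (0:ℝ) 1 := ⟨Int.fract_nonneg x, (Int.fract_lt_one x).le⟩
      rw [← hU] at hx
      rcases hx with hx | hx
      · left; exact ⟨_, m1 hx, (e1 hx).symm⟩
      · right; exact ⟨_, m2 hx, (e2 hx).symm⟩
    · rintro _ (⟨x, hx, rfl⟩ | ⟨x, hx, rfl⟩)
      · refine ⟨x / 2, ?_⟩
        have : Int.fract (x / 2) = x / 2 :=
          Int.fract_eq_self.mpr ⟨by linarith [hx.1], by linarith [hx.2]⟩
        simp only [this]
        rw [e1 ⟨by linarith [hx.1], by linarith [hx.2]⟩]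
        ring_nf
      · rcases hx.1.eq_or_lt with rfl | h0
        · exact ⟨0, by simp [f0, hδ0]⟩
        · refine ⟨1 - x / 2, ?_⟩
          have : Int.fract (1 - x / 2) = 1 - x / 2 :=
            Int.fract_eq_self.mpr ⟨by linarith [hx.2], by linarith⟩
          simp only [this]
          rw [e2 ⟨by linarith [hx.2], by linarith⟩]
          ring_nf

end Arcs

lemma JoinedIn.exists_connected {X : Type*} [TopologicalSpace X] {W : Set X} {x y : X}
    (h : JoinedIn W x y) : ∃ P, IsCompact P ∧ IsConnected P ∧ P ⊆ W ∧ x ∈ P ∧ y ∈ P := by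
  obtain ⟨γ, hγ⟩ := h
  exact ⟨range γ, isCompact_range γ.continuous, isConnected_range γ.continuous,
    range_subset_iff.mpr hγ, ⟨0, γ.source⟩, ⟨1, γ.target⟩⟩

lemma exists_compact_connected_between {W N : Set ℂ} (hW : IsOpen W) (hW' : IsPathConnected W)
    (hN : IsCompact N) (hNW : N ⊆ W) : ∃ M, IsCompact M ∧ IsConnected M ∧ N ⊆ M ∧ M ⊆ W := by
  obtain ⟨x₀, hx₀⟩ := hW'.nonempty
  suffices H : ∃ M, IsCompact M ∧ IsConnected M ∧ N ⊆ M ∧ M ⊆ W ∧ x₀ ∈ M by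
    obtain ⟨M, h1, h2, h3, h4, -⟩ := H; exact ⟨M, h1, h2, h3, h4⟩
  refine hN.induction_on (p := fun N => ∃ M, IsCompact M ∧ IsConnected M ∧ N ⊆ M ∧ M ⊆ W ∧ x₀ ∈ M)
    ?_ ?_ ?_ ?_
  · exact ⟨{x₀}, isCompact_singleton, isConnected_singleton, empty_subset _,
      singleton_subset_iff.mpr hx₀, rfl⟩
  · rintro s t hst ⟨M, h1, h2, h3, h4⟩
    exact ⟨M, h1, h2, hst.trans h3, h4⟩
  · rintro s t ⟨M, h1, h2, h3, h4, h5⟩ ⟨M', h1', h2', h3', h4', h5'⟩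
    exact ⟨M ∪ M', h1.union h1', h2.union ⟨x₀, h5, h5'⟩ h2', union_subset_union h3 h3',
      union_subset h4 h4', Or.inl h5⟩
  · intro x hx
    obtain ⟨r, hr, hball⟩ := Metric.nhds_basis_closedBall.mem_iff.mp (hW.mem_nhds (hNW hx))
    obtain ⟨P, P1, P2, P3, P4, P5⟩ := (hW'.joinedIn x₀ hx₀ x (hNW hx)).exists_connected
    refine ⟨closedBall x r, mem_nhdsWithin_of_mem_nhds (closedBall_mem_nhds x hr),
      P ∪ closedBall x r, P1.union (isCompact_closedBall x r), P2.union
      ⟨x, P5, mem_closedBall_self hr.le⟩ ?_, subset_union_right, union_subset P3 hball, Or.inl P4⟩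
    exact ((convex_closedBall x r).isPathConnected ⟨x, mem_closedBall_self hr.le⟩).isConnected

/-- A continuous nonvanishing function on an arc has a logarithm. -/
lemma IsArc.hasLog {E : Type*} [TopologicalSpace E] [T2Space E] {A : Set E} {a b : E}
    (hA : IsArc A a b) {f : E → ℂ} (hf : ContinuousOn f A) (h0 : ∀ z ∈ A, f z ≠ 0) :
    HasLog A f := by
  obtain ⟨γ, hc, hi, -, -, rfl⟩ := hA
  exact HasLog.image isCompact_Icc hc hi (hasLog_Icc (hf.comp hc (mapsTo_image _ _))
    fun t ht => h0 _ ⟨t, ht, rfl⟩)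

lemma joinedIn_compl_of_hasLog {K : Set ℂ} (hK : IsCompact K)
    (h : ∀ f : ℂ → ℂ, ContinuousOn f K → (∀ z ∈ K, f z ≠ 0) → HasLog K f) {a b : ℂ} (ha : a ∉ K)
    (hb : b ∉ K) : JoinedIn Kᶜ a b := by
  have hne : ∀ c, c ∉ K → ∀ z ∈ K, z - c ≠ 0 := fun c hc z hz h => hc (by rwa [← sub_eq_zero.mp h])
  refine joinedIn_of_hasLog_div hK ha hb (h _ ?_ fun z hz => div_ne_zero (hne a ha z hz) (hne b hb z hz))
  exact (continuousOn_id.sub continuousOn_const).div (continuousOn_id.sub continuousOn_const)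
    (hne b hb)

lemma IsArc.joinedIn_compl {A : Set ℂ} {a b : ℂ} (hA : IsArc A a b) {x y : ℂ} (hx : x ∉ A)
    (hy : y ∉ A) : JoinedIn Aᶜ x y :=
  joinedIn_compl_of_hasLog hA.isCompact (fun _ h1 h2 => hA.hasLog h1 h2) hx hy

lemma IsJordanCurve.exists_not_joinedIn {J : Set ℂ} (hJ : IsJordanCurve J) :
    ∃ x ∉ J, ∃ y ∉ J, ¬ JoinedIn Jᶜ x y := by
  by_contra! hcon
  obtain ⟨p, hp, q, hq, hpq⟩ : ∃ p ∈ J, ∃ q ∈ J, p ≠ q := by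
    obtain ⟨f, hc, hf, rfl⟩ := hJ
    refine ⟨f 0, ⟨0, rfl⟩, f (1/2), ⟨_, rfl⟩, fun h => ?_⟩
    obtain ⟨n, hn⟩ := (hf _ _).mp h
    have h2 : (0:ℝ) = 1 + 2 * n := by linarith
    have : (0:ℤ) = 1 + 2 * n := by exact_mod_cast h2
    omega
  obtain ⟨A, B, hA, hB, hAB, rfl⟩ := hJ.split hp hq hpq
  have hconn : IsPathConnected (A ∪ B)ᶜ := by
    obtain ⟨x, hx⟩ := outside_nonempty hJ.isCompact.isBounded
    exact ⟨x, hx.1, fun {y} hy => hcon x hx.1 y hy⟩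
  set r := dist p q / 2 with hr
  have hr0 : 0 < r := by have := dist_pos.mpr hpq; linarith
  have hrq : r < dist p q := by linarith
  have hnp : ∀ z ∈ sphere p r, z ∉ A ∩ B := by
    intro z hz hzAB
    rw [hAB] at hzAB
    rcases hzAB with rfl | rfl
    · simp at hz; linarith
    · rw [mem_sphere, dist_comm] at hz; linarith
  set K₁ := sphere p r ∩ {z | infDist z B ≤ infDist z A}
  set K₂ := sphere p r ∩ {z | infDist z A ≤ infDist z B}
  have cK₁ : IsCompact K₁ := (isCompact_sphere p r).inter_right
    (isClosed_le (continuous_infDist_pt B) (continuous_infDist_pt A))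
  have cK₂ : IsCompact K₂ := (isCompact_sphere p r).inter_right
    (isClosed_le (continuous_infDist_pt A) (continuous_infDist_pt B))
  have memA : ∀ z, infDist z A ≤ 0 → z ∈ A := fun z hz =>
    (hA.isCompact.isClosed.mem_iff_infDist_zero ⟨_, hA.left_mem⟩).mpr (le_antisymm hz infDist_nonneg)
  have memB : ∀ z, infDist z B ≤ 0 → z ∈ B := fun z hz =>
    (hB.isCompact.isClosed.mem_iff_infDist_zero ⟨_, hB.left_mem⟩).mpr (le_antisymm hz infDist_nonneg)
  have d₁ : ∀ z ∈ K₁, z ∉ A := fun z hz hzA => hnp z hz.1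
    ⟨hzA, memB z (hz.2.trans (infDist_zero_of_mem hzA).le)⟩
  have d₂ : ∀ z ∈ K₂, z ∉ B := fun z hz hzB => hnp z hz.1
    ⟨memA z (hz.2.trans (infDist_zero_of_mem hzB).le), hzB⟩
  obtain ⟨M, M1, M2, M3, M4⟩ := exists_compact_connected_between
    (hJ.isCompact.isClosed.isOpen_compl) hconn (cK₁.inter_right cK₂.isClosed)
    (fun z hz => fun h => h.elim (d₁ z hz.1) (d₂ z hz.2))
  have j₁ : JoinedIn (K₁ ∪ M)ᶜ p q := hA.joinedIn.mono fun z hz h =>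
    h.elim (fun h => d₁ z h hz) (fun h => M4 h (Or.inl hz))
  have j₂ : JoinedIn (K₂ ∪ M)ᶜ p q := hB.joinedIn.mono fun z hz h =>
    h.elim (fun h => d₂ z h hz) (fun h => M4 h (Or.inr hz))
  have hinter : (K₁ ∪ M) ∩ (K₂ ∪ M) = M := by
    rw [← inter_union_distrib_right]; exact union_eq_right.mpr M3
  have hlog := (hasLog_div_of_joinedIn (cK₁.union M1).isClosed j₁).union (cK₁.union M1).isClosed
    (cK₂.union M1).isClosed (by rw [hinter]; exact M2.isPreconnected)
    (hasLog_div_of_joinedIn (cK₂.union M1).isClosed j₂)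
  have hs : sphere p r ⊆ (K₁ ∪ M) ∪ (K₂ ∪ M) := fun z hz =>
    (le_total (infDist z B) (infDist z A)).elim (fun h => Or.inl (Or.inl ⟨hz, h⟩))
      (fun h => Or.inr (Or.inl ⟨hz, h⟩))
  have hq0 : ∀ z ∈ closedBall p r, z - q ≠ 0 := by
    intro z hz h
    rw [sub_eq_zero] at h
    subst h
    rw [mem_closedBall, dist_comm] at hz
    linarith
  have hlog2 : HasLog (sphere p r) (fun z => z - q) :=
    (hasLog_closedBall hr0 (by fun_prop) hq0).mono sphere_subset_closedBall
  refine one_ne_zero (not_hasLog_sphere hr0 (n := 1) (((hlog.mono hs).mul hlog2).congr ?_))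
  intro z hz
  have := hq0 z (sphere_subset_closedBall hz)
  simp only [zpow_one]
  field_simp

lemma IsJordanCurve.inside_nonempty {J : Set ℂ} (hJ : IsJordanCurve J) : (inside J).Nonempty := by
  obtain ⟨x, hx, y, hy, hxy⟩ := hJ.exists_not_joinedIn
  have hx' : x ∈ Jᶜ := hx
  have hy' : y ∈ Jᶜ := hy
  rw [compl_eq_inside_union_outside] at hx' hy'
  rcases hx' with h | h
  · exact ⟨x, h⟩
  rcases hy' with h' | h'
  · exact ⟨y, h'⟩
  exact absurd (joinedIn_of_mem_outside hJ.isCompact.isBounded h h') hxy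

lemma exists_ne_mem_jordan {J : Set ℂ} (hJ : IsJordanCurve J) {p : ℂ} : ∃ q ∈ J, p ≠ q := by
  obtain ⟨f, hc, hf, rfl⟩ := hJ
  by_contra! h
  have := (h (f 0) ⟨0, rfl⟩).symm.trans (h (f (1/2)) ⟨_, rfl⟩)
  obtain ⟨n, hn⟩ := (hf _ _).mp this
  have h2 : (0:ℝ) = 1 + 2 * n := by linarith
  have : (0:ℤ) = 1 + 2 * n := by exact_mod_cast h2
  omega

/-- Logarithms of the two halves of a Jordan curve and the resulting winding number. -/
lemma exists_winding {A B : Set ℂ} {p q a : ℂ} (hA : IsArc A p q) (hB : IsArc B p q)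
    (ha : a ∉ A ∪ B) : ∃ h k : ℂ → ℂ, ∃ n : ℤ, ContinuousOn h A ∧ ContinuousOn k B ∧
      (∀ z ∈ A, Complex.exp (h z) = z - a) ∧ (∀ z ∈ B, Complex.exp (k z) = z - a) ∧
      h p = k p ∧ h q = k q + n * (2 * Real.pi * Complex.I) := by
  have hne : ∀ z ∈ A ∪ B, z - a ≠ 0 := fun z hz h => ha (by rwa [← sub_eq_zero.mp h])
  obtain ⟨h, hc, he⟩ := hA.hasLog (f := fun z => z - a) (by fun_prop) (fun z hz => hne z (Or.inl hz))
  obtain ⟨k, kc, ke⟩ := hB.hasLog (f := fun z => z - a) (by fun_prop) (fun z hz => hne z (Or.inr hz))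
  have e : Complex.exp (k p - h p) = 1 := by
    rw [Complex.exp_sub, he p hA.left_mem, ke p hB.left_mem, div_self (hne p (Or.inl hA.left_mem))]
  obtain ⟨n, hn⟩ := Complex.exp_eq_exp_iff_exists_int.mp
    (show Complex.exp (h q + (k p - h p)) = Complex.exp (k q) by
      rw [Complex.exp_add, e, mul_one, he q hA.right_mem, ke q hB.right_mem])
  refine ⟨fun z => h z + (k p - h p), k, n, hc.add continuousOn_const, kc, fun z hz => ?_, ke,
    by ring, hn⟩
  rw [Complex.exp_add, e, mul_one, he z hz]

lemma IsJordanCurve.joinedIn_inside {J : Set ℂ} (hJ : IsJordanCurve J) {a b : ℂ}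
    (ha : a ∈ inside J) (hb : b ∈ inside J) : JoinedIn Jᶜ a b := by
  by_contra hab
  obtain ⟨p, hp⟩ := hJ.isConnected.nonempty
  obtain ⟨q, hq, hpq⟩ := exists_ne_mem_jordan hJ (p := p)
  obtain ⟨A, B, hA, hB, hAB, rfl⟩ := hJ.split hp hq hpq
  obtain ⟨h₁, k₁, n₁, h₁c, k₁c, h₁e, k₁e, hp₁, hq₁⟩ := exists_winding hA hB ha.1
  obtain ⟨h₂, k₂, n₂, h₂c, k₂c, h₂e, k₂e, hp₂, hq₂⟩ := exists_winding hA hB hb.1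
  have glue : ∀ m l : ℤ, m * n₁ + l * n₂ = 0 →
      HasLog (A ∪ B) (fun z => (z - a) ^ m * (z - b) ^ l) := by
    classical
    intro m l hml
    have hml' : (m : ℂ) * n₁ + l * n₂ = 0 := by exact_mod_cast hml
    set H : ℂ → ℂ := fun z => m * h₁ z + l * h₂ z
    set L : ℂ → ℂ := fun z => m * k₁ z + l * k₂ z
    have hHL : ∀ z ∈ A ∩ B, H z = L z := by
      rw [hAB]
      rintro z (rfl | rfl)
      · simp only [H, L, hp₁, hp₂]
      · simp only [H, L, hq₁, hq₂]
        linear_combination (2 * Real.pi * Complex.I) * hml'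
    have e1 : EqOn (A.piecewise H L) H A := fun z hz => by simp [hz]
    have e2 : EqOn (A.piecewise H L) L B := fun z hz => by
      by_cases hzA : z ∈ A
      · simp [hzA, hHL z ⟨hzA, hz⟩]
      · simp [hzA]
    refine ⟨A.piecewise H L, ContinuousOn.union_of_isClosed
      (((continuousOn_const.mul h₁c).add (continuousOn_const.mul h₂c)).congr e1)
      (((continuousOn_const.mul k₁c).add (continuousOn_const.mul k₂c)).congr e2)
      hA.isCompact.isClosed hB.isCompact.isClosed, ?_⟩
    rintro z (hz | hz)
    · rw [e1 hz]
      simp only [H, Complex.exp_add, Complex.exp_int_mul, h₁e z hz, h₂e z hz]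
    · rw [e2 hz]
      simp only [L, Complex.exp_add, Complex.exp_int_mul, k₁e z hz, k₂e z hz]
  have hnb : ∀ z ∈ pathComponentIn (A ∪ B)ᶜ a ∪ (A ∪ B), z - b ≠ 0 := by
    intro z hz h
    rw [sub_eq_zero] at h
    subst h
    exact hz.elim hab hb.1
  have hn₂ : n₂ = 0 := zpow_eq_zero_of_hasLog hJ.isCompact.isClosed ha
    (g := fun z => (z - b) ^ (-n₁))
    ((continuousOn_id.sub continuousOn_const).zpow₀ _ fun z hz => Or.inl (hnb z hz))
    (fun z hz => zpow_ne_zero _ (hnb z hz)) (glue n₂ (-n₁) (by ring))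
  have := zpow_eq_zero_of_hasLog hJ.isCompact.isClosed hb (g := fun _ => 1) continuousOn_const
    (by simp) (n := 1) ((glue 0 1 (by simp [hn₂])).congr fun z _ => by simp)
  exact one_ne_zero this

lemma pathComponentIn_subset_inside {K : Set ℂ} {a : ℂ} (ha : a ∈ inside K) :
    pathComponentIn Kᶜ a ⊆ inside K := fun _ h => JoinedIn.mem_inside h ha

lemma JoinedIn.pathComponentIn' {X : Type*} [TopologicalSpace X] {W : Set X} {x y : X}
    (h : JoinedIn W x y) : JoinedIn (pathComponentIn W x) x y := by
  have hx := mem_pathComponentIn_self h.source_mem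
  exact (isPathConnected_pathComponentIn h.source_mem).joinedIn x hx y h

lemma JoinedIn.inside {K : Set ℂ} {a b : ℂ} (h : JoinedIn Kᶜ a b) (ha : a ∈ inside K) :
    JoinedIn (inside K) a b := h.pathComponentIn'.mono (pathComponentIn_subset_inside ha)

lemma JoinedIn.outside {K : Set ℂ} {a b : ℂ} (h : JoinedIn Kᶜ a b) (ha : a ∈ outside K) :
    JoinedIn (outside K) a b := h.pathComponentIn'.mono fun _ h => JoinedIn.mem_outside h ha

lemma IsJordanCurve.isPathConnected_inside {J : Set ℂ} (hJ : IsJordanCurve J) :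
    IsPathConnected (inside J) := by
  obtain ⟨a, ha⟩ := hJ.inside_nonempty
  exact ⟨a, ha, fun _ hb => (hJ.joinedIn_inside ha hb).inside ha⟩

lemma isPathConnected_outside {K : Set ℂ} (hK : Bornology.IsBounded K) :
    IsPathConnected (outside K) := by
  obtain ⟨a, ha⟩ := outside_nonempty hK
  exact ⟨a, ha, fun _ hb => (joinedIn_of_mem_outside hK ha hb).outside ha⟩

/-- A connected set that leaves a component of `Kᶜ` meets `K` in the closure of the component. -/
lemma exists_mem_closure_of_joinedIn {K S : Set ℂ} (hK : IsClosed K) {x y : ℂ}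
    (h : JoinedIn S x y) (hx : x ∉ K) (hy : ¬ JoinedIn Kᶜ x y) :
    ∃ z ∈ K ∩ S, z ∈ closure (pathComponentIn Kᶜ x) := by
  obtain ⟨P, -, P2, P3, P4, P5⟩ := h.exists_connected
  by_contra! hcon
  set U := pathComponentIn Kᶜ x
  have hUo : IsOpen U := hK.isOpen_compl.pathComponentIn x
  have hcl : closure U ⊆ U ∪ K :=
    closure_minimal subset_union_left (isClosed_pathComponentIn_union hK x)
  have hsub : P ⊆ U ∪ (closure U)ᶜ := by
    intro z hz
    by_cases hzc : z ∈ closure U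
    · rcases hcl hzc with h | h
      · exact Or.inl h
      · exact absurd hzc (hcon z ⟨h, P3 hz⟩)
    · exact Or.inr hzc
  have := P2.isPreconnected.subset_left_of_subset_union hUo isClosed_closure.isOpen_compl
    (disjoint_compl_right.mono_right (compl_subset_compl.mpr subset_closure)) hsub
    ⟨x, P4, mem_pathComponentIn_self hx⟩
  exact hy (this P5)

lemma IsJordanCurve.subset_closure {J : Set ℂ} (hJ : IsJordanCurve J) :
    J ⊆ closure (inside J) ∧ J ⊆ closure (outside J) := by
  obtain ⟨x, hx⟩ := hJ.inside_nonempty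
  obtain ⟨y, hy⟩ := outside_nonempty hJ.isCompact.isBounded
  have hxy : ¬ JoinedIn Jᶜ x y := fun h =>
    disjoint_left.mp (disjoint_inside_outside J) (h.mem_inside hx) hy
  have key : ∀ w ∈ J, ∀ ε > 0, ∃ z ∈ ball w ε, z ∈ closure (pathComponentIn Jᶜ x) ∧
      ∃ z ∈ ball w ε, z ∈ closure (pathComponentIn Jᶜ y) := by
    intro w hw ε hε
    obtain ⟨A, B, a, b, hA, hB, -, hJAB, -, hBU⟩ := hJ.small_arc hw (ball_mem_nhds w hε)
    have hAJ : A ⊆ J := hJAB ▸ subset_union_left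
    have hj := hA.joinedIn_compl (fun h => hx.1 (hAJ h)) (fun h => hy.1 (hAJ h))
    have hin : ∀ z ∈ J ∩ Aᶜ, z ∈ ball w ε := by
      rintro z ⟨hz, hzA⟩
      rw [hJAB] at hz
      exact hBU (hz.resolve_left hzA)
    obtain ⟨z, hz, hz'⟩ := exists_mem_closure_of_joinedIn hJ.isCompact.isClosed hj hx.1 hxy
    obtain ⟨u, hu, hu'⟩ := exists_mem_closure_of_joinedIn hJ.isCompact.isClosed hj.symm hy.1
      (fun h => hxy h.symm)
    exact ⟨z, hin z hz, hz', u, hin u hu, hu'⟩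
  constructor
  · intro w hw
    rw [← closure_closure, Metric.mem_closure_iff]
    intro ε hε
    obtain ⟨z, hz, hz', -⟩ := key w hw ε hε
    exact ⟨z, closure_mono (pathComponentIn_subset_inside hx) hz', by rwa [dist_comm]⟩
  · intro w hw
    rw [← closure_closure, Metric.mem_closure_iff]
    intro ε hε
    obtain ⟨-, -, -, z, hz, hz'⟩ := key w hw ε hε
    exact ⟨z, closure_mono (fun _ h => JoinedIn.mem_outside h hy) hz', by rwa [dist_comm]⟩

lemma IsJordanCurve.closure_inside {J : Set ℂ} (hJ : IsJordanCurve J) :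
    closure (inside J) = fill J :=
  Subset.antisymm (closure_minimal subset_union_right (isClosed_fill hJ.isCompact.isClosed))
    (union_subset hJ.subset_closure.1 _root_.subset_closure)

/-- The bounded domain of a Jordan curve is the image of the open disk under any embedding of
the closed disk extending a parametrization. -/
lemma image_ball_eq_inside {f : ℂ → ℂ} (hf : ContinuousOn f (closedBall 0 1))
    (hi : InjOn f (closedBall 0 1)) : IsJordanCurve (f '' sphere 0 1) ∧
      f '' ball 0 1 = inside (f '' sphere 0 1) ∧ f '' closedBall 0 1 = fill (f '' sphere 0 1) := by
  have hJ : IsJordanCurve (f '' sphere 0 1) := by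
    have hs : IsJordanCurve (sphere (0:ℂ) 1) := by
      refine ⟨fun t => Complex.exp (t * (2 * Real.pi * Complex.I)), by fun_prop, fun s t => ?_, ?_⟩
      · rw [Complex.exp_eq_exp_iff_exists_int]
        refine exists_congr fun n => ?_
        rw [← add_mul, mul_left_inj' Complex.two_pi_I_ne_zero]
        exact_mod_cast Iff.rfl
      · ext z
        simp only [mem_range, mem_sphere, dist_zero_right]
        constructor
        · rintro ⟨t, rfl⟩
          have : (t : ℂ) * (2 * Real.pi * Complex.I) = ((t * (2 * Real.pi) : ℝ) : ℂ) * Complex.I := by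
            push_cast; ring
          rw [this, Complex.norm_exp_ofReal_mul_I]
        · intro hz
          refine ⟨z.arg / (2 * Real.pi), ?_⟩
          have := Complex.norm_mul_exp_arg_mul_I z
          rw [hz] at this
          rw [show ((z.arg / (2 * Real.pi) : ℝ) : ℂ) * (2 * Real.pi * Complex.I) = z.arg * Complex.I by
            push_cast; field_simp]
          simpa using this
    exact hs.image (hf.mono sphere_subset_closedBall) (hi.mono sphere_subset_closedBall)
  set K := f '' sphere 0 1
  have hD : IsCompact (f '' closedBall 0 1) := (isCompact_closedBall 0 1).image_of_continuousOn hf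
  have hKD : K ⊆ f '' closedBall 0 1 := image_mono sphere_subset_closedBall
  have h1 : inside K ⊆ f '' closedBall 0 1 := by
    intro b hb
    by_contra hbD
    obtain ⟨y, hy⟩ := outside_nonempty hD.isBounded
    have hj : JoinedIn (f '' closedBall 0 1)ᶜ b y := joinedIn_compl_of_hasLog hD (fun g g1 g2 =>
      HasLog.image (isCompact_closedBall 0 1) hf hi (hasLog_closedBall one_pos
        (g1.comp hf (mapsTo_image _ _)) fun z hz => g2 _ ⟨z, hz, rfl⟩)) hbD hy.1
    have hbo : b ∈ outside (f '' closedBall 0 1) := hj.symm.mem_outside hy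
    exact hbo.2 (hb.2.subset (pathComponentIn_mono (compl_subset_compl.mpr hKD)))
  have hbK : f '' ball 0 1 ⊆ Kᶜ := by
    rintro _ ⟨x, hx, rfl⟩ ⟨y, hy, hxy⟩
    have := hi (sphere_subset_closedBall hy) (ball_subset_closedBall hx) hxy
    subst this
    simp at hx hy; linarith
  have h2 : inside K ⊆ f '' ball 0 1 := by
    intro b hb
    obtain ⟨x, hx, rfl⟩ := h1 hb
    rw [← ball_union_sphere] at hx
    rcases hx with hx | hx
    · exact ⟨x, hx, rfl⟩
    · exact absurd ⟨x, hx, rfl⟩ hb.1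
  have h3 : f '' ball 0 1 = inside K := by
    refine Subset.antisymm ?_ h2
    obtain ⟨b, hb⟩ := hJ.inside_nonempty
    have hp : IsPathConnected (f '' ball 0 1) :=
      ((convex_ball (0:ℂ) 1).isPathConnected ⟨0, by simp⟩).image' (hf.mono ball_subset_closedBall)
    intro z hz
    exact ((hp.joinedIn b (h2 hb) z hz).mono hbK).mem_inside hb
  refine ⟨hJ, h3, ?_⟩
  rw [fill, ← h3, ← image_union, union_comm, ball_union_sphere]

lemma outside_subset_outside {J K : Set ℂ} (h : K ⊆ fill J) : outside J ⊆ outside K := by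
  intro z hz
  have hoK : outside J ⊆ Kᶜ := fun w hw hwK => by
    have := h hwK
    rw [fill_eq_compl_outside] at this
    exact this hw
  refine ⟨hoK hz, fun hb => hz.2 (hb.subset fun w hw => ?_)⟩
  exact (JoinedIn.outside hw hz).mono hoK

lemma fill_subset_fill {J K : Set ℂ} (h : K ⊆ fill J) : fill K ⊆ fill J := by
  rw [fill_eq_compl_outside K, fill_eq_compl_outside J]
  exact compl_subset_compl.mpr (outside_subset_outside h)

lemma subset_fill (K : Set ℂ) : K ⊆ fill K := subset_union_left

lemma disjoint_inside_self (K : Set ℂ) : Disjoint (inside K) K :=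
  disjoint_left.mpr fun _ h h' => h.1 h'

/-- One half of the `θ`-curve lemma. -/
lemma theta_half {A B β : Set ℂ} {a b : ℂ} (hA : IsArc A a b) (hB : IsArc B a b)
    (hAB : A ∩ B = {a, b}) (hβ : IsArc β a b) (hβJ : β \ {a, b} ⊆ inside (A ∪ B)) :
    IsJordanCurve (A ∪ β) ∧ B \ {a, b} ⊆ outside (A ∪ β) ∧
      inside (A ∪ β) ⊆ inside (A ∪ B) \ β ∧ fill (A ∪ β) ⊆ fill (A ∪ B) := by
  have hJ : IsJordanCurve (A ∪ B) := hA.union_isJordanCurve hB hAB.subset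
  have hβJ' : ∀ z ∈ β, z ∈ A ∪ B → z ∈ ({a, b} : Set ℂ) := fun z hz hz' => by
    by_contra h
    exact (hβJ ⟨hz, h⟩).1 hz'
  have hC : IsJordanCurve (A ∪ β) :=
    hA.union_isJordanCurve hβ fun z hz => hβJ' z hz.2 (Or.inl hz.1)
  have hβf : β ⊆ fill (A ∪ B) := by
    intro z hz
    by_cases h : z ∈ ({a, b} : Set ℂ)
    · left; left; rcases h with rfl | rfl
      exacts [hA.left_mem, hA.right_mem]
    · exact Or.inr (hβJ ⟨hz, h⟩)
  have hCf : A ∪ β ⊆ fill (A ∪ B) :=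
    union_subset (subset_union_left.trans (subset_fill _)) hβf
  have hBo : B \ {a, b} ⊆ outside (A ∪ β) := by
    rintro w ⟨hw, hwab⟩
    have hwC : w ∈ (A ∪ β)ᶜ := by
      rintro (h | h)
      · exact hwab (hAB ▸ ⟨h, hw⟩)
      · exact hwab (hβJ' w h (Or.inr hw))
    rw [compl_eq_inside_union_outside] at hwC
    refine hwC.resolve_left fun h => ?_
    have hcl := hJ.subset_closure.2 (Or.inr hw)
    obtain ⟨z, hz, hz'⟩ := mem_closure_iff.mp hcl _ (isOpen_inside hC.isCompact.isClosed) h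
    exact disjoint_left.mp (disjoint_inside_outside _) hz (outside_subset_outside hCf hz')
  refine ⟨hC, hBo, fun z hz => ⟨?_, fun h => hz.1 (Or.inr h)⟩, fill_subset_fill hCf⟩
  refine (fill_subset_fill hCf (Or.inr hz)).resolve_left ?_
  rintro (h | h)
  · exact hz.1 (Or.inl h)
  · by_cases h' : z ∈ ({a, b} : Set ℂ)
    · refine hz.1 (Or.inl ?_)
      rcases h' with rfl | rfl
      exacts [hA.left_mem, hA.right_mem]
    · exact disjoint_left.mp (disjoint_inside_outside _) hz (hBo ⟨h, h'⟩)

/-- The two sides of a crosscut are disjoint. -/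
lemma theta_disjoint {A B β : Set ℂ} {a b : ℂ} (hA : IsArc A a b) (hB : IsArc B a b)
    (hAB : A ∩ B = {a, b}) (hβ : IsArc β a b) (hβJ : β \ {a, b} ⊆ inside (A ∪ B)) :
    Disjoint (inside (A ∪ β)) (inside (B ∪ β)) := by
  have hβJ' : β \ {a, b} ⊆ inside (B ∪ A) := by rwa [union_comm]
  obtain ⟨hC₁, hB₁, hi₁, -⟩ := theta_half hA hB hAB hβ hβJ
  obtain ⟨hC₂, hA₂, hi₂, -⟩ := theta_half hB hA (by rwa [inter_comm]) hβ hβJ'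
  have sub : ∀ {C C' : Set ℂ}, IsJordanCurve C → Disjoint (inside C) C' →
      ∀ z ∈ inside C, z ∈ inside C' → inside C ⊆ inside C' := by
    intro C C' hC hd z hz hz' w hw
    exact ((hC.isPathConnected_inside.joinedIn z hz w hw).mono
      (fun u hu h => disjoint_left.mp hd hu h)).mem_inside hz'
  rw [disjoint_left]
  intro z hz hz'
  have d₁ : Disjoint (inside (A ∪ β)) (B ∪ β) := disjoint_left.mpr fun w hw h => h.elim
    (fun h => (hi₁ hw).1.1 (Or.inr h)) (hi₁ hw).2
  have d₂ : Disjoint (inside (B ∪ β)) (A ∪ β) := disjoint_left.mpr fun w hw h => h.elim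
    (fun h => (hi₂ hw).1.1 (Or.inr h)) (hi₂ hw).2
  have heq : inside (A ∪ β) ⊆ inside (B ∪ β) := sub hC₁ d₁ z hz hz'
  obtain ⟨w, hw⟩ := hA.diff_ends.1.nonempty
  have hwc : w ∈ closure (inside (B ∪ β)) :=
    closure_mono heq (hC₁.subset_closure.1 (Or.inl hw.1))
  obtain ⟨u, hu, hu'⟩ := mem_closure_iff.mp hwc _ (isOpen_outside hC₂.isCompact.isClosed) (hA₂ hw)
  exact disjoint_left.mp (disjoint_inside_outside _) hu' hu

/-- The two sides of a crosscut cover the domain minus the crosscut. -/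
lemma theta_cover {A B β : Set ℂ} {a b : ℂ} (hA : IsArc A a b) (hB : IsArc B a b)
    (hAB : A ∩ B = {a, b}) (hβ : IsArc β a b) (hβJ : β \ {a, b} ⊆ inside (A ∪ B)) :
    inside (A ∪ B) \ β = inside (A ∪ β) ∪ inside (B ∪ β) := by
  have hJ : IsJordanCurve (A ∪ B) := hA.union_isJordanCurve hB hAB.subset
  have hβJ' : β \ {a, b} ⊆ inside (B ∪ A) := by rwa [union_comm]
  obtain ⟨hC₁, hB₁, hi₁, hf₁⟩ := theta_half hA hB hAB hβ hβJ
  obtain ⟨hC₂, hA₂, hi₂, hf₂⟩ := theta_half hB hA (by rwa [inter_comm]) hβ hβJ'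
  rw [union_comm B A] at hi₂ hf₂
  refine Subset.antisymm ?_ (union_subset hi₁ hi₂)
  rintro z ⟨hz, hzβ⟩
  by_contra hcon
  simp only [mem_union, not_or] at hcon
  have h1 : z ∈ (A ∪ β)ᶜ := fun h => h.elim (fun h => hz.1 (Or.inl h)) hzβ
  have h2 : z ∈ (B ∪ β)ᶜ := fun h => h.elim (fun h => hz.1 (Or.inr h)) hzβ
  rw [compl_eq_inside_union_outside] at h1 h2
  have h1 := h1.resolve_left hcon.1
  have h2 := h2.resolve_left hcon.2
  obtain ⟨y, hy⟩ := outside_nonempty hJ.isCompact.isBounded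
  have hinter : (A ∪ β) ∩ (B ∪ β) = β := by
    rw [← inter_union_distrib_right, hAB, union_eq_right]
    rintro w (rfl | rfl)
    exacts [hβ.left_mem, hβ.right_mem]
  have hj := joinedIn_compl_union hC₁.isCompact hC₂.isCompact
    (by rw [hinter]; exact hβ.isConnected.isPreconnected)
    (joinedIn_of_mem_outside hC₁.isCompact.isBounded h1
      (outside_subset_outside ((subset_fill _).trans hf₁) hy))
    (joinedIn_of_mem_outside hC₂.isCompact.isBounded h2
      (outside_subset_outside ((subset_fill _).trans hf₂) hy))
  have hj' : JoinedIn (A ∪ B)ᶜ z y := hj.mono (compl_subset_compl.mpr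
    (union_subset_union subset_union_left subset_union_left))
  exact disjoint_left.mp (disjoint_inside_outside _) (hj'.mem_inside hz) hy

lemma JoinedIn.of_union_disjoint {X : Type*} [TopologicalSpace X] {U V : Set X} (hU : IsOpen U)
    (hV : IsOpen V) (hUV : Disjoint U V) {x y : X} (h : JoinedIn (U ∪ V) x y) (hx : x ∈ U) :
    JoinedIn U x y := by
  obtain ⟨γ, hγ⟩ := h
  refine ⟨γ, fun t => ?_⟩
  exact (isPreconnected_range γ.continuous).subset_left_of_subset_union hU hV hUV
    (range_subset_iff.mpr hγ) ⟨x, ⟨0, γ.source⟩, hx⟩ ⟨t, rfl⟩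

/-- Removing from an open set a compact subset which does not separate the plane does not
separate the components of the open set. -/
lemma JoinedIn.diff_compact {N K : Set ℂ} (hN : IsOpen N) (hK : IsCompact K) (hKN : K ⊆ N) {x y : ℂ}
    (h1 : JoinedIn N x y) (h2 : JoinedIn Kᶜ x y) : JoinedIn (N \ K) x y := by
  obtain ⟨γ, hγ⟩ := h1
  obtain ⟨R, hR⟩ := ((isCompact_range γ.continuous).union hK).isBounded.subset_ball 0
  set L := closedBall (0:ℂ) R \ (N ∩ ball 0 R) with hLdef
  have hL : IsCompact L := (isCompact_closedBall 0 R).diff (hN.inter isOpen_ball)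
  have hKL : K ∩ L = ∅ := by
    ext z
    simp only [mem_inter_iff, not_and, mem_empty_iff_false, iff_false]
    exact fun hz h => h.2 ⟨hKN hz, hR (Or.inr hz)⟩
  have hPL : JoinedIn Lᶜ x y :=
    ⟨γ, fun t h => h.2 ⟨hγ t, hR (Or.inl ⟨t, rfl⟩)⟩⟩
  have hj := joinedIn_compl_union hK hL (by rw [hKL]; exact isPreconnected_empty) h2 hPL
  have hsub : (K ∪ L)ᶜ ⊆ ((N ∩ ball 0 R) \ K) ∪ (closedBall (0:ℂ) R)ᶜ := by
    intro z hz
    by_cases hzR : z ∈ closedBall (0:ℂ) R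
    · refine Or.inl ⟨?_, fun h => hz (Or.inl h)⟩
      by_contra h
      exact hz (Or.inr ⟨hzR, h⟩)
    · exact Or.inr hzR
  have hx : x ∈ (N ∩ ball 0 R) \ K :=
    ⟨⟨γ.source ▸ hγ 0, hR (Or.inl ⟨0, γ.source⟩)⟩, h2.source_mem⟩
  refine ((hj.mono hsub).of_union_disjoint ((hN.inter isOpen_ball).sdiff hK.isClosed)
    isClosed_closedBall.isOpen_compl ?_ hx).mono fun z hz => ⟨hz.1.1, hz.2⟩
  rw [Set.disjoint_left]
  exact fun z hz h => h (ball_subset_closedBall hz.1.2)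

/-- A transitive relation on an interval which holds locally holds between the ends. -/
lemma rel_Icc_of_local {G : ℝ → ℝ → Prop}
    (trans : ∀ s t u, s ≤ t → t ≤ u → G s t → G t u → G s u)
    (loc : ∀ x ∈ Icc (0:ℝ) 1, ∃ U ∈ 𝓝 x, ∀ s ∈ U ∩ Icc 0 1, ∀ t ∈ U ∩ Icc 0 1, s ≤ t →
      Icc s t ⊆ U → G s t) : G 0 1 := by
  choose! U hU hG using loc
  obtain ⟨t, t0, tm, ⟨m, hm⟩, ht⟩ := exists_monotone_Icc_subset_open_cover_Icc
    (zero_le_one (α := ℝ)) (c := fun x : Icc (0:ℝ) 1 => Subtype.val ⁻¹' (interior (U x)))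
    (fun i => isOpen_interior.preimage continuous_subtype_val)
    (fun x _ => mem_iUnion.mpr ⟨x, mem_interior_iff_mem_nhds.mpr (hU x x.2)⟩)
  have step : ∀ n, G (t n) (t (n + 1)) := by
    intro n
    obtain ⟨x, hx⟩ := ht n
    have hle : t n ≤ t (n + 1) := tm n.le_succ
    have hsub : Icc (t n : ℝ) (t (n + 1)) ⊆ U x := by
      intro s hs
      exact interior_subset (hx (a := ⟨s, (t n).2.1.trans hs.1, hs.2.trans (t (n+1)).2.2⟩) hs)
    exact hG x x.2 _ ⟨hsub ⟨le_rfl, hle⟩, (t n).2⟩ _ ⟨hsub ⟨hle, le_rfl⟩, (t (n + 1)).2⟩ hle hsub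
  have all : ∀ n, G (t 0) (t (n + 1)) := by
    intro n
    induction n with
    | zero => exact step 0
    | succ k ih =>
      exact trans _ (t (k+1)) _ (tm (Nat.zero_le _)) (tm (Nat.le_succ _)) ih (step _)
  have := all m
  rwa [t0, hm (m + 1) (by omega)] at this

lemma JoinedIn.exists_continuousOn {X : Type*} [TopologicalSpace X] {N : Set X} {x y : X}
    (h : JoinedIn N x y) {s t : ℝ} (hst : s < t) :
    ∃ g : ℝ → X, Continuous g ∧ g s = x ∧ g t = y ∧ ∀ u, g u ∈ N := by
  obtain ⟨γ, hγ⟩ := h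
  refine ⟨fun u => γ.extend ((u - s) / (t - s)), by fun_prop, by simp, ?_, fun u => ?_⟩
  · have : t - s ≠ 0 := by linarith
    simp [div_self this]
  · have : γ.extend ((u - s) / (t - s)) ∈ range γ.extend := mem_range_self _
    rw [γ.extend_range] at this
    obtain ⟨v, hv⟩ := this
    simp only [← hv, hγ]

lemma continuousOn_ite_Icc {X : Type*} [TopologicalSpace X] {f g : ℝ → X} {s t u : ℝ}
    (hst : s ≤ t) (htu : t ≤ u) (hf : ContinuousOn f (Icc s t)) (hg : ContinuousOn g (Icc t u))
    (h : f t = g t) : ContinuousOn (fun x => if x ≤ t then f x else g x) (Icc s u) := by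
  rw [← Icc_union_Icc_eq_Icc hst htu]
  refine ContinuousOn.union_of_isClosed (hf.congr fun x hx => by simp [hx.2])
    (hg.congr fun x hx => ?_) isClosed_Icc isClosed_Icc
  rcases hx.1.eq_or_lt with rfl | h'
  · simp [h]
  · simp [not_le.mpr h']

/-- A path can be pushed off a compact nonseparating set, changing it only near that set. -/
lemma exists_push {γ : ℝ → ℂ} (hγ : ContinuousOn γ (Icc 0 1)) {K N : Set ℂ} (hK : IsCompact K)
    (hN : IsOpen N) (hKN : K ⊆ N) (hsep : ∀ x y, x ∉ K → y ∉ K → JoinedIn Kᶜ x y)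
    (h0 : γ 0 ∉ K) (h1 : γ 1 ∉ K) :
    ∃ γ' : ℝ → ℂ, ContinuousOn γ' (Icc 0 1) ∧ γ' 0 = γ 0 ∧ γ' 1 = γ 1 ∧
      ∀ t ∈ Icc (0:ℝ) 1, γ' t ∉ K ∧ (γ' t = γ t ∨ (γ t ∈ N ∧ γ' t ∈ N)) := by
  have hp : ∀ z : ℂ, ∃ w, w ∉ K ∧ (z ∉ K → w = z) ∧ (z ∈ N → JoinedIn N z w) := by
    intro z
    by_cases hz : z ∈ K
    · by_contra! hcon
      have hsub : pathComponentIn N z ⊆ K := by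
        intro w hw
        by_contra hwK
        exact hcon w hwK (fun h => absurd hz h) |>.2 hw
      have hcl : IsClosed (pathComponentIn N z) := by
        have h2 := (isClosed_pathComponentIn_union hN.isClosed_compl z).inter hK.isClosed
        rw [compl_compl] at h2
        convert h2 using 1
        ext w
        constructor
        · exact fun hw => ⟨Or.inl hw, hsub hw⟩
        · rintro ⟨hw | hw, hw'⟩
          · exact hw
          · exact absurd (hKN hw') hw
      have := IsClopen.eq_univ ⟨hcl, hN.pathComponentIn z⟩ ⟨z, JoinedIn.refl (hKN hz)⟩
      exact hK.ne_univ (eq_univ_of_univ_subset (this ▸ hsub))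
    · exact ⟨z, hz, fun _ => rfl, fun h => JoinedIn.refl h⟩
  choose p pK pz pN using hp
  suffices H : ∃ g : ℝ → ℂ, ContinuousOn g (Icc 0 1) ∧ g 0 = p (γ 0) ∧ g 1 = p (γ 1) ∧
      ∀ t ∈ Icc (0:ℝ) 1, g t ∉ K ∧ (g t = γ t ∨ (γ t ∈ N ∧ g t ∈ N)) by
    rwa [pz _ h0, pz _ h1] at H
  refine rel_Icc_of_local (G := fun a b => ∃ g : ℝ → ℂ, ContinuousOn g (Icc a b) ∧ g a = p (γ a) ∧
    g b = p (γ b) ∧ ∀ t ∈ Icc a b, g t ∉ K ∧ (g t = γ t ∨ (γ t ∈ N ∧ g t ∈ N))) ?_ ?_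
  · rintro s t u hst htu ⟨f, f1, f2, f3, f4⟩ ⟨g, g1, g2, g3, g4⟩
    refine ⟨fun x => if x ≤ t then f x else g x, continuousOn_ite_Icc hst htu f1 g1 (f3.trans g2.symm),
      by simp [hst, f2], ?_, ?_⟩
    · rcases htu.eq_or_lt with rfl | h
      · simp [f3]
      · simp [not_le.mpr h, g3]
    · intro x hx
      by_cases h : x ≤ t
      · simp only [h, if_true]; exact f4 x ⟨hx.1, h⟩
      · simp only [h, if_false]; exact g4 x ⟨(not_le.mp h).le, hx.2⟩
  · intro x hx
    by_cases hxK : γ x ∈ K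
    · obtain ⟨ε, hε, hb⟩ := Metric.mem_nhdsWithin_iff.mp
        ((hγ x hx).preimage_mem_nhdsWithin (hN.mem_nhds (hKN hxK)))
      refine ⟨ball x ε, ball_mem_nhds _ hε, ?_⟩
      intro s hs t ht hst hI
      have hI' : Icc s t ⊆ Icc 0 1 := Icc_subset_Icc hs.2.1 ht.2.2
      have hγN : ∀ u ∈ Icc s t, γ u ∈ N := fun u hu => hb ⟨hI hu, hI' hu⟩
      rcases hst.eq_or_lt with rfl | hlt
      · refine ⟨fun _ => p (γ s), continuousOn_const, rfl, rfl, fun u hu => ⟨pK _, Or.inr ?_⟩⟩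
        exact ⟨hγN u hu, (pN _ (hγN s ⟨le_rfl, le_rfl⟩)).target_mem⟩
      · have hsN := hγN s ⟨le_rfl, hst⟩
        have htN := hγN t ⟨hst, le_rfl⟩
        have j : JoinedIn N (γ s) (γ t) := by
          have : IsPathConnected (γ '' Icc s t) :=
            ((convex_Icc s t).isPathConnected ⟨s, le_rfl, hst⟩).image' (hγ.mono hI')
          exact (this.joinedIn _ ⟨s, ⟨le_rfl, hst⟩, rfl⟩ _ ⟨t, ⟨hst, le_rfl⟩, rfl⟩).mono
            (by rintro _ ⟨u, hu, rfl⟩; exact hγN u hu)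
        have j2 := JoinedIn.diff_compact hN hK hKN (((pN _ hsN).symm.trans j).trans (pN _ htN))
          (hsep _ _ (pK _) (pK _))
        obtain ⟨g, g1, g2, g3, g4⟩ := j2.exists_continuousOn hlt
        exact ⟨g, g1.continuousOn, g2, g3, fun u hu => ⟨(g4 u).2, Or.inr ⟨hγN u hu, (g4 u).1⟩⟩⟩
    · obtain ⟨ε, hε, hb⟩ := Metric.mem_nhdsWithin_iff.mp
        ((hγ x hx).preimage_mem_nhdsWithin (hK.isClosed.isOpen_compl.mem_nhds hxK))
      refine ⟨ball x ε, ball_mem_nhds _ hε, ?_⟩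
      intro s hs t ht hst hI
      have hI' : Icc s t ⊆ Icc 0 1 := Icc_subset_Icc hs.2.1 ht.2.2
      have hγK : ∀ u ∈ Icc s t, γ u ∉ K := fun u hu => hb ⟨hI hu, hI' hu⟩
      exact ⟨γ, hγ.mono hI', (pz _ (hγK s ⟨le_rfl, hst⟩)).symm, (pz _ (hγK t ⟨hst, le_rfl⟩)).symm,
        fun u hu => ⟨hγK u hu, Or.inl rfl⟩⟩

/-- Dependent choice of a sequence. -/
lemma exists_seq_step {α : Type*} {P : α → Prop} {R : ℕ → α → α → Prop} {a : α} (ha : P a)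
    (h : ∀ n x, P x → ∃ y, P y ∧ R n x y) :
    ∃ g : ℕ → α, g 0 = a ∧ ∀ n, P (g n) ∧ R n (g n) (g (n + 1)) := by
  choose! f f1 f2 using h
  let g : ℕ → α := fun n => Nat.rec a (fun n x => f n x) n
  have hP : ∀ n, P (g n) := by
    intro n
    induction n with
    | zero => exact ha
    | succ n ih => exact f1 n _ ih
  exact ⟨g, rfl, fun n => ⟨hP n, f2 n _ (hP n)⟩⟩

lemma exists_halving_seq {E : ℕ → ℝ} (hE : ∀ n, 0 < E n) :
    ∃ ε : ℕ → ℝ, ∀ n, 0 < ε n ∧ ε n ≤ E n ∧ ε (n + 1) ≤ ε n / 2 := by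
  let ε : ℕ → ℝ := fun n => Nat.rec (E 0) (fun n x => min (E (n + 1)) (x / 2)) n
  have h : ∀ n, 0 < ε n ∧ ε n ≤ E n := by
    intro n
    induction n with
    | zero => exact ⟨hE 0, le_rfl⟩
    | succ n ih => exact ⟨lt_min (hE _) (half_pos ih.1), min_le_left _ _⟩
  exact ⟨ε, fun n => ⟨(h n).1, (h n).2, min_le_right _ _⟩⟩

lemma exists_pos_le_dist {D D' : Set ℂ} (hD : IsCompact D) (hD' : IsCompact D')
    (h : Disjoint D D') : ∃ δ > 0, ∀ x ∈ D, ∀ y ∈ D', δ ≤ dist x y := by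
  obtain ⟨δ, hδ, hd⟩ := h.exists_thickenings hD hD'.isClosed
  refine ⟨δ, hδ, fun x hx y hy => ?_⟩
  by_contra! hlt
  exact Set.disjoint_left.mp hd (self_subset_thickening hδ D hx)
    (mem_thickening_iff.mpr ⟨y, hy, hlt⟩)

lemma eventually_le_nhdsGT {c : ℝ} (hc : 0 < c) : ∀ᶠ r in 𝓝[>] (0:ℝ), r ≤ c :=
  mem_nhdsWithin_of_mem_nhds (Iic_mem_nhds hc)

/-- Radii of neighbourhoods of a null sequence of disjoint compact sets such that neighbourhoods
which meet have rapidly decreasing diameters. -/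
lemma exists_null_nhds {D : ℕ → Set ℂ} (hD : ∀ n, IsCompact (D n))
    (hdisj : Pairwise fun i j => Disjoint (D i) (D j))
    (hdiam : Tendsto (fun n => diam (D n)) atTop (𝓝 0)) {v : ℕ → ℝ} (hv : ∀ n, 0 < v n) :
    ∃ ε r : ℕ → ℝ, (∀ n, 0 < ε n ∧ ε n ≤ v n / 8 ∧ ε (n + 1) ≤ ε n / 2) ∧
      (∀ n i, i < n → ∀ x ∈ D n, ∀ y ∈ D i, 8 * ε n ≤ dist x y) ∧
      (∀ n, 0 < r n ∧ r n ≤ ε n / 8) ∧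
      ∀ n m, n < m → (thickening (r n) (D n) ∩ thickening (r m) (D m)).Nonempty →
        diam (D m) + 2 * r m ≤ ε n := by
  have hδ : ∀ n i, ∃ δ > 0, n ≠ i → ∀ x ∈ D n, ∀ y ∈ D i, δ ≤ dist x y := by
    intro n i
    by_cases h : n = i
    · exact ⟨1, one_pos, fun h' => absurd h h'⟩
    · obtain ⟨δ, h1, h2⟩ := exists_pos_le_dist (hD n) (hD i) (hdisj h)
      exact ⟨δ, h1, fun _ => h2⟩
  choose δ δpos hδ using hδ
  have hE : ∀ n, ∃ e > 0, e ≤ v n / 8 ∧ ∀ i ∈ Finset.range n, e ≤ δ n i / 8 := by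
    intro n
    have h : ∀ᶠ e in 𝓝[>] (0:ℝ), 0 < e ∧ e ≤ v n / 8 ∧ ∀ i ∈ Finset.range n, e ≤ δ n i / 8 :=
      eventually_mem_nhdsWithin.and ((eventually_le_nhdsGT (by linarith [hv n])).and
        ((Finset.eventually_all _).mpr fun i _ => eventually_le_nhdsGT (by linarith [δpos n i])))
    exact h.exists
  choose E Epos Ev Eδ using hE
  obtain ⟨ε, hε⟩ := exists_halving_seq Epos
  have anti : ∀ n m, n ≤ m → ε m ≤ ε n := by
    intro n m h
    induction m, h using Nat.le_induction with
    | base => exact le_rfl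
    | succ k _ ih => linarith [(hε k).2.2, (hε k).1]
  have hr : ∀ n, ∃ r > 0, r ≤ ε n / 8 ∧ (∀ i ∈ Finset.range n, r ≤ δ n i / 3) ∧
      ∀ m, ε n / 2 < diam (D m) → r ≤ δ n m / 3 := by
    intro n
    have hfin : {m | ε n / 2 < diam (D m)}.Finite := by
      have := hdiam.eventually_lt_const (half_pos (hε n).1)
      obtain ⟨M, hM⟩ := eventually_atTop.mp this
      refine (finite_lt_nat M).subset fun m hm => ?_
      by_contra h
      exact absurd (hM m (not_lt.mp h)) (not_lt.mpr (le_of_lt hm))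
    have h : ∀ᶠ r in 𝓝[>] (0:ℝ), 0 < r ∧ r ≤ ε n / 8 ∧ (∀ i ∈ Finset.range n, r ≤ δ n i / 3) ∧
        ∀ m ∈ {m | ε n / 2 < diam (D m)}, r ≤ δ n m / 3 :=
      eventually_mem_nhdsWithin.and ((eventually_le_nhdsGT (by linarith [(hε n).1])).and
        (((Finset.eventually_all _).mpr fun i _ => eventually_le_nhdsGT (by linarith [δpos n i])).and
        (hfin.eventually_all.mpr fun i _ => eventually_le_nhdsGT (by linarith [δpos n i]))))
    exact h.exists
  choose r rpos rε rδ rδ' using hr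
  refine ⟨ε, r, fun n => ⟨(hε n).1, (hε n).2.1.trans (Ev n), (hε n).2.2⟩, ?_,
    fun n => ⟨rpos n, rε n⟩, ?_⟩
  · intro n i hi x hx y hy
    linarith [hδ n i hi.ne' x hx y hy, Eδ n i (Finset.mem_range.mpr hi), (hε n).2.1]
  · rintro n m hnm ⟨z, hz, hz'⟩
    obtain ⟨x, hx, hzx⟩ := mem_thickening_iff.mp hz
    obtain ⟨y, hy, hzy⟩ := mem_thickening_iff.mp hz'
    by_cases h : ε n / 2 < diam (D m)
    · exfalso
      have h1 := hδ n m hnm.ne x hx y hy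
      have h2 := hδ m n hnm.ne' y hy x hx
      have h3 := rδ' n m h
      have h4 := rδ m n (Finset.mem_range.mpr hnm)
      have h5 := dist_triangle_left x y z
      rw [dist_comm y x] at h2
      linarith [rpos n, rpos m]
    · linarith [rε m, anti n m hnm.le, (hε n).1]

lemma dist_le_of_mem_thickening {D : Set ℂ} (hD : IsCompact D) {r : ℝ} {x y : ℂ}
    (hx : x ∈ thickening r D) (hy : y ∈ thickening r D) : dist x y ≤ diam D + 2 * r := by
  obtain ⟨x', hx', h1⟩ := mem_thickening_iff.mp hx
  obtain ⟨y', hy', h2⟩ := mem_thickening_iff.mp hy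
  have := dist_le_diam_of_mem hD.isBounded hx' hy'
  have h3 := dist_triangle4 x x' y' y
  rw [dist_comm y' y] at h3
  linarith

/-- A path in an open set `V` can be made disjoint from a null sequence of disjoint compact
nonseparating subsets of `V`. -/
lemma exists_path_avoiding {V : Set ℂ} {D : ℕ → Set ℂ} (hV : IsOpen V) (hD : ∀ n, IsCompact (D n))
    (hDV : ∀ n, D n ⊆ V) (hdisj : Pairwise fun i j => Disjoint (D i) (D j))
    (hdiam : Tendsto (fun n => diam (D n)) atTop (𝓝 0))
    (hsep : ∀ n x y, x ∉ D n → y ∉ D n → JoinedIn (D n)ᶜ x y) {γ : ℝ → ℂ}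
    (hγ : ContinuousOn γ (Icc 0 1)) (hγV : ∀ t ∈ Ioo (0:ℝ) 1, γ t ∈ V)
    (h0 : ∀ n, γ 0 ∉ D n) (h1 : ∀ n, γ 1 ∉ D n) {e : ℝ} (he : ∀ n, diam (D n) < e) :
    ∃ γ' : ℝ → ℂ, ContinuousOn γ' (Icc 0 1) ∧ γ' 0 = γ 0 ∧ γ' 1 = γ 1 ∧
      (∀ t ∈ Ioo (0:ℝ) 1, γ' t ∈ V ∧ ∀ n, γ' t ∉ D n) ∧
      ∀ t ∈ Icc (0:ℝ) 1, dist (γ' t) (γ t) ≤ 4 * e := by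
  have he0 : 0 < e := diam_nonneg.trans_lt (he 0)
  have hv : ∀ n, ∃ v > 0, v ≤ e ∧ thickening v (D n) ⊆ V := fun n => by
    obtain ⟨v, h1, h2⟩ := (hD n).exists_thickening_subset_open hV (hDV n)
    exact ⟨min v e, lt_min h1 he0, min_le_right _ _,
      (thickening_mono (min_le_left _ _) _).trans h2⟩
  choose v vpos ve hv using hv
  obtain ⟨ε, r, hε, hεd, hr, hN⟩ := exists_null_nhds hD hdisj hdiam vpos
  obtain ⟨g, g0, hg⟩ := exists_seq_step (P := fun g : ℝ → ℂ => ContinuousOn g (Icc 0 1) ∧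
      g 0 = γ 0 ∧ g 1 = γ 1)
    (R := fun n g g' => ∀ t ∈ Icc (0:ℝ) 1, g' t ∉ D n ∧ (g' t = g t ∨
      (g t ∈ thickening (r n) (D n) ∧ g' t ∈ thickening (r n) (D n)))) (a := γ) ⟨hγ, rfl, rfl⟩ (by
    rintro n f ⟨f1, f2, f3⟩
    obtain ⟨f', f1', f2', f3', f4'⟩ := exists_push f1 (hD n) isOpen_thickening
      (self_subset_thickening (hr n).1 (D n)) (hsep n) (f2 ▸ h0 n) (f3 ▸ h1 n)
    exact ⟨f', ⟨f1', f2'.trans f2, f3'.trans f3⟩, f4'⟩)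
  have later : ∀ t ∈ Icc (0:ℝ) 1, ∀ k n m, n < m → g m t ∈ thickening (r n) (D n) →
      dist (g (m + k) t) (g m t) ≤ 2 * ε n := by
    intro t ht k
    induction k with
    | zero => intro n m _ _; simpa using (hε n).1.le
    | succ k ih =>
      intro n m hnm hx
      rw [show m + (k + 1) = (m + 1) + k by ring]
      rcases ((hg m).2 t ht).2 with h | ⟨ha, hb⟩
      · rw [← h]
        exact ih n (m + 1) (by omega) (h ▸ hx)
      · have e1 := dist_le_of_mem_thickening (hD m) hb ha
        have e2 := hN n m hnm ⟨_, hx, ha⟩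
        have e3 := ih m (m + 1) (by omega) hb
        have e4 := hN n m hnm ⟨_, hx, ha⟩
        have e5 : ε m ≤ ε n / 2 := by
          clear * - hnm hε
          induction m, hnm using Nat.le_induction with
          | base => exact (hε n).2.2
          | succ k _ ih => linarith [(hε k).2.2, (hε k).1]
        linarith [dist_triangle (g (m + 1 + k) t) (g (m + 1) t) (g m t)]
  have hε0 : Tendsto ε atTop (𝓝 0) := by
    have h : ∀ n, ε n ≤ ε 0 * (1 / 2) ^ n := by
      intro n
      induction n with
      | zero => simp
      | succ n ih => rw [pow_succ]; linarith [(hε n).2.2]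
    refine squeeze_zero (fun n => (hε n).1.le) h ?_
    simpa using (tendsto_pow_atTop_nhds_zero_of_lt_one (r := (1/2:ℝ)) (by norm_num)
      (by norm_num)).const_mul (ε 0)
  have cau' : ∀ e > 0, ∀ M, (∀ m ≥ M, diam (D m) < e ∧ ε m < e) → ∀ m ≥ M, ∀ k,
      ∀ t ∈ Icc (0:ℝ) 1, dist (g (m + k) t) (g m t) ≤ 4 * e := by
    intro e he M hM m hm k t ht
    induction k generalizing m with
    | zero => simpa using he.le
    | succ k ih =>
      rw [show m + (k + 1) = (m + 1) + k by ring]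
      rcases ((hg m).2 t ht).2 with h | ⟨ha, hb⟩
      · rw [← h]
        exact ih (m + 1) (by omega)
      · have e1 := dist_le_of_mem_thickening (hD m) hb ha
        have e3 := later t ht k m (m + 1) (by omega) hb
        linarith [dist_triangle (g (m + 1 + k) t) (g (m + 1) t) (g m t), hM m hm, hr m]
  have cau : ∀ e > 0, ∃ M, ∀ m ≥ M, ∀ k, ∀ t ∈ Icc (0:ℝ) 1,
      dist (g (m + k) t) (g m t) ≤ 4 * e := by
    intro e he
    obtain ⟨M, hM⟩ := eventually_atTop.mp
      ((hdiam.eventually_lt_const he).and (hε0.eventually_lt_const he))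
    exact ⟨M, cau' e he M hM⟩
  have hucs : UniformCauchySeqOn g atTop (Icc 0 1) := by
    rw [Metric.uniformCauchySeqOn_iff]
    intro e he
    obtain ⟨M, hM⟩ := cau (e / 16) (by linarith)
    refine ⟨M, fun m hm n hn t ht => ?_⟩
    obtain ⟨k, rfl⟩ := Nat.exists_eq_add_of_le hm
    obtain ⟨l, rfl⟩ := Nat.exists_eq_add_of_le hn
    have a := hM M le_rfl k t ht
    have b := hM M le_rfl l t ht
    linarith [dist_triangle_right (g (M + k) t) (g (M + l) t) (g M t)]
  have hlim : ∀ t, ∃ y, t ∈ Icc (0:ℝ) 1 → Tendsto (fun n => g n t) atTop (𝓝 y) := by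
    intro t
    by_cases ht : t ∈ Icc (0:ℝ) 1
    · obtain ⟨y, hy⟩ := cauchySeq_tendsto_of_complete (hucs.cauchySeq ht)
      exact ⟨y, fun _ => hy⟩
    · exact ⟨0, fun h => absurd h ht⟩
  choose γ' hγ' using hlim
  have hu : TendstoUniformlyOn g γ' atTop (Icc 0 1) :=
    hucs.tendstoUniformlyOn_of_tendsto fun t ht => hγ' t ht
  refine ⟨γ', hu.continuousOn (Frequently.of_forall fun n => (hg n).1.1), ?_, ?_, ?_, ?_⟩
  · exact tendsto_nhds_unique (hγ' 0 (by simp)) (by simp [fun n => (hg n).1.2.1])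
  · exact tendsto_nhds_unique (hγ' 1 (by simp)) (by simp [fun n => (hg n).1.2.2])
  swap
  · intro t ht
    refine le_of_tendsto ((hγ' t ht).dist tendsto_const_nhds) (Eventually.of_forall fun n => ?_)
    have := cau' e he0 0 (fun m _ => ⟨he m, by linarith [hε m, ve m]⟩) 0 le_rfl n t ht
    rwa [g0, zero_add] at this
  intro t ht
  have ht' := Ioo_subset_Icc_self ht
  have moved : ∀ n, g (n + 1) t ∈ thickening (r n) (D n) → ∃ x ∈ D n, dist (γ' t) x < 8 * ε n := by
    intro n hn
    obtain ⟨x, hx, hd⟩ := mem_thickening_iff.mp hn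
    refine ⟨x, hx, ?_⟩
    have : dist (γ' t) (g (n + 1) t) ≤ 2 * ε n := by
      refine le_of_tendsto ((hγ' t ht').dist tendsto_const_nhds)
        (eventually_atTop.mpr ⟨n + 1, fun m hm => ?_⟩)
      obtain ⟨k, rfl⟩ := Nat.exists_eq_add_of_le hm
      exact later t ht' k n (n + 1) (by omega) hn
    linarith [dist_triangle (γ' t) (g (n + 1) t) x, hr n, hε n]
  have still : ∀ m, (∀ n ≥ m, g (n + 1) t = g n t) → γ' t = g m t := by
    intro m hm
    have : ∀ n ≥ m, g n t = g m t := by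
      intro n hn
      induction n, hn using Nat.le_induction with
      | base => rfl
      | succ k hk ih => rw [hm k hk, ih]
    exact tendsto_nhds_unique (hγ' t ht') (tendsto_atTop_of_eventually_const this)
  constructor
  · by_cases h : ∀ n ≥ 0, g (n + 1) t = g n t
    · rw [still 0 h, g0]; exact hγV t ht
    · push Not at h
      obtain ⟨n, -, hn⟩ := h
      obtain ⟨x, hx, hd⟩ := moved n (((hg n).2 t ht').2.resolve_left hn).2
      exact hv n (mem_thickening_iff.mpr ⟨x, hx, hd.trans_le (by linarith [hε n])⟩)
  · intro k hk
    by_cases h : ∀ n ≥ k + 1, g (n + 1) t = g n t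
    · rw [still (k + 1) h] at hk
      exact ((hg k).2 t ht').1 hk
    · push Not at h
      obtain ⟨n, hkn, hn⟩ := h
      obtain ⟨x, hx, hd⟩ := moved n (((hg n).2 t ht').2.resolve_left hn).2
      have := hεd n k (by omega) x hx _ hk
      rw [dist_comm] at this
      linarith

section PathToArc
variable {E : Type*} [MetricSpace E]

/-- Closed subsets of `[0, 1]` such that a function takes equal values at the ends of all gaps. -/
def GapClosed (γ : ℝ → E) (F : Set ℝ) : Prop :=
  F ⊆ Icc 0 1 ∧ IsClosed F ∧ 0 ∈ F ∧ 1 ∈ F ∧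
    ∀ a ∈ F, ∀ b ∈ F, a < b → F ∩ Ioo a b = ∅ → γ a = γ b

lemma exists_gap {F : Set ℝ} (hF : IsClosed F) {a b s t : ℝ} (ha : a ∈ F) (hb : b ∈ F)
    (has : a ≤ s) (htb : t ≤ b) (hst : s ≤ t) (hFst : F ∩ Icc s t = ∅) :
    ∃ a' ∈ F, ∃ b' ∈ F, a ≤ a' ∧ a' < s ∧ t < b' ∧ b' ≤ b ∧ F ∩ Ioo a' b' = ∅ := by
  have hc1 : IsCompact (F ∩ Icc a s) := isCompact_Icc.inter_left hF
  have hc2 : IsCompact (F ∩ Icc t b) := isCompact_Icc.inter_left hF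
  have m1 := hc1.sSup_mem ⟨a, ha, le_rfl, has⟩
  have m2 := hc2.sInf_mem ⟨b, hb, htb, le_rfl⟩
  set a' := sSup (F ∩ Icc a s)
  set b' := sInf (F ∩ Icc t b)
  have n1 : a' ≠ s := fun h => by
    have : a' ∈ F ∩ Icc s t := ⟨m1.1, h.ge, h.le.trans hst⟩
    rw [hFst] at this; exact this
  have n2 : b' ≠ t := fun h => by
    have : b' ∈ F ∩ Icc s t := ⟨m2.1, hst.trans h.ge, h.le⟩
    rw [hFst] at this; exact this
  refine ⟨a', m1.1, b', m2.1, m1.2.1, m1.2.2.lt_of_ne n1, m2.2.1.lt_of_ne n2.symm, m2.2.2, ?_⟩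
  rw [Set.eq_empty_iff_forall_notMem]
  rintro x ⟨hx, hx1, hx2⟩
  rcases le_total x s with h | h
  · exact absurd (le_csSup hc1.bddAbove ⟨hx, m1.2.1.trans hx1.le, h⟩) (not_le.mpr hx1)
  rcases le_total x t with h' | h'
  · have : x ∈ F ∩ Icc s t := ⟨hx, h, h'⟩
    rw [hFst] at this; exact this
  · exact absurd (csInf_le hc2.bddBelow ⟨hx, h', hx2.le.trans m2.2.2⟩) (not_le.mpr hx2)

lemma GapClosed.sInter {γ : ℝ → E} (hγ : ContinuousOn γ (Icc 0 1)) {c : Set (Set ℝ)}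
    (hc : ∀ F ∈ c, GapClosed γ F) (hchain : IsChain (· ⊆ ·) c) (hne : c.Nonempty) :
    GapClosed γ (⋂₀ c) := by
  refine ⟨fun x hx => ?_, isClosed_sInter fun F hF => (hc F hF).2.1, fun F hF => (hc F hF).2.2.1,
    fun F hF => (hc F hF).2.2.2.1, ?_⟩
  · obtain ⟨F, hF⟩ := hne
    exact (hc F hF).1 (hx F hF)
  intro a ha b hb hab hgap
  have hI : ∀ x ∈ ⋂₀ c, x ∈ Icc (0:ℝ) 1 := fun x hx => by
    obtain ⟨F, hF⟩ := hne
    exact (hc F hF).1 (hx F hF)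
  have key : ∀ e > 0, e < (b - a) / 2 → ∃ a' ∈ Icc (0:ℝ) 1, ∃ b' ∈ Icc (0:ℝ) 1,
      dist a' a < e ∧ dist b' b < e ∧ γ a' = γ b' := by
    intro e he heb
    have hex : ∃ F ∈ c, F ∩ Icc (a + e) (b - e) = ∅ := by
      by_contra! hcon
      have : (⋂ F : c, (F : Set ℝ) ∩ Icc (a + e) (b - e)).Nonempty := by
        have : Nonempty c := hne.to_subtype
        refine IsCompact.nonempty_iInter_of_directed_nonempty_isCompact_isClosed _ ?_
          (fun F => hcon F F.2)
          (fun F => isCompact_Icc.inter_left (hc F F.2).2.1)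
          (fun F => (hc F F.2).2.1.inter isClosed_Icc)
        intro F F'
        rcases hchain.total F.2 F'.2 with h | h
        · exact ⟨F, Subset.rfl, inter_subset_inter_left _ h⟩
        · exact ⟨F', inter_subset_inter_left _ h, Subset.rfl⟩
      obtain ⟨x, hx⟩ := this
      rw [mem_iInter] at hx
      obtain ⟨F, hF⟩ := hne
      have hx' : x ∈ ⋂₀ c ∩ Ioo a b :=
        ⟨fun F hF => (hx ⟨F, hF⟩).1, by linarith [(hx ⟨F, hF⟩).2.1], by linarith [(hx ⟨F, hF⟩).2.2]⟩
      rw [hgap] at hx'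
      exact hx'
    obtain ⟨F, hF, hFe⟩ := hex
    obtain ⟨a', ha', b', hb', h1, h2, h3, h4, h5⟩ := exists_gap (hc F hF).2.1 (ha F hF) (hb F hF)
      (by linarith) (by linarith) (by linarith) hFe
    refine ⟨a', (hc F hF).1 ha', b', (hc F hF).1 hb', ?_, ?_,
      (hc F hF).2.2.2.2 a' ha' b' hb' (by linarith) h5⟩
    · rw [Real.dist_eq, abs_lt]; constructor <;> linarith
    · rw [Real.dist_eq, abs_lt]; constructor <;> linarith
  refine eq_of_forall_dist_le fun e he => ?_
  obtain ⟨δ1, hδ1, h1⟩ := Metric.continuousOn_iff.mp hγ a (hI a ha) (e / 2) (half_pos he)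
  obtain ⟨δ2, hδ2, h2⟩ := Metric.continuousOn_iff.mp hγ b (hI b hb) (e / 2) (half_pos he)
  obtain ⟨r, hr, hr1, hr2, hr3⟩ := (show ∃ r > 0, r ≤ δ1 ∧ r ≤ δ2 ∧ r < (b - a) / 2 from
    ⟨min (min δ1 δ2) ((b - a) / 4), lt_min (lt_min hδ1 hδ2) (by linarith),
      (min_le_left _ _).trans (min_le_left _ _), (min_le_left _ _).trans (min_le_right _ _),
      (min_le_right _ _).trans_lt (by linarith)⟩)
  obtain ⟨a', ha', b', hb', d1, d2, h⟩ := key r hr hr3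
  have e1 := h1 a' ha' (d1.trans_le hr1)
  have e2 := h2 b' hb' (d2.trans_le hr2)
  rw [h] at e1
  linarith [dist_triangle_left (γ a) (γ b) (γ b')]

lemma exists_minimal_gapClosed {γ : ℝ → E} (hγ : ContinuousOn γ (Icc 0 1)) :
    ∃ F, GapClosed γ F ∧ ∀ s ∈ F, ∀ t ∈ F, s < t → γ s = γ t → F ∩ Ioo s t = ∅ := by
  have h0 : GapClosed γ (Icc 0 1) := by
    refine ⟨Subset.rfl, isClosed_Icc, by simp, by simp, fun a ha b hb hab h => ?_⟩
    have : (a + b) / 2 ∈ Icc (0:ℝ) 1 ∩ Ioo a b :=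
      ⟨⟨by linarith [ha.1, hb.1], by linarith [ha.2, hb.2]⟩, by linarith, by linarith⟩
    rw [h] at this
    exact this.elim
  obtain ⟨F, hF, hmin⟩ := zorn_superset_nonempty {F | GapClosed γ F}
    (fun c hc hchain hne => ⟨⋂₀ c, GapClosed.sInter hγ hc hchain hne,
      fun s hs => sInter_subset_of_mem hs⟩) _ h0
  have hG : GapClosed γ F := hmin.prop
  refine ⟨F, hG, fun s hs t ht hst hγst => ?_⟩
  have h' : GapClosed γ (F \ Ioo s t) := by
    obtain ⟨g1, g2, g3, g4, g5⟩ := hG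
    refine ⟨sdiff_subset.trans g1, g2.sdiff isOpen_Ioo, ⟨g3, fun h => ?_⟩, ⟨g4, fun h => ?_⟩, ?_⟩
    · linarith [h.1, (g1 hs).1]
    · linarith [h.2, (g1 ht).2]
    rintro a ⟨ha, ha'⟩ b ⟨hb, hb'⟩ hab hgap
    have hgap' : ∀ x ∈ F, x ∉ Ioo s t → x ∉ Ioo a b := fun x hx hx' hxab => by
      have : x ∈ F \ Ioo s t ∩ Ioo a b := ⟨⟨hx, hx'⟩, hxab⟩
      rw [hgap] at this; exact this
    by_cases hbs : b ≤ s
    · refine g5 a ha b hb hab (Set.eq_empty_iff_forall_notMem.mpr ?_)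
      rintro x ⟨hx, hx2⟩
      exact hgap' x hx (fun h => by linarith [h.1, hx2.2]) hx2
    by_cases hta : t ≤ a
    · refine g5 a ha b hb hab (Set.eq_empty_iff_forall_notMem.mpr ?_)
      rintro x ⟨hx, hx2⟩
      exact hgap' x hx (fun h => by linarith [h.2, hx2.1]) hx2
    push Not at hbs hta
    have as : a ≤ s := by
      by_contra! h; exact ha' ⟨h, hta⟩
    have tb : t ≤ b := by
      by_contra! h; exact hb' ⟨hbs, h⟩
    have as' : a = s := by
      by_contra h
      exact hgap' s hs (fun h => lt_irrefl _ h.1) ⟨as.lt_of_ne h, hbs⟩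
    have tb' : t = b := by
      by_contra h
      exact hgap' t ht (fun h => lt_irrefl _ h.2) ⟨hta, tb.lt_of_ne h⟩
    rw [as', ← tb', hγst]
  have hsub : F ⊆ F \ Ioo s t := hmin.le_of_le h' sdiff_subset
  rw [Set.eq_empty_iff_forall_notMem]
  exact fun x hx => (hsub hx.1).2 hx.2

lemma exists_monotone_path {γ : ℝ → E} (hγ : ContinuousOn γ (Icc 0 1)) :
    ∃ g : ℝ → E, ContinuousOn g (Icc 0 1) ∧ g 0 = γ 0 ∧ g 1 = γ 1 ∧ g '' Icc 0 1 ⊆ γ '' Icc 0 1 ∧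
      ∀ s ∈ Icc (0:ℝ) 1, ∀ t ∈ Icc (0:ℝ) 1, s ≤ t → g s = g t → ∀ u ∈ Icc s t, g u = g s := by
  obtain ⟨F, ⟨FI, Fc, F0, F1, Fg⟩, Finj⟩ := exists_minimal_gapClosed hγ
  have hcp : ∀ x, IsCompact (F ∩ Icc 0 x) := fun x => isCompact_Icc.inter_left Fc
  set σ : ℝ → ℝ := fun x => sSup (F ∩ Icc 0 x) with hσ
  have mσ : ∀ x ∈ Icc (0:ℝ) 1, σ x ∈ F ∩ Icc 0 x := fun x hx =>
    (hcp x).sSup_mem ⟨0, F0, le_rfl, hx.1⟩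
  have maxσ : ∀ x, ∀ z ∈ F, z ≤ x → z ≤ σ x := fun x z hz hzx =>
    le_csSup (hcp x).bddAbove ⟨hz, (FI hz).1, hzx⟩
  have σF : ∀ x ∈ F, σ x = x := fun x hx =>
    le_antisymm (mσ x (FI hx)).2.2 (maxσ x x hx le_rfl)
  have near : ∀ x ∈ F, ∀ y ∈ Icc (0:ℝ) 1, ∃ z ∈ Icc (0:ℝ) 1, dist z x ≤ dist y x ∧ γ (σ y) = γ z := by
    intro x hx y hy
    rcases le_total x y with h | h
    · refine ⟨σ y, FI (mσ y hy).1, ?_, rfl⟩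
      have h1 := maxσ y x hx h
      have h2 := (mσ y hy).2.2
      rw [Real.dist_eq, Real.dist_eq, abs_of_nonneg (by linarith), abs_of_nonneg (by linarith)]
      linarith
    · by_cases hyF : y ∈ F
      · exact ⟨y, hy, le_rfl, by rw [σF y hyF]⟩
      obtain ⟨a', ha', b', hb', h1, h2, h3, h4, h5⟩ := exists_gap Fc F0 hx hy.1 h le_rfl (by
        rw [Icc_self, Set.eq_empty_iff_forall_notMem]
        rintro z ⟨hz, rfl⟩
        exact hyF hz)
      have : σ y = a' := by
        refine le_antisymm ?_ (maxσ y a' ha' h2.le)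
        by_contra! hlt
        have : σ y ∈ F ∩ Ioo a' b' := ⟨(mσ y hy).1, hlt, (mσ y hy).2.2.trans_lt h3⟩
        rw [h5] at this; exact this
      refine ⟨b', FI hb', ?_, by rw [this]; exact Fg a' ha' b' hb' (h2.trans h3) h5⟩
      rw [Real.dist_eq, Real.dist_eq, abs_of_nonpos (by linarith), abs_of_nonpos (by linarith)]
      linarith
  refine ⟨γ ∘ σ, ?_, by simp [σF 0 F0], by simp [σF 1 F1], ?_, ?_⟩
  · intro x hx
    by_cases hxF : x ∈ F
    · rw [Metric.continuousWithinAt_iff]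
      intro e he
      obtain ⟨δ, hδ, h⟩ := Metric.continuousOn_iff.mp hγ x hx e he
      refine ⟨δ, hδ, fun y hy hyx => ?_⟩
      obtain ⟨z, hz, hz1, hz2⟩ := near x hxF y hy
      simp only [Function.comp, hz2, σF x hxF]
      exact h z hz (hz1.trans_lt hyx)
    · obtain ⟨a', ha', b', hb', h1, h2, h3, h4, h5⟩ := exists_gap Fc F0 F1 hx.1 hx.2 le_rfl (by
        rw [Icc_self, Set.eq_empty_iff_forall_notMem]
        rintro z ⟨hz, rfl⟩
        exact hxF hz)
      have hloc : ∀ y ∈ Ioo a' b', σ y = a' := by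
        intro y hy
        have hyI : y ∈ Icc (0:ℝ) 1 := ⟨h1.trans hy.1.le, hy.2.le.trans h4⟩
        refine le_antisymm ?_ (maxσ y a' ha' hy.1.le)
        by_contra! hlt
        have : σ y ∈ F ∩ Ioo a' b' := ⟨(mσ y hyI).1, hlt, (mσ y hyI).2.2.trans_lt hy.2⟩
        rw [h5] at this; exact this
      refine (ContinuousAt.congr (continuousAt_const (y := γ a')) ?_).continuousWithinAt
      filter_upwards [Ioo_mem_nhds h2 h3] with y hy
      simp [hloc y hy]
  · rintro _ ⟨x, hx, rfl⟩
    exact ⟨σ x, FI (mσ x hx).1, rfl⟩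
  · intro s hs t ht hst hg u hu
    have huI : u ∈ Icc (0:ℝ) 1 := ⟨hs.1.trans hu.1, hu.2.trans ht.2⟩
    have h1 : σ s ≤ σ u := maxσ u _ (mσ s hs).1 ((mσ s hs).2.2.trans hu.1)
    have h2 : σ u ≤ σ t := maxσ t _ (mσ u huI).1 ((mσ u huI).2.2.trans hu.2)
    simp only [Function.comp] at hg ⊢
    rcases (h1.trans h2).eq_or_lt with h | h
    · rw [le_antisymm (h2.trans h.ge) h1]
    · have := Finj _ (mσ s hs).1 _ (mσ t ht).1 h hg
      rcases h1.eq_or_lt with h3 | h3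
      · rw [h3]
      rcases h2.eq_or_lt with h4 | h4
      · rw [h4, hg]
      · have h5 : σ u ∈ F ∩ Ioo (σ s) (σ t) := ⟨(mσ u huI).1, h3, h4⟩
        rw [this] at h5; exact h5.elim

lemma isArc_of_monotone_path {g : ℝ → E} (hg : Continuous g) (hne : g 0 ≠ g 1)
    (hm : ∀ s ∈ Icc (0:ℝ) 1, ∀ t ∈ Icc (0:ℝ) 1, s ≤ t → g s = g t → ∀ u ∈ Icc s t, g u = g s) :
    IsArc (g '' Icc 0 1) (g 0) (g 1) := by
  set h : ℝ → ℝ → ℝ := fun x u => sInf ((fun v => dist (g u) (g (v * x))) '' Icc 0 1) with hh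
  have hcont : Continuous (Function.uncurry h) :=
    isCompact_Icc.continuous_sInf (f := fun (p : ℝ × ℝ) v => dist (g p.2) (g (v * p.1)))
      (by fun_prop)
  have hval : ∀ x ∈ Icc (0:ℝ) 1, ∀ u, h x u = infDist (g u) (g '' Icc 0 x) := by
    intro x hx u
    have himg : (fun v : ℝ => v * x) '' Icc 0 1 = Icc 0 x := by
      rcases hx.1.eq_or_lt with h | h
      · subst h; simp
      · rw [image_mul_right_Icc' _ _ h]; simp
    rw [infDist_eq_iInf, ← himg, image_image, hh, ← sInf_image']
    simp only [image_image]
  set G : ℝ → ℝ := fun x => ∫ u in (0:ℝ)..1, h x u with hG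
  have Gc : Continuous G :=
    intervalIntegral.continuous_parametric_intervalIntegral_of_continuous' hcont 0 1
  have Geq : ∀ x ∈ Icc (0:ℝ) 1, ∀ y ∈ Icc (0:ℝ) 1, x ≤ y → g x = g y → G x = G y := by
    intro x hx y hy hxy hgxy
    have : g '' Icc 0 x = g '' Icc 0 y := by
      refine Subset.antisymm (image_mono (Icc_subset_Icc_right hxy)) ?_
      rintro _ ⟨u, hu, rfl⟩
      rcases le_total u x with h | h
      · exact ⟨u, ⟨hu.1, h⟩, rfl⟩
      · exact ⟨x, ⟨hx.1, le_rfl⟩, (hm x hx y hy hxy hgxy u ⟨h, hu.2⟩).symm⟩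
    simp only [hG, hval x hx, hval y hy, this]
  have Glt : ∀ x ∈ Icc (0:ℝ) 1, ∀ y ∈ Icc (0:ℝ) 1, x ≤ y → g x ≠ g y → G y < G x := by
    intro x hx y hy hxy hgxy
    have hc : ∀ x, Continuous (h x) := fun x => hcont.comp (by fun_prop : Continuous fun u => (x, u))
    have hle : ∀ u, h y u ≤ h x u := fun u => by
      rw [hval x hx, hval y hy]
      exact infDist_le_infDist_of_subset (image_mono (Icc_subset_Icc_right hxy))
        ⟨_, 0, ⟨le_rfl, hx.1⟩, rfl⟩
    refine intervalIntegral.integral_lt_integral_of_continuousOn_of_le_of_exists_lt zero_lt_one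
      (hc y).continuousOn (hc x).continuousOn (fun u _ => hle u) ⟨y, hy, ?_⟩
    have h0 : h y y = 0 := by
      rw [hval y hy]; exact infDist_zero_of_mem ⟨y, ⟨hy.1, le_rfl⟩, rfl⟩
    rw [h0, hval x hx]
    refine ((isCompact_Icc.image hg).isClosed.notMem_iff_infDist_pos
      ⟨_, 0, ⟨le_rfl, hx.1⟩, rfl⟩).mp ?_
    rintro ⟨u, hu, hgu⟩
    exact hgxy ((hm u ⟨hu.1, hu.2.trans hx.2⟩ y hy (hu.2.trans hxy) hgu x ⟨hu.2, hxy⟩).trans hgu)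
  have Giff : ∀ x ∈ Icc (0:ℝ) 1, ∀ y ∈ Icc (0:ℝ) 1, (G x = G y ↔ g x = g y) := by
    intro x hx y hy
    constructor
    · intro h
      by_contra hne
      rcases le_total x y with h' | h'
      · exact (Glt x hx y hy h' hne).ne' h
      · exact (Glt y hy x hx h' (Ne.symm hne)).ne h
    · intro h
      rcases le_total x y with h' | h'
      · exact Geq x hx y hy h' h
      · exact (Geq y hy x hx h' h.symm).symm
  have i0 : (0:ℝ) ∈ Icc (0:ℝ) 1 := by simp
  have i1 : (1:ℝ) ∈ Icc (0:ℝ) 1 := by simp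
  have hlt : G 1 < G 0 := Glt 0 i0 1 i1 zero_le_one hne
  have himg : G '' Icc 0 1 = Icc (G 1) (G 0) := by
    refine Subset.antisymm ?_ (intermediate_value_Icc' zero_le_one Gc.continuousOn)
    rintro _ ⟨x, hx, rfl⟩
    have a1 : G x ≤ G 0 := by
      by_cases h : g 0 = g x
      · exact (Geq 0 i0 x hx hx.1 h).ge
      · exact (Glt 0 i0 x hx hx.1 h).le
    have a2 : G 1 ≤ G x := by
      by_cases h : g x = g 1
      · exact (Geq x hx 1 i1 hx.2 h).ge
      · exact (Glt x hx 1 i1 hx.2 h).le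
    exact ⟨a2, a1⟩
  have hsurj : SurjOn G (Icc 0 1) (Icc (G 1) (G 0)) := himg.ge
  set k : ℝ → E := fun s => g (Function.invFunOn G (Icc 0 1) s) with hk
  have kmem : ∀ s ∈ Icc (G 1) (G 0), Function.invFunOn G (Icc 0 1) s ∈ Icc (0:ℝ) 1 :=
    fun s hs => Function.invFunOn_mem (hsurj hs)
  have keq : ∀ s ∈ Icc (G 1) (G 0), G (Function.invFunOn G (Icc 0 1) s) = s :=
    fun s hs => Function.invFunOn_eq (hsurj hs)
  have kG : ∀ x ∈ Icc (0:ℝ) 1, k (G x) = g x := by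
    intro x hx
    have hGx : G x ∈ Icc (G 1) (G 0) := himg ▸ mem_image_of_mem _ hx
    exact (Giff _ (kmem _ hGx) x hx).mp (keq _ hGx)
  have kc : ContinuousOn k (Icc (G 1) (G 0)) := by
    rw [continuousOn_iff_isClosed]
    intro C hC
    refine ⟨G '' (g ⁻¹' C ∩ Icc 0 1),
      ((isCompact_Icc.inter_left (hC.preimage hg)).image Gc).isClosed, ?_⟩
    ext s
    constructor
    · rintro ⟨hs, hsI⟩
      exact ⟨⟨_, ⟨hs, kmem s hsI⟩, keq s hsI⟩, hsI⟩
    · rintro ⟨⟨x, ⟨hx, hxI⟩, rfl⟩, hsI⟩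
      refine ⟨?_, hsI⟩
      rw [mem_preimage, kG x hxI]
      exact hx
  have ki : InjOn k (Icc (G 1) (G 0)) := by
    intro s hs t ht hst
    rw [← keq s hs, ← keq t ht]
    exact (Giff _ (kmem s hs) _ (kmem t ht)).mpr hst
  have := (isArc_image_Icc hlt kc ki).symm
  rw [kG 0 i0, kG 1 i1, ← himg, image_image] at this
  rwa [image_congr kG] at this

/-- A path with distinct ends contains an arc with the same ends. -/
theorem exists_isArc_of_path {γ : ℝ → E} (hγ : ContinuousOn γ (Icc 0 1)) (hne : γ 0 ≠ γ 1) :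
    ∃ A, IsArc A (γ 0) (γ 1) ∧ A ⊆ γ '' Icc 0 1 := by
  obtain ⟨g, gc, g0, g1, gi, gm⟩ := exists_monotone_path hγ
  have hp : EqOn (IccExtend zero_le_one ((Icc (0:ℝ) 1).domRestrict g)) g (Icc 0 1) := fun x hx => by
    rw [IccExtend_of_mem _ _ hx]; rfl
  have i0 : (0:ℝ) ∈ Icc (0:ℝ) 1 := by simp
  have i1 : (1:ℝ) ∈ Icc (0:ℝ) 1 := by simp
  have := isArc_of_monotone_path (g := IccExtend zero_le_one ((Icc (0:ℝ) 1).domRestrict g))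
    (continuousOn_iff_continuous_domRestrict.mp gc).Icc_extend' (by rw [hp i0, hp i1, g0, g1]; exact hne) (by
      intro s hs t ht hst h u hu
      rw [hp hs, hp ht] at h
      rw [hp hs, hp ⟨hs.1.trans hu.1, hu.2.trans ht.2⟩]
      exact gm s hs t ht hst h u hu)
  rw [hp i0, hp i1, g0, g1, image_congr hp] at this
  exact ⟨_, this, gi⟩

end PathToArc

lemma IsJordanCurve.locally_joined {J : Set ℂ} (hJ : IsJordanCurve J) {a : ℂ} (ha : a ∈ J) {ε : ℝ}
    (hε : 0 < ε) : ∃ δ > 0, ∀ x ∈ ball a δ, ∀ y ∈ ball a δ, JoinedIn Jᶜ x y →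
      JoinedIn (ball a ε \ J) x y := by
  obtain ⟨A, B, p, q, hA, hB, hAB, rfl, hp, hBU⟩ := hJ.small_arc ha (ball_mem_nhds a hε)
  have haA : a ∉ A := fun h => hp.2 (hAB ▸ ⟨h, hp.1⟩)
  obtain ⟨δ, hδ, hd⟩ := Metric.mem_nhds_iff.mp (hA.isCompact.isClosed.isOpen_compl.mem_nhds haA)
  refine ⟨min δ ε, lt_min hδ hε, fun x hx y hy hxy => ?_⟩
  have hcap : (A ∪ sphere a ε) ∩ (A ∪ B) = A := by
    ext z
    constructor
    · rintro ⟨h | h, h' | h'⟩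
      · exact h
      · exact h
      · exact h'
      · exact absurd h (ne_of_lt (hBU h'))
    · exact fun h => ⟨Or.inl h, Or.inl h⟩
  have h1 : JoinedIn (A ∪ sphere a ε)ᶜ x y := by
    refine (((convex_ball a (min δ ε)).isPathConnected
      ⟨a, mem_ball_self (lt_min hδ hε)⟩).joinedIn x hx y hy).mono ?_
    rintro z hz (h | h)
    · exact hd (ball_subset_ball (min_le_left _ _) hz) h
    · exact absurd h (ne_of_lt (hz.trans_le (min_le_right _ _)))
  have h2 := joinedIn_compl_union (hA.isCompact.union (isCompact_sphere a ε)) hJ.isCompact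
    (by rw [hcap]; exact hA.isConnected.isPreconnected) h1 hxy
  refine JoinedIn.of_union_disjoint (U := ball a ε \ (A ∪ B)) (V := (closedBall a ε)ᶜ)
    (isOpen_ball.sdiff hJ.isCompact.isClosed) isClosed_closedBall.isOpen_compl ?_ (h2.mono ?_)
    ⟨ball_subset_ball (min_le_right _ _) hx, hxy.source_mem⟩
  · rw [Set.disjoint_left]
    exact fun z hz h => h (ball_subset_closedBall hz.1)
  · intro z hz
    rcases lt_trichotomy (dist z a) ε with h | h | h
    · exact Or.inl ⟨h, fun h' => hz (Or.inr h')⟩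
    · exact absurd (Or.inl (Or.inr h)) hz
    · exact Or.inr (not_le.mpr h)

/-- Infinite concatenation of paths. -/
lemma exists_concat {X : Type*} [TopologicalSpace X] {g : ℕ → ℝ → X} (hg : ∀ n, Continuous (g n))
    (h : ∀ n, g n 1 = g (n + 1) 0) :
    ∃ f : ℝ → X, ContinuousOn f (Ici 0) ∧ ∀ n : ℕ, ∀ t ∈ Icc (n:ℝ) (n + 1), f t = g n (t - n) := by
  set f : ℝ → X := fun t => g ⌊t⌋₊ (t - ⌊t⌋₊)
  have hf : ∀ n : ℕ, ∀ t ∈ Icc (n:ℝ) (n + 1), f t = g n (t - n) := by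
    intro n t ht
    rcases ht.2.eq_or_lt with rfl | hlt
    · have : ⌊(n:ℝ) + 1⌋₊ = n + 1 := by exact_mod_cast Nat.floor_natCast (n + 1)
      simp only [f, this]
      push_cast
      rw [sub_self, ← h n]
      congr 1; ring
    · have : ⌊t⌋₊ = n := (Nat.floor_eq_iff (n.cast_nonneg.trans ht.1)).mpr ⟨ht.1, hlt⟩
      simp only [f, this]
  refine ⟨f, ?_, hf⟩
  have hU : Ici (0:ℝ) ⊆ ⋃ n : ℕ, Icc (n:ℝ) (n + 1) := fun t ht =>
    mem_iUnion.mpr ⟨⌊t⌋₊, Nat.floor_le ht, (Nat.lt_floor_add_one t).le⟩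
  refine ContinuousOn.mono ?_ hU
  refine LocallyFinite.continuousOn_iUnion ?_ (fun n => isClosed_Icc) fun n => ?_
  · intro t
    refine ⟨Iio (t + 1), Iio_mem_nhds (by linarith), (finite_le_nat ⌈t + 1⌉₊).subset ?_⟩
    rintro n ⟨s, hs, hs'⟩
    have : (n:ℝ) ≤ ⌈t + 1⌉₊ := (hs.1.trans (le_of_lt hs')).trans (Nat.le_ceil _)
    exact_mod_cast this
  · exact ((hg n).comp (by fun_prop : Continuous fun t : ℝ => t - n)).continuousOn.congr (hf n)

/-- `a` is the end of a path which otherwise runs in `U`. -/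
def Accessible (U : Set ℂ) (a : ℂ) : Prop :=
  ∃ γ : ℝ → ℂ, ContinuousOn γ (Icc 0 1) ∧ γ 1 = a ∧ ∀ t ∈ Ico (0:ℝ) 1, γ t ∈ U

lemma IsJordanCurve.accessible {J : Set ℂ} (hJ : IsJordanCurve J) {a x : ℂ} (ha : a ∈ J)
    (hcl : a ∈ closure (pathComponentIn Jᶜ x)) : Accessible (pathComponentIn Jᶜ x) a := by
  have h1 : ∀ n : ℕ, ∃ δ > 0, ∀ x ∈ ball a δ, ∀ y ∈ ball a δ, JoinedIn Jᶜ x y →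
      JoinedIn (ball a (1 / ((n:ℝ) + 1)) \ J) x y := fun n =>
    hJ.locally_joined ha Nat.one_div_pos_of_nat
  choose δ δpos hδ using h1
  obtain ⟨ε, hε⟩ := exists_halving_seq δpos
  have h2 : ∀ n, ∃ y ∈ pathComponentIn Jᶜ x, y ∈ ball a (ε n) := fun n => by
    obtain ⟨y, hy, hd⟩ := Metric.mem_closure_iff.mp hcl (ε n) (hε n).1
    exact ⟨y, hy, by rwa [mem_ball, dist_comm]⟩
  choose y hy hyb using h2
  have h3 : ∀ n, ∃ g : ℝ → ℂ, Continuous g ∧ g 0 = y n ∧ g 1 = y (n + 1) ∧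
      ∀ u, g u ∈ ball a (1 / ((n:ℝ) + 1)) \ J := fun n => by
    refine (hδ n (y n) (ball_subset_ball (hε n).2.1 (hyb n)) (y (n + 1))
      (ball_subset_ball ?_ (hyb (n + 1))) ((hy n).symm.trans (hy (n + 1)))).exists_continuousOn
      zero_lt_one
    linarith [hε n]
  choose g gc g0 g1 gm using h3
  obtain ⟨f, fc, hf⟩ := exists_concat gc (fun n => (g1 n).trans (g0 (n + 1)).symm)
  have fm : ∀ n : ℕ, ∀ t ≥ (n:ℝ), f t ∈ ball a (1 / ((n:ℝ) + 1)) \ J := by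
    intro n t ht
    have ht0 : 0 ≤ t := n.cast_nonneg.trans ht
    rw [hf ⌊t⌋₊ t ⟨Nat.floor_le ht0, (Nat.lt_floor_add_one t).le⟩]
    have hn : n ≤ ⌊t⌋₊ := Nat.le_floor ht
    refine ⟨ball_subset_ball ?_ (gm _ _).1, (gm _ _).2⟩
    exact one_div_le_one_div_of_le (by positivity) (by exact_mod_cast Nat.succ_le_succ hn)
  have f0 : f 0 = y 0 := by
    rw [hf 0 0 (by simp)]; simpa using g0 0
  set s : ℝ → ℝ := fun t => t / (1 - t)
  have s0 : ∀ t ∈ Ico (0:ℝ) 1, 0 ≤ s t := fun t ht => div_nonneg ht.1 (by linarith [ht.2])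
  have sc : ContinuousOn s (Ico 0 1) := by
    refine continuousOn_id.div (by fun_prop) fun t ht => ?_
    have := ht.2
    intro h; linarith
  have c1 : ContinuousOn (fun t => f (s t)) (Ico 0 1) := fc.comp sc s0
  have comp : ∀ t ∈ Ico (0:ℝ) 1, f (s t) ∈ pathComponentIn Jᶜ x := by
    intro t ht
    have hI : Icc 0 t ⊆ Ico (0:ℝ) 1 := fun u hu => ⟨hu.1, hu.2.trans_lt ht.2⟩
    have hp : IsPathConnected ((fun t => f (s t)) '' Icc 0 t) :=
      ((convex_Icc 0 t).isPathConnected ⟨0, le_rfl, ht.1⟩).image' (c1.mono hI)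
    have hj := (hp.joinedIn _ ⟨0, ⟨le_rfl, ht.1⟩, rfl⟩ _ ⟨t, ⟨ht.1, le_rfl⟩, rfl⟩).mono
      (V := Jᶜ) (by
        rintro _ ⟨u, hu, rfl⟩
        exact (fm 0 _ (by simpa using s0 u (hI hu))).2)
    simp only [s, zero_div, f0] at hj
    exact (hy 0).trans hj
  refine ⟨fun t => if t < 1 then f (s t) else a, ?_, by simp, fun t ht => by
    simp only [ht.2, if_true]; exact comp t ht⟩
  intro t ht
  rcases ht.2.eq_or_lt with rfl | hlt
  · rw [Metric.continuousWithinAt_iff]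
    intro e he
    obtain ⟨n, hn⟩ := exists_nat_one_div_lt he
    refine ⟨1 / ((n:ℝ) + 1), Nat.one_div_pos_of_nat, fun u hu hd => ?_⟩
    simp only [lt_irrefl, if_false]
    split_ifs with h
    · refine lt_trans (fm n (s u) ?_).1 hn
      rw [Real.dist_eq, abs_of_nonpos (by linarith)] at hd
      have h1u : 0 < 1 - u := by linarith
      simp only [s]
      rw [ge_iff_le, le_div_iff₀ h1u]
      have hn1 : (0:ℝ) < n + 1 := by positivity
      rw [lt_div_iff₀ hn1] at hd
      nlinarith
    · simpa using he
  · have := (c1 t ⟨ht.1, hlt⟩).congr (f := fun t => f (s t))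
      (g := fun t => if t < 1 then f (s t) else a) (fun u hu => if_pos hu.2) (if_pos hlt)
    refine this.mono_of_mem_nhdsWithin ?_
    filter_upwards [mem_nhdsWithin_of_mem_nhds (Iio_mem_nhds hlt), self_mem_nhdsWithin] with u h1 h2
    exact ⟨h2.1, h1⟩

lemma Accessible.mono {U V : Set ℂ} {a : ℂ} (h : Accessible U a) (hUV : U ⊆ V) : Accessible V a := by
  obtain ⟨γ, h1, h2, h3⟩ := h
  exact ⟨γ, h1, h2, fun t ht => hUV (h3 t ht)⟩

lemma Accessible.nonempty {U : Set ℂ} {a : ℂ} (h : Accessible U a) : U.Nonempty := by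
  obtain ⟨γ, h1, h2, h3⟩ := h
  exact ⟨γ 0, h3 0 (by simp)⟩

lemma Accessible.inter {U N : Set ℂ} {a : ℂ} (h : Accessible U a) (hN : N ∈ 𝓝 a) :
    Accessible (U ∩ N) a := by
  obtain ⟨γ, h1, rfl, h3⟩ := h
  obtain ⟨δ, hδ, hd⟩ := Metric.mem_nhdsWithin_iff.mp
    ((h1 1 (by simp)).preimage_mem_nhdsWithin hN)
  set r := min (δ / 2) 1
  have hr : 0 < r := lt_min (by linarith) one_pos
  have hr1 : r ≤ 1 := min_le_right _ _
  have hrδ : r < δ := (min_le_left _ _).trans_lt (by linarith)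
  have hm : MapsTo (fun t => 1 - r * (1 - t)) (Icc 0 1) (Icc 0 1) := by
    rintro t ⟨h0, h1⟩
    constructor <;> simp only <;> nlinarith
  refine ⟨fun t => γ (1 - r * (1 - t)), h1.comp (by fun_prop) hm, by simp, fun t ht => ?_⟩
  have htI := hm (Ico_subset_Icc_self ht)
  refine ⟨h3 _ ⟨htI.1, ?_⟩, hd ⟨?_, htI⟩⟩
  · nlinarith [ht.2]
  · rw [mem_ball, Real.dist_eq, abs_lt]
    constructor <;> nlinarith [ht.1, ht.2]

lemma exists_path_of_accessible {U : Set ℂ} (hc : IsPathConnected U) {a b : ℂ}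
    (ha : Accessible U a) (hb : Accessible U b) :
    ∃ γ : ℝ → ℂ, ContinuousOn γ (Icc 0 1) ∧ γ 0 = a ∧ γ 1 = b ∧ ∀ t ∈ Ioo (0:ℝ) 1, γ t ∈ U := by
  obtain ⟨α, α1, rfl, α3⟩ := ha
  obtain ⟨β, β1, rfl, β3⟩ := hb
  obtain ⟨g, g1, g2, g3, g4⟩ := (hc.joinedIn _ (α3 0 (by simp)) _ (β3 0 (by simp))).exists_continuousOn
    (show (1/3:ℝ) < 2/3 by norm_num)
  have a1 : ContinuousOn (fun t => α (1 - 3 * t)) (Icc 0 (1/3)) :=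
    α1.comp (by fun_prop) fun t ht => ⟨by linarith [ht.2], by linarith [ht.1]⟩
  have b1 : ContinuousOn (fun t => β (3 * t - 2)) (Icc (2/3) 1) :=
    β1.comp (by fun_prop) fun t ht => ⟨by linarith [ht.1], by linarith [ht.2]⟩
  have c1 := continuousOn_ite_Icc (by norm_num) (by norm_num) a1
    (g1.continuousOn (s := Icc (1/3) (2/3))) (by rw [g2]; norm_num)
  have c2 := continuousOn_ite_Icc (by norm_num) (by norm_num) c1 b1 (by rw [if_neg (by norm_num), g3]; norm_num)
  refine ⟨_, c2, by norm_num, by norm_num, fun t ht => ?_⟩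
  split_ifs with h1 h2
  · exact α3 _ ⟨by linarith, by linarith [ht.1]⟩
  · exact g4 _
  · exact β3 _ ⟨by linarith, by linarith [ht.2]⟩

/-- A null sequence of disjoint compact sets none of which separates the plane. -/
structure IsNullFamily (D : ℕ → Set ℂ) : Prop where
  isCompact : ∀ n, IsCompact (D n)
  disjoint : Pairwise fun i j => Disjoint (D i) (D j)
  diam : Tendsto (fun n => diam (D n)) atTop (𝓝 0)
  joinedIn : ∀ n x y, x ∉ D n → y ∉ D n → JoinedIn (D n)ᶜ x y

/-- The subfamily of those members which satisfy a condition. -/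
lemma IsNullFamily.filter {D : ℕ → Set ℂ} (h : IsNullFamily D) (p : ℕ → Prop) [DecidablePred p] :
    IsNullFamily (fun n => if p n then D n else ∅) := by
  refine ⟨fun n => ?_, fun i j hij => ?_, ?_, fun n x y hx hy => ?_⟩
  · split_ifs
    · exact h.isCompact n
    · exact isCompact_empty
  · beta_reduce; split_ifs <;> simp [h.disjoint hij]
  · refine squeeze_zero (fun n => diam_nonneg) (fun n => ?_) h.diam
    split_ifs
    · exact le_rfl
    · rw [diam_empty]; exact diam_nonneg
  · split_ifs at hx hy ⊢
    · exact h.joinedIn n x y hx hy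
    · rw [compl_empty]
      exact isPathConnected_univ.joinedIn x trivial y trivial

lemma IsNullFamily.exists_bound {D : ℕ → Set ℂ} (h : IsNullFamily D) : ∃ e, ∀ n, Metric.diam (D n) < e := by
  obtain ⟨C, hC⟩ := h.diam.bddAbove_range
  exact ⟨C + 1, fun n => (hC ⟨n, rfl⟩).trans_lt (lt_add_one C)⟩

/-- A path through `U` between points off `U` yields an arc through `U` which avoids a null family,
and stays close to the path if the members of the family in `U` are small. -/
lemma exists_arc_avoiding_near {U : Set ℂ} (hU : IsOpen U) {D : ℕ → Set ℂ} (hD : IsNullFamily D)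
    (hDU : ∀ n, D n ⊆ U ∨ Disjoint (D n) U) {γ : ℝ → ℂ} (hγ : ContinuousOn γ (Icc 0 1))
    (hγU : ∀ t ∈ Ioo (0:ℝ) 1, γ t ∈ U) (h0 : γ 0 ∉ U) (h1 : γ 1 ∉ U) (hne : γ 0 ≠ γ 1)
    {e : ℝ} (he0 : 0 < e) (he : ∀ n, D n ⊆ U → diam (D n) < e) :
    ∃ A, IsArc A (γ 0) (γ 1) ∧ A \ {γ 0, γ 1} ⊆ U ∧ (∀ n, Disjoint (A \ {γ 0, γ 1}) (D n)) ∧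
      A ⊆ cthickening (4 * e) (γ '' Icc 0 1) := by
  classical
  have hD' := hD.filter (fun n => D n ⊆ U)
  have sub : ∀ n, (if D n ⊆ U then D n else ∅) ⊆ U := fun n => by
    split_ifs with h
    · exact h
    · exact empty_subset _
  obtain ⟨g, gc, g0, g1, gU, gd⟩ := exists_path_avoiding hU hD'.isCompact sub hD'.disjoint
    hD'.diam hD'.joinedIn hγ hγU (fun n h => h0 (sub n h)) (fun n h => h1 (sub n h)) (e := e)
    (fun n => by
      split_ifs with h
      · exact he n h
      · rwa [diam_empty])
  obtain ⟨A, hA, hAg⟩ := exists_isArc_of_path gc (by rwa [g0, g1])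
  have key : ∀ z ∈ A \ {γ 0, γ 1}, ∃ t ∈ Ioo (0:ℝ) 1, g t = z := by
    rintro z ⟨hz, hz'⟩
    obtain ⟨t, ht, rfl⟩ := hAg hz
    refine ⟨t, ⟨ht.1.lt_of_ne ?_, ht.2.lt_of_ne ?_⟩, rfl⟩
    · rintro rfl; exact hz' (Or.inl g0)
    · rintro rfl; exact hz' (Or.inr g1)
  rw [g0, g1] at hA
  refine ⟨A, hA, fun z hz => ?_, fun n => ?_, fun z hz => ?_⟩
  · obtain ⟨t, ht, rfl⟩ := key z hz
    exact (gU t ht).1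
  · rw [Set.disjoint_left]
    intro z hz hzD
    obtain ⟨t, ht, rfl⟩ := key z hz
    rcases hDU n with h | h
    · have := (gU t ht).2 n
      rw [if_pos h] at this
      exact this hzD
    · exact Set.disjoint_left.mp h hzD (gU t ht).1
  · obtain ⟨t, ht, rfl⟩ := hAg hz
    exact mem_cthickening_of_dist_le _ (γ t) _ _ ⟨t, ht, rfl⟩ (gd t ht)

lemma exists_arc_avoiding {U : Set ℂ} (hU : IsOpen U) (hc : IsPathConnected U) {D : ℕ → Set ℂ}
    (hD : IsNullFamily D) (hDU : ∀ n, D n ⊆ U ∨ Disjoint (D n) U) {a b : ℂ}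
    (ha : Accessible U a) (hb : Accessible U b) (haU : a ∉ U) (hbU : b ∉ U) (hab : a ≠ b) :
    ∃ A, IsArc A a b ∧ A \ {a, b} ⊆ U ∧ ∀ n, Disjoint (A \ {a, b}) (D n) := by
  obtain ⟨γ, γc, rfl, rfl, γU⟩ := exists_path_of_accessible hc ha hb
  obtain ⟨e, he⟩ := hD.exists_bound
  obtain ⟨A, h1, h2, h3, -⟩ := exists_arc_avoiding_near hU hD hDU γc γU haU hbU hab
    (diam_nonneg.trans_lt (he 0)) (fun n _ => he n)
  exact ⟨A, h1, h2, h3⟩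

lemma IsJordanCurve.accessible_inside {J : Set ℂ} (hJ : IsJordanCurve J) {a : ℂ} (ha : a ∈ J) :
    Accessible (inside J) a := by
  obtain ⟨x, hx⟩ := hJ.inside_nonempty
  refine (hJ.accessible ha (x := x) ?_).mono (pathComponentIn_subset_inside hx)
  exact closure_mono (fun y hy => hJ.joinedIn_inside hx hy) (hJ.subset_closure.1 ha)

lemma IsJordanCurve.accessible_outside {J : Set ℂ} (hJ : IsJordanCurve J) {a : ℂ} (ha : a ∈ J) :
    Accessible (outside J) a := by
  have hb := hJ.isCompact.isBounded
  obtain ⟨x, hx⟩ := outside_nonempty hb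
  refine (hJ.accessible ha (x := x) ?_).mono fun _ h => JoinedIn.mem_outside h hx
  exact closure_mono (fun y hy => joinedIn_of_mem_outside hb hx hy) (hJ.subset_closure.2 ha)

lemma IsJordanCurve.isConnected_fill {J : Set ℂ} (hJ : IsJordanCurve J) : IsConnected (fill J) := by
  rw [← hJ.closure_inside]
  exact hJ.isPathConnected_inside.isConnected.closure

/-- Removing from the inside of a Jordan curve a compact set which does not separate the plane
and has connected intersection with the curve leaves a connected set. -/
lemma IsJordanCurve.isPathConnected_inside_diff {J M : Set ℂ} (hJ : IsJordanCurve J)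
    (hM : IsCompact M) (hJM : IsPreconnected (J ∩ M))
    (hsep : ∀ x y, x ∉ M → y ∉ M → JoinedIn Mᶜ x y) (hne : (inside J \ M).Nonempty) :
    IsPathConnected (inside J \ M) := by
  obtain ⟨x, hx⟩ := hne
  refine ⟨x, hx, fun {y} hy => ?_⟩
  have h := joinedIn_compl_union hJ.isCompact hM hJM (hJ.joinedIn_inside hx.1 hy.1)
    (hsep x y hx.2 hy.2)
  refine JoinedIn.of_union_disjoint ((isOpen_inside hJ.isCompact.isClosed).sdiff hM.isClosed)
    (isOpen_outside hJ.isCompact.isClosed) ?_ (h.mono ?_) hx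
  · exact (disjoint_inside_outside J).mono_left sdiff_subset
  · intro z hz
    simp only [mem_compl_iff, mem_union, not_or] at hz
    have : z ∈ inside J ∪ outside J := by rw [← compl_eq_inside_union_outside]; exact hz.1
    exact this.imp (fun h => ⟨h, hz.2⟩) id

lemma IsPreconnected.subset_inside_or_disjoint {J S : Set ℂ} (hJ : IsClosed J)
    (hS : IsPreconnected S) (h : Disjoint S J) : S ⊆ inside J ∨ Disjoint S (inside J) := by
  have hsub : S ⊆ inside J ∪ outside J := by
    rw [← compl_eq_inside_union_outside]
    exact fun z hz hzJ => disjoint_left.mp h hz hzJ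
  rcases hS.subset_or_subset (isOpen_inside hJ) (isOpen_outside hJ) (disjoint_inside_outside J) hsub
    with h | h
  · exact Or.inl h
  · exact Or.inr ((disjoint_inside_outside J).symm.mono_left h)

/-- The topological part of the splitting of an annulus into two cells: `α` and `β` join the outer
curve `A₁ ∪ A₂` to the inner curve `K₁ ∪ K₂`. -/
lemma annulus_split {A₁ A₂ α β K₁ K₂ : Set ℂ} {a b c d : ℂ} (hA₁ : IsArc A₁ a b)
    (hA₂ : IsArc A₂ a b) (hA : A₁ ∩ A₂ = {a, b}) (hK₁ : IsArc K₁ c d) (hK₂ : IsArc K₂ c d)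
    (hK : K₁ ∩ K₂ = {c, d}) (hα : IsArc α a c) (hβ : IsArc β b d) (hαβ : Disjoint α β)
    (hαK : α ∩ (K₁ ∪ K₂) ⊆ {c}) (hβK : β ∩ (K₁ ∪ K₂) ⊆ {d})
    (hαJ : α \ {a} ⊆ inside (A₁ ∪ A₂)) (hβJ : β \ {b} ⊆ inside (A₁ ∪ A₂))
    (hKJ : K₁ ∪ K₂ ⊆ inside (A₁ ∪ A₂))
    (hside : K₂ \ {c, d} ⊆ inside (A₂ ∪ (α ∪ K₁ ∪ β))) :
    inside (A₁ ∪ (α ∪ K₁ ∪ β)) ⊆ inside (A₁ ∪ A₂) ∧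
    inside (A₂ ∪ (α ∪ K₂ ∪ β)) ⊆ inside (A₁ ∪ A₂) ∧
    Disjoint (inside (A₁ ∪ (α ∪ K₁ ∪ β))) (inside (A₂ ∪ (α ∪ K₂ ∪ β))) ∧
    Disjoint (fill (K₁ ∪ K₂)) (inside (A₁ ∪ (α ∪ K₁ ∪ β))) ∧
    Disjoint (fill (K₁ ∪ K₂)) (inside (A₂ ∪ (α ∪ K₂ ∪ β))) ∧
    fill (A₁ ∪ A₂) \ inside (K₁ ∪ K₂) ⊆
      fill (A₁ ∪ (α ∪ K₁ ∪ β)) ∪ fill (A₂ ∪ (α ∪ K₂ ∪ β)) := by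
  have arc : ∀ {K'}, IsArc K' c d → K' ⊆ K₁ ∪ K₂ → IsArc (α ∪ K' ∪ β) a b := by
    intro K' hK' hsub
    refine (hα.trans hK' ?_).trans hβ.symm ?_
    · exact fun z hz => hαK ⟨hz.1, hsub hz.2⟩
    · rintro z ⟨hz | hz, hz'⟩
      · exact (disjoint_left.mp hαβ hz hz').elim
      · exact hβK ⟨hz', hsub hz⟩
  have hχ := arc hK₁ subset_union_left
  have hχJ : (α ∪ K₁ ∪ β) \ {a, b} ⊆ inside (A₁ ∪ A₂) := by
    rintro z ⟨(hz | hz) | hz, hz'⟩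
    · exact hαJ ⟨hz, fun h => hz' (Or.inl h)⟩
    · exact hKJ (Or.inl hz)
    · exact hβJ ⟨hz, fun h => hz' (Or.inr h)⟩
  have hχJ' : (α ∪ K₁ ∪ β) \ {a, b} ⊆ inside (A₂ ∪ A₁) := by rwa [union_comm A₂]
  have t1 := theta_half hA₁ hA₂ hA hχ hχJ
  have t2 := theta_half hA₂ hA₁ (by rwa [inter_comm]) hχ hχJ'
  have td := theta_disjoint hA₁ hA₂ hA hχ hχJ
  have tc := theta_cover hA₁ hA₂ hA hχ hχJ
  -- the second `θ`-curve
  have mJ : ∀ z ∈ A₁ ∪ A₂, z ∉ inside (A₁ ∪ A₂) := fun z h h' =>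
    disjoint_left.mp (disjoint_inside_self _) h' h
  have hBarc : IsArc (α ∪ A₂ ∪ β) c d := by
    refine (hα.symm.trans hA₂ ?_).trans hβ ?_
    · intro z hz
      by_contra h
      exact mJ z (Or.inr hz.2) (hαJ ⟨hz.1, h⟩)
    · rintro z ⟨hz | hz, hz'⟩
      · exact (disjoint_left.mp hαβ hz hz').elim
      · by_contra h
        exact mJ z (Or.inr hz) (hβJ ⟨hz', h⟩)
  have hBK : (α ∪ A₂ ∪ β) ∩ K₁ = {c, d} := by
    apply Subset.antisymm
    · rintro z ⟨(hz | hz) | hz, hz'⟩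
      · exact Or.inl (hαK ⟨hz, Or.inl hz'⟩)
      · exact (mJ z (Or.inr hz) (hKJ (Or.inl hz'))).elim
      · exact Or.inr (hβK ⟨hz, Or.inl hz'⟩)
    · rintro z (rfl | rfl)
      · exact ⟨Or.inl (Or.inl hα.right_mem), hK₁.left_mem⟩
      · exact ⟨Or.inr hβ.right_mem, hK₁.right_mem⟩
  have e1 : α ∪ A₂ ∪ β ∪ K₁ = A₂ ∪ (α ∪ K₁ ∪ β) := by ext z; simp only [mem_union]; tauto
  have e2 : α ∪ A₂ ∪ β ∪ K₂ = A₂ ∪ (α ∪ K₂ ∪ β) := by ext z; simp only [mem_union]; tauto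
  rw [← e1] at hside
  have s1 := theta_half hBarc hK₁ hBK hK₂ hside
  have s2 := theta_half hK₁ hBarc (by rwa [inter_comm]) hK₂ (by rwa [union_comm K₁])
  have sd := theta_disjoint hBarc hK₁ hBK hK₂ hside
  have sc := theta_cover hBarc hK₁ hBK hK₂ hside
  rw [union_comm K₁ (α ∪ A₂ ∪ β)] at s2
  rw [e1] at s1 s2 sc hside
  rw [e2] at s1 sd sc
  rw [union_comm A₂ A₁] at t2
  refine ⟨t1.2.2.1.trans sdiff_subset, (s1.2.2.1.trans sdiff_subset).trans
    (t2.2.2.1.trans sdiff_subset), td.mono_right (s1.2.2.1.trans sdiff_subset), ?_, ?_, ?_⟩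
  · rw [Set.disjoint_left]
    rintro z ((hz | hz) | hz) hz'
    · exact (t1.2.2.1 hz').2 (Or.inl (Or.inr hz))
    · by_cases h : z ∈ ({c, d} : Set ℂ)
      · refine (t1.2.2.1 hz').2 (Or.inl (Or.inr ?_))
        rcases h with rfl | rfl
        exacts [hK₁.left_mem, hK₁.right_mem]
      · exact disjoint_left.mp td hz' (hside ⟨hz, h⟩)
    · exact disjoint_left.mp td hz' (s2.2.2.1 hz).1
  · rw [Set.disjoint_left]
    rintro z ((hz | hz) | hz) hz'
    · exact disjoint_left.mp (disjoint_inside_self _) (s1.2.2.1 hz').1 (Or.inr (Or.inl (Or.inr hz)))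
    · exact (s1.2.2.1 hz').2 hz
    · exact disjoint_left.mp sd hz' hz
  · rintro z ⟨(hz | hz) | hz, hzK⟩
    · exact Or.inl (Or.inl (Or.inl hz))
    · exact Or.inr (Or.inl (Or.inl hz))
    · by_cases h : z ∈ α ∪ K₁ ∪ β
      · exact Or.inl (Or.inl (Or.inr h))
      · have := tc.subset ⟨hz, h⟩
        rcases this with h1 | h1
        · exact Or.inl (Or.inr h1)
        · by_cases h2 : z ∈ K₂
          · exact Or.inr (Or.inl (Or.inr (Or.inl (Or.inr h2))))
          · rcases sc.subset ⟨h1, h2⟩ with h3 | h3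
            · exact Or.inr (Or.inr h3)
            · exact (hzK h3).elim

/-- A sequence of (possibly empty) Jordan curves bounding a null sequence of disjoint disks. -/
structure IsHoles (K : ℕ → Set ℂ) : Prop where
  curve : ∀ n, K n = ∅ ∨ IsJordanCurve (K n)
  null : IsNullFamily fun n => fill (K n)

/-- The planar properties of the subdivision of the cell with boundary `A₁ ∪ A₂` into cells with
boundaries `A₁ ∪ B₁` and `A₂ ∪ B₂`. -/
structure IsSplit (K : ℕ → Set ℂ) (A₁ A₂ B₁ B₂ : Set ℂ) : Prop where
  sub₁ : inside (A₁ ∪ B₁) ⊆ inside (A₁ ∪ A₂)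
  sub₂ : inside (A₂ ∪ B₂) ⊆ inside (A₁ ∪ A₂)
  disj : Disjoint (inside (A₁ ∪ B₁)) (inside (A₂ ∪ B₂))
  good₁ : ∀ n, fill (K n) ⊆ inside (A₁ ∪ B₁) ∨ Disjoint (fill (K n)) (inside (A₁ ∪ B₁))
  good₂ : ∀ n, fill (K n) ⊆ inside (A₂ ∪ B₂) ∨ Disjoint (fill (K n)) (inside (A₂ ∪ B₂))
  cover : fill (A₁ ∪ A₂) \ ⋃ n, inside (K n) ⊆ fill (A₁ ∪ B₁) ∪ fill (A₂ ∪ B₂)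

/-- A family of holes none of which meets the boundary of the cell `J` from the inside. -/
def IsGood (K : ℕ → Set ℂ) (J : Set ℂ) : Prop :=
  ∀ n, fill (K n) ⊆ inside J ∨ Disjoint (fill (K n)) (inside J)

lemma inside_empty : inside ∅ = ∅ := by
  refine eq_empty_of_forall_notMem fun z hz => ?_
  have h := hz.2
  have hu : pathComponentIn univ z = univ :=
    eq_univ_of_forall fun w => isPathConnected_univ.joinedIn z trivial w trivial
  rw [compl_empty, hu] at h
  exact NormedSpace.unbounded_univ ℝ ℂ h

lemma fill_empty : fill ∅ = ∅ := by rw [fill, inside_empty, union_self]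

lemma IsHoles.isPreconnected_fill {K : ℕ → Set ℂ} (hK : IsHoles K) (n : ℕ) :
    IsPreconnected (fill (K n)) := by
  rcases hK.curve n with h | h
  · rw [h, fill_empty]; exact isPreconnected_empty
  · exact h.isConnected_fill.isPreconnected

/-- A subcell whose new boundary avoids the holes is again good. -/
lemma IsHoles.good_of_disjoint {K : ℕ → Set ℂ} (hK : IsHoles K) {J C : Set ℂ} (hJ : IsGood K J)
    (hC : IsClosed C) (hCJ : inside C ⊆ inside J) (n : ℕ)
    (h : fill (K n) ⊆ inside J → Disjoint (fill (K n)) C) :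
    fill (K n) ⊆ inside C ∨ Disjoint (fill (K n)) (inside C) := by
  rcases hJ n with h1 | h1
  · exact (hK.isPreconnected_fill n).subset_inside_or_disjoint hC (h h1)
  · exact Or.inr (h1.mono_right hCJ)

lemma isSplit_crosscut {K : ℕ → Set ℂ} (hK : IsHoles K) {A₁ A₂ β : Set ℂ} {a b : ℂ}
    (hA₁ : IsArc A₁ a b) (hA₂ : IsArc A₂ a b) (hA : A₁ ∩ A₂ = {a, b})
    (hgood : IsGood K (A₁ ∪ A₂)) (hβ : IsArc β a b) (hβJ : β \ {a, b} ⊆ inside (A₁ ∪ A₂))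
    (hβK : ∀ n, Disjoint (β \ {a, b}) (fill (K n))) : IsSplit K A₁ A₂ β β := by
  have t1 := theta_half hA₁ hA₂ hA hβ hβJ
  have t2 := theta_half hA₂ hA₁ (by rwa [inter_comm]) hβ (by rwa [union_comm A₂])
  have tc := theta_cover hA₁ hA₂ hA hβ hβJ
  rw [union_comm A₂ A₁] at t2
  have key : ∀ n, fill (K n) ⊆ inside (A₁ ∪ A₂) → ∀ z ∈ fill (K n), z ∉ A₁ ∪ A₂ ∪ β := by
    intro n hn z hz hz'
    have h0 : z ∉ A₁ ∪ A₂ := fun h => disjoint_left.mp (disjoint_inside_self _) (hn hz) h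
    refine disjoint_left.mp (hβK n) ⟨hz'.resolve_left h0, ?_⟩ hz
    rintro (rfl | rfl)
    exacts [h0 (Or.inl hA₁.left_mem), h0 (Or.inl hA₁.right_mem)]
  refine ⟨t1.2.2.1.trans sdiff_subset, t2.2.2.1.trans sdiff_subset,
    theta_disjoint hA₁ hA₂ hA hβ hβJ, fun n => ?_, fun n => ?_, ?_⟩
  · refine hK.good_of_disjoint hgood t1.1.isCompact.isClosed (t1.2.2.1.trans sdiff_subset) n ?_
    exact fun h => disjoint_left.mpr fun z hz hz' => key n h z hz (hz'.imp Or.inl id)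
  · refine hK.good_of_disjoint hgood t2.1.isCompact.isClosed (t2.2.2.1.trans sdiff_subset) n ?_
    exact fun h => disjoint_left.mpr fun z hz hz' => key n h z hz (hz'.imp Or.inr id)
  · rintro z ⟨(hz | hz) | hz, -⟩
    · exact Or.inl (Or.inl (Or.inl hz))
    · exact Or.inr (Or.inl (Or.inl hz))
    · by_cases h : z ∈ β
      · exact Or.inl (Or.inl (Or.inr h))
      · exact (tc.subset ⟨hz, h⟩).imp Or.inr Or.inr

/-- A hole inside a cell can be joined to the boundary of the cell by two arcs which avoid the other
holes, so that the cell without the hole is split into two cells. -/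
lemma exists_isSplit_hole {K : ℕ → Set ℂ} (hK : IsHoles K) {A₁ A₂ : Set ℂ} {a b : ℂ}
    (hA₁ : IsArc A₁ a b) (hA₂ : IsArc A₂ a b) (hA : A₁ ∩ A₂ = {a, b})
    (hgood : IsGood K (A₁ ∪ A₂)) {m : ℕ} (hm : (K m).Nonempty)
    (hmJ : fill (K m) ⊆ inside (A₁ ∪ A₂)) :
    ∃ c d α β K₁ K₂, IsArc α a c ∧ IsArc β b d ∧ IsArc K₁ c d ∧ IsArc K₂ c d ∧ K₁ ∩ K₂ = {c, d} ∧
      Disjoint α β ∧ α ∩ (K₁ ∪ K₂) ⊆ {c} ∧ β ∩ (K₁ ∪ K₂) ⊆ {d} ∧ (α ∪ β) ∩ (A₁ ∪ A₂) ⊆ {a, b} ∧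
      Disjoint (K₁ ∪ K₂) (A₁ ∪ A₂) ∧ K₁ ∪ K₂ = K m ∧
      IsSplit K A₁ A₂ (α ∪ K₁ ∪ β) (α ∪ K₂ ∪ β) := by
  have hJ : IsJordanCurve (A₁ ∪ A₂) := hA₁.union_isJordanCurve hA₂ hA.subset
  have hJo := isOpen_inside hJ.isCompact.isClosed
  set J := A₁ ∪ A₂ with hJdef
  have hKm : IsJordanCurve (K m) := (hK.curve m).resolve_left hm.ne_empty
  have hM : IsCompact (fill (K m)) := hK.null.isCompact m
  have haJ : a ∈ J := Or.inl hA₁.left_mem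
  have hbJ : b ∈ J := Or.inl hA₁.right_mem
  have nJ : ∀ z ∈ J, z ∉ inside J := fun z h h' =>
    disjoint_left.mp (disjoint_inside_self _) h' h
  have hJM : J ∩ fill (K m) = ∅ := eq_empty_of_forall_notMem fun z hz => nJ z hz.1 (hmJ hz.2)
  have hout : outside (K m) = (fill (K m))ᶜ := by rw [fill_eq_compl_outside, compl_compl]
  obtain ⟨c, hc⟩ := hm
  obtain ⟨d, hd, hcd⟩ := exists_ne_mem_jordan hKm (p := c)
  have cM : c ∈ fill (K m) := Or.inl hc
  have dM : d ∈ fill (K m) := Or.inl hd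
  have acc : ∀ z ∈ J, ∀ M : Set ℂ, IsCompact M → z ∉ M → Accessible (inside J \ M) z :=
    fun z hz M hM h => (hJ.accessible_inside hz).inter (hM.isClosed.isOpen_compl.mem_nhds h)
  have acc' : ∀ z ∈ K m, ∀ N : Set ℂ, IsCompact N → z ∉ N →
      Accessible (inside J \ (fill (K m) ∪ N)) z := fun z hz N hN h => by
    refine ((hKm.accessible_outside hz).inter (N := inside J ∩ Nᶜ) (inter_mem
      (hJo.mem_nhds (hmJ (Or.inl hz))) (hN.isClosed.isOpen_compl.mem_nhds h))).mono ?_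
    rintro w ⟨h1, h2, h3⟩
    rw [hout] at h1
    exact ⟨h2, fun h => h.elim h1 h3⟩
  have hDU : ∀ n, fill (K n) ⊆ inside J \ fill (K m) ∨
      Disjoint (fill (K n)) (inside J \ fill (K m)) := by
    intro n
    by_cases hn : n = m
    · rw [hn]; exact Or.inr disjoint_sdiff_right
    · rcases hgood n with h | h
      · exact Or.inl fun z hz => ⟨h hz, fun h' => disjoint_left.mp (hK.null.disjoint hn) hz h'⟩
      · exact Or.inr (h.mono_right sdiff_subset)
  have haM : a ∉ fill (K m) := fun h => nJ a haJ (hmJ h)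
  have hbM : b ∉ fill (K m) := fun h => nJ b hbJ (hmJ h)
  have Acca := acc a haJ _ hM haM
  have hUc : IsPathConnected (inside J \ fill (K m)) :=
    hJ.isPathConnected_inside_diff hM (by rw [hJM]; exact isPreconnected_empty)
      (hK.null.joinedIn m) Acca.nonempty
  obtain ⟨α, hα, hαU, hαK⟩ := exists_arc_avoiding (hJo.sdiff hM.isClosed) hUc hK.null hDU Acca
    (by simpa using acc' c hc ∅ isCompact_empty (notMem_empty c)) (fun h => nJ a haJ h.1)
    (fun h => h.2 cM) (fun h => haM (h ▸ cM))
  have hαJ : α ∩ J ⊆ {a} := by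
    rintro z ⟨hz, hzJ⟩
    by_contra h
    by_cases hzc : z = c
    · exact nJ z hzJ (hmJ (hzc ▸ cM))
    · exact nJ z hzJ (hαU ⟨hz, by rintro (h' | h') <;> [exact h h'; exact hzc h']⟩).1
  have hαM : α ∩ fill (K m) ⊆ {c} := by
    rintro z ⟨hz, hzM⟩
    by_contra h
    by_cases hza : z = a
    · exact haM (hza ▸ hzM)
    · exact (hαU ⟨hz, by rintro (h' | h') <;> [exact hza h'; exact h h']⟩).2 hzM
  have hbα : b ∉ α := fun h => hA₁.ne.symm (hαJ ⟨h, hbJ⟩)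
  have hdα : d ∉ α := fun h => hcd.symm (hαM ⟨h, dM⟩)
  have hMα : IsCompact (fill (K m) ∪ α) := hM.union hα.isCompact
  have Accb := acc b hbJ _ hMα (fun h => h.elim hbM hbα)
  have hVc : IsPathConnected (inside J \ (fill (K m) ∪ α)) := by
    refine hJ.isPathConnected_inside_diff hMα ?_ (fun x y hx hy => ?_) Accb.nonempty
    · have : J ∩ (fill (K m) ∪ α) = {a} := by
        rw [inter_union_distrib_left, hJM, empty_union, inter_comm]
        exact hαJ.antisymm (singleton_subset_iff.mpr ⟨hα.left_mem, haJ⟩)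
      rw [this]; exact isPreconnected_singleton
    · refine joinedIn_compl_union hM hα.isCompact ?_
        (hK.null.joinedIn m x y (fun h => hx (Or.inl h)) (fun h => hy (Or.inl h)))
        (hα.joinedIn_compl (fun h => hx (Or.inr h)) (fun h => hy (Or.inr h)))
      have : fill (K m) ∩ α = {c} := by
        rw [inter_comm]
        exact hαM.antisymm (singleton_subset_iff.mpr ⟨hα.right_mem, cM⟩)
      rw [this]; exact isPreconnected_singleton
  have hDV : ∀ n, fill (K n) ⊆ inside J \ (fill (K m) ∪ α) ∨
      Disjoint (fill (K n)) (inside J \ (fill (K m) ∪ α)) := by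
    intro n
    rcases hDU n with h | h
    · refine Or.inl fun z hz => ⟨(h hz).1, fun h' => h'.elim (h hz).2 fun hzα => ?_⟩
      refine disjoint_left.mp (hαK n) ⟨hzα, ?_⟩ hz
      rintro (rfl | rfl)
      exacts [nJ _ haJ (h hz).1, (h hz).2 cM]
    · exact Or.inr (h.mono_right (sdiff_subset_sdiff_right subset_union_left))
  obtain ⟨β, hβ, hβU, hβK⟩ := exists_arc_avoiding (hJo.sdiff hMα.isClosed) hVc hK.null hDV Accb
    (acc' d hd α hα.isCompact hdα) (fun h => nJ b hbJ h.1)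
    (fun h => h.2 (Or.inl dM)) (fun h => hbM (h ▸ dM))
  have hβJ : β ∩ J ⊆ {b} := by
    rintro z ⟨hz, hzJ⟩
    by_contra h
    by_cases hzc : z = d
    · exact nJ z hzJ (hmJ (hzc ▸ dM))
    · exact nJ z hzJ (hβU ⟨hz, by rintro (h' | h') <;> [exact h h'; exact hzc h']⟩).1
  have hβM : β ∩ fill (K m) ⊆ {d} := by
    rintro z ⟨hz, hzM⟩
    by_contra h
    by_cases hza : z = b
    · exact hbM (hza ▸ hzM)
    · exact (hβU ⟨hz, by rintro (h' | h') <;> [exact hza h'; exact h h']⟩).2 (Or.inl hzM)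
  have hαβ : Disjoint α β := by
    rw [Set.disjoint_left]
    intro z hzα hzβ
    by_cases h : z ∈ ({b, d} : Set ℂ)
    · rcases h with rfl | rfl
      exacts [hbα hzα, hdα hzα]
    · exact (hβU ⟨hzβ, h⟩).2 (Or.inr hzα)
  have hαi : α \ {a} ⊆ inside J := by
    rintro z ⟨hz, hza⟩
    by_cases hzc : z = c
    · exact hmJ (hzc ▸ cM)
    · exact (hαU ⟨hz, by rintro (h' | h') <;> [exact hza h'; exact hzc h']⟩).1
  have hβi : β \ {b} ⊆ inside J := by
    rintro z ⟨hz, hza⟩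
    by_cases hzc : z = d
    · exact hmJ (hzc ▸ dM)
    · exact (hβU ⟨hz, by rintro (h' | h') <;> [exact hza h'; exact hzc h']⟩).1
  obtain ⟨K₁, K₂, hK₁, hK₂, hK12, hKm'⟩ := hKm.split hc hd hcd
  have hKsub : K₁ ∪ K₂ ⊆ fill (K m) := by rw [← hKm']; exact subset_fill _
  have hKi : K₁ ∪ K₂ ⊆ inside J := hKsub.trans hmJ
  -- the main case distinction
  have main : ∀ L₁ L₂ : Set ℂ, IsArc L₁ c d → IsArc L₂ c d → L₁ ∩ L₂ = {c, d} → L₁ ∪ L₂ = K m →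
      inside (A₁ ∪ (α ∪ L₁ ∪ β)) ⊆ inside J ∧ inside (A₂ ∪ (α ∪ L₂ ∪ β)) ⊆ inside J ∧
      Disjoint (inside (A₁ ∪ (α ∪ L₁ ∪ β))) (inside (A₂ ∪ (α ∪ L₂ ∪ β))) ∧
      Disjoint (fill (L₁ ∪ L₂)) (inside (A₁ ∪ (α ∪ L₁ ∪ β))) ∧
      Disjoint (fill (L₁ ∪ L₂)) (inside (A₂ ∪ (α ∪ L₂ ∪ β))) ∧
      fill J \ inside (L₁ ∪ L₂) ⊆
        fill (A₁ ∪ (α ∪ L₁ ∪ β)) ∪ fill (A₂ ∪ (α ∪ L₂ ∪ β)) →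
      ∃ c d α β K₁ K₂, IsArc α a c ∧ IsArc β b d ∧ IsArc K₁ c d ∧ IsArc K₂ c d ∧ K₁ ∩ K₂ = {c, d} ∧
      Disjoint α β ∧ α ∩ (K₁ ∪ K₂) ⊆ {c} ∧ β ∩ (K₁ ∪ K₂) ⊆ {d} ∧ (α ∪ β) ∩ J ⊆ {a, b} ∧
      Disjoint (K₁ ∪ K₂) J ∧ K₁ ∪ K₂ = K m ∧
      IsSplit K A₁ A₂ (α ∪ K₁ ∪ β) (α ∪ K₂ ∪ β) := by
    rintro L₁ L₂ hL₁ hL₂ hL hLK ⟨h1, h2, h3, h4, h5, h6⟩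
    have hLM : L₁ ∪ L₂ ⊆ fill (K m) := by rw [hLK]; exact subset_fill _
    have key : ∀ n ≠ m, fill (K n) ⊆ inside J → Disjoint (fill (K n)) (J ∪ α ∪ β ∪ fill (K m)) := by
      intro n hnm hn
      have hnJ : ∀ z ∈ fill (K n), z ∉ J := fun z hz hzJ => nJ z hzJ (hn hz)
      have hnm' : ∀ z ∈ fill (K n), z ∉ fill (K m) := fun z hz h =>
        disjoint_left.mp (hK.null.disjoint hnm) hz h
      rw [Set.disjoint_left]
      rintro z hz (((hz' | hz') | hz') | hz')
      · exact hnJ z hz hz'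
      · refine disjoint_left.mp (hαK n) ⟨hz', ?_⟩ hz
        rintro (rfl | rfl)
        exacts [hnJ _ hz haJ, hnm' _ hz cM]
      · refine disjoint_left.mp (hβK n) ⟨hz', ?_⟩ hz
        rintro (rfl | rfl)
        exacts [hnJ _ hz hbJ, hnm' _ hz dM]
      · exact hnm' z hz hz'
    refine ⟨c, d, α, β, L₁, L₂, hα, hβ, hL₁, hL₂, hL, hαβ, fun z hz => hαM ⟨hz.1, hLM hz.2⟩,
      fun z hz => hβM ⟨hz.1, hLM hz.2⟩, ?_, ?_, hLK, h1, h2, h3, ?_, ?_, ?_⟩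
    · rintro z ⟨hz | hz, hzJ⟩
      exacts [Or.inl (hαJ ⟨hz, hzJ⟩), Or.inr (hβJ ⟨hz, hzJ⟩)]
    · exact disjoint_left.mpr fun z hz hzJ => nJ z hzJ (hmJ (hLM hz))
    · intro n
      by_cases hn : n = m
      · rw [hn, ← hLK]; exact Or.inr h4
      · refine hK.good_of_disjoint hgood (hA₁.isCompact.union ((hα.isCompact.union
          hL₁.isCompact).union hβ.isCompact)).isClosed h1 n fun h => (key n hn h).mono_right ?_
        rintro z (hz | ((hz | hz) | hz))
        exacts [Or.inl (Or.inl (Or.inl (Or.inl hz))), Or.inl (Or.inl (Or.inr hz)),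
          Or.inr (hLM (Or.inl hz)), Or.inl (Or.inr hz)]
    · intro n
      by_cases hn : n = m
      · rw [hn, ← hLK]; exact Or.inr h5
      · refine hK.good_of_disjoint hgood (hA₂.isCompact.union ((hα.isCompact.union
          hL₂.isCompact).union hβ.isCompact)).isClosed h2 n fun h => (key n hn h).mono_right ?_
        rintro z (hz | ((hz | hz) | hz))
        exacts [Or.inl (Or.inl (Or.inl (Or.inr hz))), Or.inl (Or.inl (Or.inr hz)),
          Or.inr (hLM (Or.inr hz)), Or.inl (Or.inr hz)]
    · refine (sdiff_subset_sdiff_right ?_).trans h6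
      rw [hLK]
      exact subset_iUnion (fun n => inside (K n)) m
  have hαK' : α ∩ (K₁ ∪ K₂) ⊆ {c} := fun z hz => hαM ⟨hz.1, hKsub hz.2⟩
  have hβK' : β ∩ (K₁ ∪ K₂) ⊆ {d} := fun z hz => hβM ⟨hz.1, hKsub hz.2⟩
  have hχ : IsArc (α ∪ K₁ ∪ β) a b := by
    refine (hα.trans hK₁ fun z hz => hαK' ⟨hz.1, Or.inl hz.2⟩).trans hβ.symm ?_
    rintro z ⟨hz | hz, hz'⟩
    · exact (disjoint_left.mp hαβ hz hz').elim
    · exact hβK' ⟨hz', Or.inl hz⟩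
  have hχJ : (α ∪ K₁ ∪ β) \ {a, b} ⊆ inside J := by
    rintro z ⟨(hz | hz) | hz, hz'⟩
    · exact hαi ⟨hz, fun h => hz' (Or.inl h)⟩
    · exact hKi (Or.inl hz)
    · exact hβi ⟨hz, fun h => hz' (Or.inr h)⟩
  have hK₂χ : K₂ \ {c, d} ⊆ inside J \ (α ∪ K₁ ∪ β) := by
    rintro z ⟨hz, hz'⟩
    refine ⟨hKi (Or.inr hz), ?_⟩
    rintro ((h | h) | h)
    · exact hz' (Or.inl (hαK' ⟨h, Or.inr hz⟩))
    · exact hz' (hK12.subset ⟨h, hz⟩)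
    · exact hz' (Or.inr (hβK' ⟨h, Or.inr hz⟩))
  rw [theta_cover hA₁ hA₂ hA hχ hχJ] at hK₂χ
  have ho1 := (theta_half hA₁ hA₂ hA hχ hχJ).1.isCompact.isClosed
  have ho2 := (theta_half hA₂ hA₁ (by rwa [inter_comm]) hχ (by rwa [union_comm A₂])).1.isCompact.isClosed
  rcases hK₂.diff_ends.1.isPreconnected.subset_or_subset (isOpen_inside ho1) (isOpen_inside ho2)
    (theta_disjoint hA₁ hA₂ hA hχ hχJ) hK₂χ with h | h
  · have := annulus_split hA₂ hA₁ (by rwa [inter_comm]) hK₁ hK₂ hK12 hα hβ hαβ hαK' hβK'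
      (by rwa [union_comm A₂]) (by rwa [union_comm A₂]) (by rwa [union_comm A₂]) h
    obtain ⟨h1, h2, h3, h4, h5, h6⟩ := this
    rw [union_comm A₂ A₁] at h1 h2 h6
    refine main K₂ K₁ hK₂ hK₁ (by rwa [inter_comm]) (by rw [union_comm, hKm']) ⟨h2, h1, h3.symm, ?_⟩
    rw [union_comm K₂ K₁]
    exact ⟨h5, h4, h6.trans (union_comm _ _).subset⟩
  · exact main K₁ K₂ hK₁ hK₂ hK12 hKm'.symm (annulus_split hA₁ hA₂ hA hK₁ hK₂ hK12 hα hβ hαβ hαK' hβK'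
      hαi hβi hKi h)

lemma IsJordanCurve.fill_subset_fill {J C : Set ℂ} (hJ : IsJordanCurve J) (hC : IsJordanCurve C)
    (h : inside C ⊆ inside J) : fill C ⊆ fill J := by
  rw [← hJ.closure_inside, ← hC.closure_inside]
  exact closure_mono h

/-- Cells with disjoint insides meet along their boundaries only. -/
lemma IsJordanCurve.mem_of_mem_fill {J C : Set ℂ} (hJ : IsJordanCurve J) (hC : IsJordanCurve C)
    (h : Disjoint (inside J) (inside C)) {z : ℂ} (hz : z ∈ fill J) (hz' : z ∈ fill C) : z ∈ J := by
  refine hz.resolve_right fun hi => ?_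
  rw [← hC.closure_inside] at hz'
  obtain ⟨w, hw, hw'⟩ := mem_closure_iff.mp hz' _ (isOpen_inside hJ.isCompact.isClosed) hi
  exact disjoint_left.mp h hw hw'

/-- A curve in the product of two planes which projects injectively to both of them, such that each
projection is compatible with the corresponding family of holes. -/
structure IsCell (π π' : ℂ × ℂ → ℂ) (K K' : ℕ → Set ℂ) (Γ : Set (ℂ × ℂ)) : Prop where
  jordan : IsJordanCurve Γ
  inj : InjOn π Γ
  inj' : InjOn π' Γ
  good : IsGood K (π '' Γ)
  good' : IsGood K' (π' '' Γ)
  dense : (∃ n, (K' n).Nonempty) → inside (π '' Γ) ⊆ closure (⋃ n, fill (K n))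
  dense' : (∃ n, (K n).Nonempty) → inside (π' '' Γ) ⊆ closure (⋃ n, fill (K' n))

lemma IsCell.symm {π π' : ℂ × ℂ → ℂ} {K K' : ℕ → Set ℂ} {Γ : Set (ℂ × ℂ)}
    (h : IsCell π π' K K' Γ) : IsCell π' π K' K Γ :=
  ⟨h.jordan, h.inj', h.inj, h.good', h.good, h.dense', h.dense⟩

/-- One projection of a subdivision of a cell. -/
structure IsSideSubdiv (π : ℂ × ℂ → ℂ) (K : ℕ → Set ℂ) (Γ : Set (ℂ × ℂ))
    (S : Set (Set (ℂ × ℂ))) : Prop where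
  inj : InjOn π (⋃₀ S)
  good : ∀ Δ ∈ S, IsGood K (π '' Δ)
  sub : ∀ Δ ∈ S, inside (π '' Δ) ⊆ inside (π '' Γ)
  disj : ∀ Δ ∈ S, ∀ Δ' ∈ S, Δ ≠ Δ' → Disjoint (inside (π '' Δ)) (inside (π '' Δ'))
  cover : ∀ z ∈ fill (π '' Γ), z ∉ ⋃ n, inside (K n) → ∃ Δ ∈ S, z ∈ fill (π '' Δ)

/-- A finite subdivision of a cell into cells which covers everything but the holes. -/
structure IsSubdiv (π π' : ℂ × ℂ → ℂ) (K K' : ℕ → Set ℂ) (Γ : Set (ℂ × ℂ))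
    (S : Set (Set (ℂ × ℂ))) : Prop where
  finite : S.Finite
  jordan : ∀ Δ ∈ S, IsJordanCurve Δ
  bdry : Γ ⊆ ⋃₀ S
  side : IsSideSubdiv π K Γ S
  side' : IsSideSubdiv π' K' Γ S

section Subdiv

variable {π π' : ℂ × ℂ → ℂ} {K K' : ℕ → Set ℂ} {Γ : Set (ℂ × ℂ)} {S : Set (Set (ℂ × ℂ))}

lemma IsSubdiv.symm (h : IsSubdiv π π' K K' Γ S) : IsSubdiv π' π K' K Γ S :=
  ⟨h.finite, h.jordan, h.bdry, h.side', h.side⟩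

lemma IsSubdiv.isCell (h : IsSubdiv π π' K K' Γ S) (hΓ : IsCell π π' K K' Γ) {Δ : Set (ℂ × ℂ)}
    (hΔ : Δ ∈ S) : IsCell π π' K K' Δ :=
  ⟨h.jordan Δ hΔ, h.side.inj.mono (subset_sUnion_of_mem hΔ),
    h.side'.inj.mono (subset_sUnion_of_mem hΔ), h.side.good Δ hΔ, h.side'.good Δ hΔ,
    fun hn => (h.side.sub Δ hΔ).trans (hΓ.dense hn),
    fun hn => (h.side'.sub Δ hΔ).trans (hΓ.dense' hn)⟩

lemma IsSideSubdiv.refl (hi : InjOn π Γ) (hg : IsGood K (π '' Γ)) : IsSideSubdiv π K Γ {Γ} := by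
  refine ⟨by simpa using hi, ?_, ?_, ?_, ?_⟩
  · rintro _ rfl; exact hg
  · rintro _ rfl; exact Subset.rfl
  · rintro _ rfl _ rfl h; exact (h rfl).elim
  · exact fun z hz _ => ⟨Γ, rfl, hz⟩

lemma IsSubdiv.refl (hΓ : IsCell π π' K K' Γ) : IsSubdiv π π' K K' Γ {Γ} :=
  ⟨finite_singleton _, by rintro _ rfl; exact hΓ.jordan, by simp,
    IsSideSubdiv.refl hΓ.inj hΓ.good, IsSideSubdiv.refl hΓ.inj' hΓ.good'⟩

lemma IsSideSubdiv.jordan (h : IsSideSubdiv π K Γ S) (hπ : Continuous π)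
    (hS : ∀ Δ ∈ S, IsJordanCurve Δ) {Δ : Set (ℂ × ℂ)} (hΔ : Δ ∈ S) : IsJordanCurve (π '' Δ) :=
  (hS Δ hΔ).image hπ.continuousOn (h.inj.mono (subset_sUnion_of_mem hΔ))

lemma IsSideSubdiv.bind (h : IsSideSubdiv π K Γ S) (hπ : Continuous π)
    (hS : ∀ Δ ∈ S, IsJordanCurve Δ) {T : Set (ℂ × ℂ) → Set (Set (ℂ × ℂ))}
    (hT : ∀ Δ ∈ S, IsSideSubdiv π K Δ (T Δ)) (hTJ : ∀ Δ ∈ S, ∀ Δ' ∈ T Δ, IsJordanCurve Δ')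
    (hTb : ∀ Δ ∈ S, Δ ⊆ ⋃₀ T Δ) :
    IsSideSubdiv π K Γ (⋃ Δ ∈ S, T Δ) := by
  have key : ∀ Δ₁ ∈ S, ∀ Δ₂ ∈ S, Δ₁ ≠ Δ₂ → ∀ C₁ ∈ T Δ₁, ∀ C₂ ∈ T Δ₂, ∀ P ∈ C₁, ∀ Q ∈ C₂,
      π P = π Q → P ∈ Δ₁ := by
    intro Δ₁ h₁ Δ₂ h₂ hne C₁ hC₁ C₂ hC₂ P hP Q hQ hPQ
    have J₁ := h.jordan hπ hS h₁
    have J₂ := h.jordan hπ hS h₂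
    have f₁ : π P ∈ fill (π '' Δ₁) := J₁.fill_subset_fill ((hT Δ₁ h₁).jordan hπ (hTJ Δ₁ h₁) hC₁)
      ((hT Δ₁ h₁).sub C₁ hC₁) (Or.inl (mem_image_of_mem π hP))
    have f₂ : π P ∈ fill (π '' Δ₂) := J₂.fill_subset_fill ((hT Δ₂ h₂).jordan hπ (hTJ Δ₂ h₂) hC₂)
      ((hT Δ₂ h₂).sub C₂ hC₂) (Or.inl (hPQ ▸ mem_image_of_mem π hQ))
    obtain ⟨P', hP', hPP'⟩ := J₁.mem_of_mem_fill J₂ (h.disj Δ₁ h₁ Δ₂ h₂ hne) f₁ f₂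
    rwa [← (hT Δ₁ h₁).inj (hTb Δ₁ h₁ hP') ⟨C₁, hC₁, hP⟩ hPP']
  refine ⟨?_, ?_, ?_, ?_, ?_⟩
  · rintro P ⟨C₁, hC₁, hP⟩ Q ⟨C₂, hC₂, hQ⟩ hPQ
    simp only [mem_iUnion] at hC₁ hC₂
    obtain ⟨Δ₁, h₁, hC₁⟩ := hC₁
    obtain ⟨Δ₂, h₂, hC₂⟩ := hC₂
    by_cases hne : Δ₁ = Δ₂
    · subst hne
      exact (hT Δ₁ h₁).inj ⟨C₁, hC₁, hP⟩ ⟨C₂, hC₂, hQ⟩ hPQ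
    · exact h.inj ⟨Δ₁, h₁, key Δ₁ h₁ Δ₂ h₂ hne C₁ hC₁ C₂ hC₂ P hP Q hQ hPQ⟩
        ⟨Δ₂, h₂, key Δ₂ h₂ Δ₁ h₁ (Ne.symm hne) C₂ hC₂ C₁ hC₁ Q hQ P hP hPQ.symm⟩ hPQ
  · intro C hC
    simp only [mem_iUnion] at hC
    obtain ⟨Δ, hΔ, hC⟩ := hC
    exact (hT Δ hΔ).good C hC
  · intro C hC
    simp only [mem_iUnion] at hC
    obtain ⟨Δ, hΔ, hC⟩ := hC
    exact ((hT Δ hΔ).sub C hC).trans (h.sub Δ hΔ)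
  · intro C₁ hC₁ C₂ hC₂ hne
    simp only [mem_iUnion] at hC₁ hC₂
    obtain ⟨Δ₁, h₁, hC₁⟩ := hC₁
    obtain ⟨Δ₂, h₂, hC₂⟩ := hC₂
    by_cases hΔ : Δ₁ = Δ₂
    · subst hΔ
      exact (hT Δ₁ h₁).disj C₁ hC₁ C₂ hC₂ hne
    · exact (h.disj Δ₁ h₁ Δ₂ h₂ hΔ).mono ((hT Δ₁ h₁).sub C₁ hC₁) ((hT Δ₂ h₂).sub C₂ hC₂)
  · intro z hz hzK
    obtain ⟨Δ, hΔ, hz⟩ := h.cover z hz hzK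
    obtain ⟨C, hC, hz⟩ := (hT Δ hΔ).cover z hz hzK
    exact ⟨C, mem_biUnion hΔ hC, hz⟩

/-- Subdividing the cells of a subdivision. -/
lemma IsSubdiv.bind (h : IsSubdiv π π' K K' Γ S) (hπ : Continuous π) (hπ' : Continuous π')
    {Q : Set (ℂ × ℂ) → Prop}
    (hT : ∀ Δ ∈ S, ∃ T, IsSubdiv π π' K K' Δ T ∧ ∀ C ∈ T, Q C) :
    ∃ T, IsSubdiv π π' K K' Γ T ∧ ∀ C ∈ T, Q C ∧ ∃ Δ ∈ S,
      inside (π '' C) ⊆ inside (π '' Δ) ∧ inside (π' '' C) ⊆ inside (π' '' Δ) ∧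
      fill (π '' C) ⊆ fill (π '' Δ) ∧ fill (π' '' C) ⊆ fill (π' '' Δ) := by
  choose! T hT hQ using hT
  refine ⟨⋃ Δ ∈ S, T Δ, ⟨?_, ?_, ?_, ?_, ?_⟩, ?_⟩
  · exact h.finite.biUnion fun Δ hΔ => (hT Δ hΔ).finite
  · intro C hC
    simp only [mem_iUnion] at hC
    obtain ⟨Δ, hΔ, hC⟩ := hC
    exact (hT Δ hΔ).jordan C hC
  · intro P hP
    obtain ⟨Δ, hΔ, hP⟩ := h.bdry hP
    obtain ⟨C, hC, hP⟩ := (hT Δ hΔ).bdry hP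
    exact ⟨C, mem_biUnion hΔ hC, hP⟩
  · exact h.side.bind hπ h.jordan (fun Δ hΔ => (hT Δ hΔ).side) (fun Δ hΔ => (hT Δ hΔ).jordan)
      (fun Δ hΔ => (hT Δ hΔ).bdry)
  · exact h.side'.bind hπ' h.jordan (fun Δ hΔ => (hT Δ hΔ).side') (fun Δ hΔ => (hT Δ hΔ).jordan)
      (fun Δ hΔ => (hT Δ hΔ).bdry)
  · intro C hC
    simp only [mem_iUnion] at hC
    obtain ⟨Δ, hΔ, hC⟩ := hC
    have hs := (hT Δ hΔ).side.sub C hC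
    have hs' := (hT Δ hΔ).side'.sub C hC
    exact ⟨hQ Δ hΔ C hC, Δ, hΔ, hs, hs', (h.side.jordan hπ h.jordan hΔ).fill_subset_fill
      ((hT Δ hΔ).side.jordan hπ (hT Δ hΔ).jordan hC) hs,
      (h.side'.jordan hπ' h.jordan hΔ).fill_subset_fill
      ((hT Δ hΔ).side'.jordan hπ' (hT Δ hΔ).jordan hC) hs'⟩

lemma IsSplit.isSideSubdiv {A₁ A₂ B₁ B₂ : Set (ℂ × ℂ)}
    (h : IsSplit K (π '' A₁) (π '' A₂) (π '' B₁) (π '' B₂))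
    (hi : InjOn π (A₁ ∪ A₂ ∪ (B₁ ∪ B₂))) :
    IsSideSubdiv π K (A₁ ∪ A₂) {A₁ ∪ B₁, A₂ ∪ B₂} := by
  refine ⟨?_, ?_, ?_, ?_, ?_⟩
  · refine hi.mono ?_
    rw [sUnion_pair]
    intro z; simp only [mem_union]; tauto
  · rintro _ (rfl | rfl)
    · rw [image_union]; exact h.good₁
    · rw [image_union]; exact h.good₂
  · rintro _ (rfl | rfl)
    · rw [image_union, image_union]; exact h.sub₁
    · rw [image_union, image_union]; exact h.sub₂
  · rintro _ (rfl | rfl) _ (rfl | rfl) hne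
    · exact (hne rfl).elim
    · rw [image_union, image_union]; exact h.disj
    · rw [image_union, image_union]; exact h.disj.symm
    · exact (hne rfl).elim
  · intro z hz hzK
    rw [image_union] at hz
    rcases h.cover ⟨hz, hzK⟩ with h | h
    · exact ⟨_, Or.inl rfl, by rwa [image_union]⟩
    · exact ⟨_, Or.inr rfl, by rwa [image_union]⟩

/-- The two orderings of the coordinate projections of `ℂ × ℂ`. -/
def IsProjPair (π π' : ℂ × ℂ → ℂ) : Prop :=
  (π = Prod.fst ∧ π' = Prod.snd) ∨ (π = Prod.snd ∧ π' = Prod.fst)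

lemma IsProjPair.symm (h : IsProjPair π π') : IsProjPair π' π := by
  rcases h with ⟨rfl, rfl⟩ | ⟨rfl, rfl⟩
  exacts [Or.inr ⟨rfl, rfl⟩, Or.inl ⟨rfl, rfl⟩]

lemma IsProjPair.continuous (h : IsProjPair π π') : Continuous π := by
  rcases h with ⟨rfl, rfl⟩ | ⟨rfl, rfl⟩
  exacts [continuous_fst, continuous_snd]

lemma IsProjPair.exists_isArc (h : IsProjPair π π') {β β' : Set ℂ} {P Q : ℂ × ℂ}
    (hβ : IsArc β (π P) (π Q)) (hβ' : IsArc β' (π' P) (π' Q)) :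
    ∃ B, IsArc B P Q ∧ π '' B = β ∧ π' '' B = β' ∧ InjOn π B ∧ InjOn π' B := by
  obtain ⟨γ, γc, γi, γ0, γ1, rfl⟩ := hβ
  obtain ⟨δ, δc, δi, δ0, δ1, rfl⟩ := hβ'
  rcases h with ⟨rfl, rfl⟩ | ⟨rfl, rfl⟩
  · refine ⟨(fun t => (γ t, δ t)) '' Icc 0 1, ⟨fun t => (γ t, δ t), γc.prodMk δc, ?_,
      Prod.ext γ0 δ0, Prod.ext γ1 δ1, rfl⟩, ?_, ?_, ?_, ?_⟩
    · exact fun s hs t ht hst => γi hs ht (congrArg Prod.fst hst)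
    · rw [image_image]
    · rw [image_image]
    · rintro _ ⟨s, hs, rfl⟩ _ ⟨t, ht, rfl⟩ hst
      rw [γi hs ht hst]
    · rintro _ ⟨s, hs, rfl⟩ _ ⟨t, ht, rfl⟩ hst
      rw [δi hs ht hst]
  · refine ⟨(fun t => (δ t, γ t)) '' Icc 0 1, ⟨fun t => (δ t, γ t), δc.prodMk γc, ?_,
      Prod.ext δ0 γ0, Prod.ext δ1 γ1, rfl⟩, ?_, ?_, ?_, ?_⟩
    · exact fun s hs t ht hst => γi hs ht (congrArg Prod.snd hst)
    · rw [image_image]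
    · rw [image_image]
    · rintro _ ⟨s, hs, rfl⟩ _ ⟨t, ht, rfl⟩ hst
      rw [γi hs ht hst]
    · rintro _ ⟨s, hs, rfl⟩ _ ⟨t, ht, rfl⟩ hst
      rw [δi hs ht hst]

end Subdiv

lemma InjOn.union_of_image {α β : Type*} {f : α → β} {s t F : Set α} (hs : InjOn f s)
    (ht : InjOn f t) (hFs : F ⊆ s) (hFt : F ⊆ t) (h : f '' s ∩ f '' t ⊆ f '' F) :
    InjOn f (s ∪ t) := by
  have key : ∀ x ∈ s, ∀ y ∈ t, f x = f y → x = y := by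
    intro x hx y hy hxy
    obtain ⟨w, hw, hwx⟩ := h ⟨mem_image_of_mem f hx, hxy ▸ mem_image_of_mem f hy⟩
    rw [← hs (hFs hw) hx hwx]
    exact ht (hFt hw) hy (hwx.trans hxy)
  rintro x (hx | hx) y (hy | hy) hxy
  exacts [hs hx hy hxy, key x hx y hy hxy, (key y hy x hx hxy.symm).symm, ht hx hy hxy]

lemma InjOn.inter_subset_of_image {α β : Type*} {f : α → β} {s t F U : Set α} (hU : InjOn f U)
    (hs : s ⊆ U) (ht : t ⊆ U) (hF : F ⊆ U) (h : f '' s ∩ f '' t ⊆ f '' F) : s ∩ t ⊆ F := by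
  rintro x ⟨hx, hx'⟩
  obtain ⟨w, hw, hwx⟩ := h ⟨mem_image_of_mem f hx, mem_image_of_mem f hx'⟩
  rwa [← hU (hF hw) (hs hx) hwx]

section Ops

variable {π π' : ℂ × ℂ → ℂ} {K K' : ℕ → Set ℂ} {A₁ A₂ : Set (ℂ × ℂ)} {P Q : ℂ × ℂ}

/-- Cutting a cell along a crosscut. -/
lemma IsCell.exists_crosscut (hp : IsProjPair π π') (hK : IsHoles K) (hK' : IsHoles K')
    (hA₁ : IsArc A₁ P Q) (hA₂ : IsArc A₂ P Q) (hA : A₁ ∩ A₂ = {P, Q})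
    (hΓ : IsCell π π' K K' (A₁ ∪ A₂)) {β : Set ℂ} (hβ : IsArc β (π P) (π Q))
    (hβJ : β \ {π P, π Q} ⊆ inside (π '' (A₁ ∪ A₂)))
    (hβK : ∀ n, Disjoint (β \ {π P, π Q}) (fill (K n))) :
    ∃ B, π '' B = β ∧ IsSubdiv π π' K K' (A₁ ∪ A₂) {A₁ ∪ B, A₂ ∪ B} := by
  have hπ := hp.continuous
  have hπ' := hp.symm.continuous
  have hJ' := hΓ.jordan.image hπ'.continuousOn hΓ.inj'
  have hP : P ∈ A₁ ∪ A₂ := Or.inl hA₁.left_mem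
  have hQ : Q ∈ A₁ ∪ A₂ := Or.inl hA₁.right_mem
  have nJ' : ∀ z ∈ π' '' (A₁ ∪ A₂), z ∉ inside (π' '' (A₁ ∪ A₂)) := fun z h h' =>
    disjoint_left.mp (disjoint_inside_self _) h' h
  obtain ⟨β', hβ', hβJ', hβK'⟩ := exists_arc_avoiding (isOpen_inside hJ'.isCompact.isClosed)
    hJ'.isPathConnected_inside hK'.null hΓ.good' (hJ'.accessible_inside (mem_image_of_mem π' hP))
    (hJ'.accessible_inside (mem_image_of_mem π' hQ)) (nJ' _ (mem_image_of_mem π' hP))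
    (nJ' _ (mem_image_of_mem π' hQ)) (fun h => hA₁.ne (hΓ.inj' hP hQ h))
  obtain ⟨B, hB, hBβ, hBβ', hBi, hBi'⟩ := hp.exists_isArc hβ hβ'
  have hPQ : {P, Q} ⊆ A₁ ∪ A₂ := by rintro z (rfl | rfl) <;> assumption
  have hPQB : {P, Q} ⊆ B := by rintro z (rfl | rfl) <;> [exact hB.left_mem; exact hB.right_mem]
  have side : ∀ {π : ℂ × ℂ → ℂ} {K : ℕ → Set ℂ}, Continuous π → IsHoles K → InjOn π (A₁ ∪ A₂) →
      IsGood K (π '' (A₁ ∪ A₂)) → InjOn π B →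
      (π '' B) \ {π P, π Q} ⊆ inside (π '' (A₁ ∪ A₂)) →
      (∀ n, Disjoint ((π '' B) \ {π P, π Q}) (fill (K n))) →
      IsSideSubdiv π K (A₁ ∪ A₂) {A₁ ∪ B, A₂ ∪ B} ∧ InjOn π (A₁ ∪ A₂ ∪ B) := by
    intro π K hπ hK hi hg hBi hBJ hBK
    have hinj : InjOn π (A₁ ∪ A₂ ∪ B) := by
      refine InjOn.union_of_image hi hBi hPQ hPQB ?_
      rintro z ⟨hz, hz'⟩
      rw [image_pair]
      by_contra h
      exact disjoint_left.mp (disjoint_inside_self _) (hBJ ⟨hz', h⟩) hz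
    refine ⟨IsSplit.isSideSubdiv ?_ (by rwa [union_self]), hinj⟩
    rw [image_union] at hg hBJ
    refine isSplit_crosscut hK (hA₁.image hπ.continuousOn (hi.mono subset_union_left))
      (hA₂.image hπ.continuousOn (hi.mono subset_union_right)) ?_ hg
      (hB.image hπ.continuousOn hBi) hBJ hBK
    rw [← hi.image_inter subset_union_left subset_union_right, hA, image_pair]
  subst hBβ hBβ'
  obtain ⟨s, hinj⟩ := side hπ hK hΓ.inj hΓ.good hBi hβJ hβK
  obtain ⟨s', -⟩ := side hπ' hK' hΓ.inj' hΓ.good' hBi' hβJ' hβK'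
  have hAB : (A₁ ∪ A₂) ∩ B ⊆ {P, Q} := by
    refine InjOn.inter_subset_of_image hinj subset_union_left subset_union_right
      (hPQ.trans subset_union_left) ?_
    rintro z ⟨hz, hz'⟩
    rw [image_pair]
    by_contra h
    exact disjoint_left.mp (disjoint_inside_self _) (hβJ ⟨hz', h⟩) hz
  refine ⟨B, rfl, by simp, ?_, ?_, s, s'⟩
  · rintro _ (rfl | rfl)
    · exact hA₁.union_isJordanCurve hB fun z hz => hAB ⟨Or.inl hz.1, hz.2⟩
    · exact hA₂.union_isJordanCurve hB fun z hz => hAB ⟨Or.inr hz.1, hz.2⟩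
  · rw [sUnion_pair]
    intro z; simp only [mem_union]; tauto

/-- Cutting a cell along arcs from its boundary to a hole. -/
lemma IsCell.exists_hole_cut (hp : IsProjPair π π') (hK : IsHoles K) (hK' : IsHoles K')
    {Γ : Set (ℂ × ℂ)} (hΓ : IsCell π π' K K' Γ) {m m' : ℕ} (hm : (K m).Nonempty)
    (hmJ : fill (K m) ⊆ inside (π '' Γ)) (hm' : (K' m').Nonempty)
    (hmJ' : fill (K' m') ⊆ inside (π' '' Γ)) :
    ∃ S, IsSubdiv π π' K K' Γ S ∧ ∀ Δ ∈ S, (π '' Δ ∩ fill (K m)).Nonempty := by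
  have hπ := hp.continuous
  have hπ' := hp.symm.continuous
  have hJ := hΓ.jordan.image hπ.continuousOn hΓ.inj
  obtain ⟨_, P, hP, rfl⟩ := hJ.isConnected.nonempty
  obtain ⟨_, ⟨Q, hQ, rfl⟩, hPQ⟩ := exists_ne_mem_jordan hJ (p := π P)
  obtain ⟨A₁, A₂, hA₁, hA₂, hA, rfl⟩ := hΓ.jordan.split hP hQ (fun h => hPQ (by rw [h]))
  have pre : ∀ {π : ℂ × ℂ → ℂ} {K : ℕ → Set ℂ} {m : ℕ}, Continuous π → IsHoles K →
      InjOn π (A₁ ∪ A₂) → IsGood K (π '' (A₁ ∪ A₂)) → (K m).Nonempty →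
      fill (K m) ⊆ inside (π '' (A₁ ∪ A₂)) →
      ∃ c d α β K₁ K₂, IsArc α (π P) c ∧ IsArc β (π Q) d ∧ IsArc K₁ c d ∧ IsArc K₂ c d ∧
      K₁ ∩ K₂ = {c, d} ∧ Disjoint α β ∧ α ∩ (K₁ ∪ K₂) ⊆ {c} ∧ β ∩ (K₁ ∪ K₂) ⊆ {d} ∧
      (α ∪ β) ∩ π '' (A₁ ∪ A₂) ⊆ {π P, π Q} ∧ Disjoint (K₁ ∪ K₂) (π '' (A₁ ∪ A₂)) ∧
      K₁ ∪ K₂ = K m ∧ IsSplit K (π '' A₁) (π '' A₂) (α ∪ K₁ ∪ β) (α ∪ K₂ ∪ β) := by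
    intro π K m hπ hK hi hg hm hmJ
    rw [image_union] at hg hmJ ⊢
    refine exists_isSplit_hole hK (hA₁.image hπ.continuousOn (hi.mono subset_union_left))
      (hA₂.image hπ.continuousOn (hi.mono subset_union_right)) ?_ hg hm hmJ
    rw [← hi.image_inter subset_union_left subset_union_right, hA, image_pair]
  obtain ⟨c, d, α, β, K₁, K₂, hα, hβ, hK₁, hK₂, hK12, hαβ, hαK, hβK, hJ1, hJ2, hKm, hsplit⟩ :=
    pre hπ hK hΓ.inj hΓ.good hm hmJ
  obtain ⟨c', d', α', β', K₁', K₂', hα', hβ', hK₁', hK₂', hK12', hαβ', hαK', hβK', hJ1', hJ2', hKm',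
    hsplit'⟩ := pre hπ' hK' hΓ.inj' hΓ.good' hm' hmJ'
  obtain ⟨R, rfl, rfl⟩ : ∃ R, π R = c ∧ π' R = c' := by
    rcases hp with ⟨rfl, rfl⟩ | ⟨rfl, rfl⟩
    exacts [⟨(c, c'), rfl, rfl⟩, ⟨(c', c), rfl, rfl⟩]
  obtain ⟨S, rfl, rfl⟩ : ∃ S, π S = d ∧ π' S = d' := by
    rcases hp with ⟨rfl, rfl⟩ | ⟨rfl, rfl⟩
    exacts [⟨(d, d'), rfl, rfl⟩, ⟨(d', d), rfl, rfl⟩]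
  obtain ⟨a, ha, rfl, rfl, ai, ai'⟩ := hp.exists_isArc hα hα'
  obtain ⟨b, hb, rfl, rfl, bi, bi'⟩ := hp.exists_isArc hβ hβ'
  obtain ⟨k₁, hk₁, rfl, rfl, k₁i, k₁i'⟩ := hp.exists_isArc hK₁ hK₁'
  obtain ⟨k₂, hk₂, rfl, rfl, k₂i, k₂i'⟩ := hp.exists_isArc hK₂ hK₂'
  have inj : ∀ {π : ℂ × ℂ → ℂ}, InjOn π (A₁ ∪ A₂) → InjOn π a → InjOn π b → InjOn π k₁ →
      InjOn π k₂ → π '' k₁ ∩ π '' k₂ = {π R, π S} → Disjoint (π '' a) (π '' b) →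
      π '' a ∩ (π '' k₁ ∪ π '' k₂) ⊆ {π R} → π '' b ∩ (π '' k₁ ∪ π '' k₂) ⊆ {π S} →
      (π '' a ∪ π '' b) ∩ π '' (A₁ ∪ A₂) ⊆ {π P, π Q} →
      Disjoint (π '' k₁ ∪ π '' k₂) (π '' (A₁ ∪ A₂)) →
      InjOn π (A₁ ∪ A₂ ∪ (a ∪ k₁ ∪ b ∪ (a ∪ k₂ ∪ b))) := by
    intro π hi ai bi k₁i k₂i hk hab hak hbk hJ1 hJ2
    have i1 : InjOn π (k₁ ∪ k₂) := by
      refine InjOn.union_of_image k₁i k₂i (F := {R, S}) ?_ ?_ (by rw [image_pair]; exact hk.subset)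
      · rintro z (rfl | rfl) <;> [exact hk₁.left_mem; exact hk₁.right_mem]
      · rintro z (rfl | rfl) <;> [exact hk₂.left_mem; exact hk₂.right_mem]
    have i2 : InjOn π (a ∪ (k₁ ∪ k₂)) := by
      refine InjOn.union_of_image ai i1 (F := {R}) ?_ ?_ (by
        rw [image_singleton, image_union]; exact hak)
      · rintro z rfl; exact ha.right_mem
      · rintro z rfl; exact Or.inl hk₁.left_mem
    have i3 : InjOn π (a ∪ (k₁ ∪ k₂) ∪ b) := by
      refine InjOn.union_of_image i2 bi (F := {S}) ?_ ?_ ?_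
      · rintro z rfl; exact Or.inr (Or.inl hk₁.right_mem)
      · rintro z rfl; exact hb.right_mem
      · rw [image_singleton, image_union, image_union]
        rintro z ⟨hz | hz, hz'⟩
        · exact (disjoint_left.mp hab hz hz').elim
        · exact hbk ⟨hz', hz⟩
    have i4 : InjOn π (A₁ ∪ A₂ ∪ (a ∪ (k₁ ∪ k₂) ∪ b)) := by
      refine InjOn.union_of_image hi i3 (F := {P, Q}) ?_ ?_ ?_
      · rintro z (rfl | rfl) <;> assumption
      · rintro z (rfl | rfl)
        exacts [Or.inl (Or.inl ha.left_mem), Or.inr hb.left_mem]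
      · rw [image_pair]
        rintro z ⟨hz, hz'⟩
        rw [image_union, image_union, image_union] at hz'
        rcases hz' with (h | h) | h
        · exact hJ1 ⟨Or.inl h, hz⟩
        · exact (disjoint_left.mp hJ2 h hz).elim
        · exact hJ1 ⟨Or.inr h, hz⟩
    refine i4.mono ?_
    intro z; simp only [mem_union]; tauto
  have I := inj hΓ.inj ai bi k₁i k₂i hK12 hαβ hαK hβK hJ1 hJ2
  have I' := inj hΓ.inj' ai' bi' k₁i' k₂i' hK12' hαβ' hαK' hβK' hJ1' hJ2'
  rw [← image_union, ← image_union, ← image_union, ← image_union] at hsplit hsplit'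
  have ma : a ⊆ A₁ ∪ A₂ ∪ (a ∪ k₁ ∪ b ∪ (a ∪ k₂ ∪ b)) := by intro z; simp only [mem_union]; tauto
  have mb : b ⊆ A₁ ∪ A₂ ∪ (a ∪ k₁ ∪ b ∪ (a ∪ k₂ ∪ b)) := by intro z; simp only [mem_union]; tauto
  have mk : k₁ ∪ k₂ ⊆ A₁ ∪ A₂ ∪ (a ∪ k₁ ∪ b ∪ (a ∪ k₂ ∪ b)) := by
    intro z; simp only [mem_union]; tauto
  have mA : A₁ ∪ A₂ ⊆ A₁ ∪ A₂ ∪ (a ∪ k₁ ∪ b ∪ (a ∪ k₂ ∪ b)) := subset_union_left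
  have jord : ∀ {A k}, IsArc A P Q → IsArc k R S → A ⊆ A₁ ∪ A₂ → k ⊆ k₁ ∪ k₂ →
      IsJordanCurve (A ∪ (a ∪ k ∪ b)) := by
    intro A k hA' hk hsA hsk
    refine hA'.union_isJordanCurve ((ha.trans hk ?_).trans hb.symm ?_) ?_
    · refine InjOn.inter_subset_of_image I ma (hsk.trans mk) (singleton_subset_iff.mpr
        (ma ha.right_mem)) ?_
      rw [image_singleton]
      refine (inter_subset_inter_right _ (image_mono hsk)).trans ?_
      rw [image_union]; exact hαK
    · refine InjOn.inter_subset_of_image I (union_subset ma (hsk.trans mk)) mb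
        (singleton_subset_iff.mpr (mb hb.right_mem)) ?_
      rw [image_singleton, image_union]
      rintro z ⟨hz | hz, hz'⟩
      · exact (disjoint_left.mp hαβ hz hz').elim
      · refine hβK ⟨hz', ?_⟩
        rw [← image_union]; exact image_mono hsk hz
    · refine InjOn.inter_subset_of_image I (hsA.trans mA)
        (union_subset (union_subset ma (hsk.trans mk)) mb) (pair_subset (mA hP) (mA hQ)) ?_
      rw [image_pair, image_union, image_union]
      rintro z ⟨hz, (hz' | hz') | hz'⟩
      · exact hJ1 ⟨Or.inl hz', image_mono hsA hz⟩
      · refine (disjoint_left.mp hJ2 ?_ (image_mono hsA hz)).elim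
        rw [← image_union]; exact image_mono hsk hz'
      · exact hJ1 ⟨Or.inr hz', image_mono hsA hz⟩
  have hR : π R ∈ fill (K m) := by
    rw [← hKm]; exact Or.inl (Or.inl (mem_image_of_mem π hk₁.left_mem))
  refine ⟨{A₁ ∪ (a ∪ k₁ ∪ b), A₂ ∪ (a ∪ k₂ ∪ b)}, ⟨by simp, ?_, ?_, hsplit.isSideSubdiv I,
    hsplit'.isSideSubdiv I'⟩, ?_⟩
  · rintro _ (rfl | rfl)
    · exact jord hA₁ hk₁ subset_union_left subset_union_left
    · exact jord hA₂ hk₂ subset_union_right subset_union_right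
  · rw [sUnion_pair]
    intro z; simp only [mem_union]; tauto
  · rintro _ (rfl | rfl)
    · exact ⟨π R, mem_image_of_mem π (Or.inr (Or.inl (Or.inl ha.right_mem))), hR⟩
    · exact ⟨π R, mem_image_of_mem π (Or.inr (Or.inl (Or.inl ha.right_mem))), hR⟩

end Ops

lemma IsHoles.finite_diam_ge {K : ℕ → Set ℂ} (hK : IsHoles K) {ε : ℝ} (hε : 0 < ε) :
    {n | ε ≤ diam (fill (K n))}.Finite := by
  have h := (hK.null.diam).eventually (gt_mem_nhds hε)
  rw [← Nat.cofinite_eq_atTop, eventually_cofinite] at h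
  simpa using h

/-- A cell can be subdivided such that all holes inside the first projections of the new cells are
small. -/
lemma IsCell.exists_subdiv_holes_small {π π' : ℂ × ℂ → ℂ} {K K' : ℕ → Set ℂ}
    (hp : IsProjPair π π') (hK : IsHoles K) (hK' : IsHoles K') {ε : ℝ} (hε : 0 < ε)
    {Γ : Set (ℂ × ℂ)} (hΓ : IsCell π π' K K' Γ) :
    ∃ S, IsSubdiv π π' K K' Γ S ∧
      ∀ Δ ∈ S, ∀ n, fill (K n) ⊆ inside (π '' Δ) → diam (fill (K n)) < ε := by
  have hfin : ∀ Γ : Set (ℂ × ℂ),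
      {n | fill (K n) ⊆ inside (π '' Γ) ∧ ε ≤ diam (fill (K n))}.Finite := fun Γ =>
    (hK.finite_diam_ge hε).subset fun n hn => hn.2
  obtain ⟨k, hk⟩ : ∃ k, {n | fill (K n) ⊆ inside (π '' Γ) ∧ ε ≤ diam (fill (K n))}.ncard = k :=
    ⟨_, rfl⟩
  induction k using Nat.strong_induction_on generalizing Γ with
  | _ k ih =>
  rcases eq_empty_or_nonempty {n | fill (K n) ⊆ inside (π '' Γ) ∧ ε ≤ diam (fill (K n))} with h | h
  · refine ⟨{Γ}, IsSubdiv.refl hΓ, ?_⟩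
    intro Δ hΔ n hn
    rw [mem_singleton_iff.mp hΔ] at hn
    by_contra hlt
    exact (h ▸ (⟨hn, not_lt.mp hlt⟩ : n ∈ {n | fill (K n) ⊆ inside (π '' Γ) ∧
      ε ≤ diam (fill (K n))}) : n ∈ (∅ : Set ℕ))
  · obtain ⟨m, hm, hmε⟩ := h
    have hm0 : (K m).Nonempty := by
      rw [nonempty_iff_ne_empty]
      intro h0
      rw [h0, fill_empty, diam_empty] at hmε
      exact absurd hmε (not_le.mpr hε)
    have hJ' := hΓ.jordan.image hp.symm.continuous.continuousOn hΓ.inj'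
    obtain ⟨z, hz⟩ := hJ'.inside_nonempty
    obtain ⟨w, hw, hw'⟩ := mem_closure_iff.mp (hΓ.dense' ⟨m, hm0⟩ hz) _
      (isOpen_inside hJ'.isCompact.isClosed) hz
    obtain ⟨m', hm'⟩ := mem_iUnion.mp hw'
    have hm'0 : (K' m').Nonempty := by
      rw [nonempty_iff_ne_empty]
      intro h0
      rw [h0, fill_empty] at hm'
      exact hm'
    obtain ⟨S, hS, hSm⟩ := hΓ.exists_hole_cut hp hK hK' hm0 hm hm'0
      ((hΓ.good' m').resolve_right fun h => disjoint_left.mp h hm' hw)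
    obtain ⟨T, hT, hTS⟩ := hS.bind hp.continuous hp.symm.continuous
      (Q := fun Δ => ∀ n, fill (K n) ⊆ inside (π '' Δ) → diam (fill (K n)) < ε) fun Δ hΔ => by
        refine ih _ ?_ (hS.isCell hΓ hΔ) rfl
        rw [← hk]
        refine ncard_lt_ncard ⟨fun n hn => ⟨hn.1.trans (hS.side.sub Δ hΔ), hn.2⟩, fun hsub => ?_⟩
          (hfin Γ)
        obtain ⟨w, hw, hw'⟩ := hSm Δ hΔ
        exact disjoint_left.mp (disjoint_inside_self _) ((hsub ⟨hm, hmε⟩).1 hw') hw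
    exact ⟨T, hT, fun Δ hΔ => (hTS Δ hΔ).1⟩

/-- Level sets of `fun z => (ω * z).re` through the inside of a curve meet the curve below. -/
lemma exists_re_le_of_mem_inside {K : Set ℂ} (hK : Bornology.IsBounded K) {ω : ℂ} (hω : ‖ω‖ = 1)
    {x : ℂ} (hx : x ∈ inside K) : ∃ z ∈ K, (ω * z).re ≤ (ω * x).re := by
  by_contra! h
  obtain ⟨R, hR⟩ := hK.subset_closedBall 0
  have hωω : ω * (starRingEnd ℂ) ω = 1 := by
    rw [Complex.mul_conj, Complex.normSq_eq_norm_sq, hω]; norm_num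
  set t : ℝ := ‖x‖ + max R 1 + 1 with ht
  have ht0 : 0 ≤ t := by positivity
  have hseg : segment ℝ x (x - t * (starRingEnd ℂ) ω) ⊆ Kᶜ := by
    rw [segment_eq_image']
    rintro _ ⟨s, hs, rfl⟩ hK
    have := h _ hK
    have e : ω * (x + s • (x - t * (starRingEnd ℂ) ω - x)) = ω * x - (s * t : ℝ) := by
      rw [Complex.real_smul]
      push_cast
      linear_combination (-(s:ℂ) * t) * hωω
    rw [e, Complex.sub_re, Complex.ofReal_re] at this
    nlinarith [hs.1, mul_nonneg hs.1 ht0]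
  have hj : JoinedIn Kᶜ x (x - t * (starRingEnd ℂ) ω) := JoinedIn.of_segment_subset hseg
  have h1 := hj.mem_inside hx
  have h2 : x - t * (starRingEnd ℂ) ω ∈ outside K := by
    refine mem_outside_of_norm (R := max R 1) (by positivity)
      (hR.trans (closedBall_subset_closedBall (le_max_left _ _))) ?_
    have h3 : ‖(t : ℂ) * (starRingEnd ℂ) ω‖ = t := by
      rw [norm_mul, RCLike.norm_conj, hω, mul_one, Complex.norm_real, Real.norm_of_nonneg ht0]
    have h4 := norm_sub_norm_le ((t : ℂ) * (starRingEnd ℂ) ω) x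
    rw [h3, norm_sub_rev] at h4
    linarith
  exact disjoint_left.mp (disjoint_inside_outside K) h1 h2

lemma exists_le_re_of_mem_inside {K : Set ℂ} (hK : Bornology.IsBounded K) {ω : ℂ} (hω : ‖ω‖ = 1)
    {x : ℂ} (hx : x ∈ inside K) : ∃ z ∈ K, (ω * x).re ≤ (ω * z).re := by
  obtain ⟨z, hz, h⟩ := exists_re_le_of_mem_inside hK (ω := -ω) (by simpa using hω) hx
  exact ⟨z, hz, by simpa only [neg_mul, Complex.neg_re, neg_le_neg_iff] using h⟩

/-- If `J` together with each of finitely many compact sets, meeting each other in `J` only, does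
not separate `x` from `y`, then neither does the union. -/
lemma joinedIn_compl_union_biUnion {ι : Type*} {J : Set ℂ} (hJ : IsCompact J)
    (hJc : IsPreconnected J) {s : ι → Set ℂ} (hs : ∀ i, IsCompact (s i))
    (hss : ∀ i j, s i = s j ∨ s i ∩ s j ⊆ J) {x y : ℂ} (F : Finset ι) (h0 : JoinedIn Jᶜ x y)
    (h : ∀ i ∈ F, JoinedIn (J ∪ s i)ᶜ x y) : JoinedIn (J ∪ ⋃ i ∈ F, s i)ᶜ x y := by
  classical
  induction F using Finset.induction_on with
  | empty => simpa using h0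
  | insert k F hk ih =>
    have ih := ih fun i hi => h i (Finset.mem_insert_of_mem hi)
    rw [Finset.set_biUnion_insert]
    by_cases he : ∃ i ∈ F, s k = s i
    · obtain ⟨i, hi, he⟩ := he
      rwa [union_eq_self_of_subset_left (he ▸ subset_biUnion_of_mem (u := s) hi : s k ⊆ ⋃ i ∈ F, s i)]
    · push Not at he
      have hc : IsCompact (⋃ i ∈ F, s i) := F.isCompact_biUnion fun i _ => hs i
      have e : (J ∪ s k) ∩ (J ∪ ⋃ i ∈ F, s i) = J := by
        rw [← union_inter_distrib_left]
        refine union_eq_self_of_subset_right ?_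
        rintro z ⟨hz, hz'⟩
        simp only [mem_iUnion] at hz'
        obtain ⟨i, hi, hz'⟩ := hz'
        exact ((hss k i).resolve_left (he i hi)) ⟨hz, hz'⟩
      have := joinedIn_compl_union (hJ.union (hs k)) (hJ.union hc) (by rwa [e])
        (h k (Finset.mem_insert_self k F)) ih
      rwa [← union_union_distrib_left] at this

/-- If a line separates two points inside a Jordan curve then some segment of the line is a crosscut
separating them. -/
lemma IsJordanCurve.exists_segment {J : Set ℂ} (hJ : IsJordanCurve J) {ω : ℂ} (hω : ‖ω‖ = 1)
    {x y : ℂ} (hx : x ∈ inside J) (hy : y ∈ inside J) {c : ℝ} (hxc : (ω * x).re < c)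
    (hcy : c < (ω * y).re) :
    ∃ γ : ℝ → ℂ, Continuous γ ∧ γ 0 ∈ J ∧ γ 1 ∈ J ∧ γ 0 ≠ γ 1 ∧ (∀ t ∈ Icc (0:ℝ) 1, (ω * γ t).re = c) ∧
      (∀ t ∈ Ioo (0:ℝ) 1, γ t ∈ inside J) ∧
      ∀ A B, IsArc A (γ 0) (γ 1) → IsArc B (γ 0) (γ 1) → A ∩ B = {γ 0, γ 1} → J = A ∪ B →
        (∃ z ∈ A, (ω * z).re ≤ (ω * x).re ∨ (ω * y).re ≤ (ω * z).re) ∧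
        ∃ z ∈ B, (ω * z).re ≤ (ω * x).re ∨ (ω * y).re ≤ (ω * z).re := by
  classical
  have hωω : ω * (starRingEnd ℂ) ω = 1 := by
    rw [Complex.mul_conj, Complex.normSq_eq_norm_sq, hω]; norm_num
  have hωω' : (starRingEnd ℂ) ω * ω = 1 := by rw [mul_comm]; exact hωω
  set ℓ : ℝ → ℂ := fun t => (starRingEnd ℂ) ω * (c + t * Complex.I) with hℓ
  have hℓc : Continuous ℓ := by fun_prop
  have hωℓ : ∀ t, ω * ℓ t = c + t * Complex.I := fun t => by
    rw [hℓ]; beta_reduce; rw [← mul_assoc, hωω, one_mul]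
  have hℓu : ∀ t, (ω * ℓ t).re = c := fun t => by rw [hωℓ]; simp
  have hℓv : ∀ t, (ω * ℓ t).im = t := fun t => by rw [hωℓ]; simp
  have hℓi : Function.Injective ℓ := fun s t h => by rw [← hℓv s, h, hℓv]
  have huℓ : ∀ z : ℂ, (ω * z).re = c → ℓ (ω * z).im = z := fun z hz => by
    rw [hℓ]; beta_reduce
    rw [← hz, Complex.re_add_im, ← mul_assoc, hωω', one_mul]
  have hJc := hJ.isCompact
  have hIo : IsOpen (inside J) := isOpen_inside hJc.isClosed
  -- the components of the trace of the inside on the line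
  have hbd : ∃ M : ℝ, ∀ t, ℓ t ∈ inside J → |t| < M := by
    obtain ⟨R, hR⟩ := (isBounded_fill hJc.isBounded).subset_closedBall 0
    refine ⟨R + 1, fun t ht => ?_⟩
    have h1 := hR (Or.inr ht)
    rw [mem_closedBall_zero_iff] at h1
    have h2 : ‖ω * ℓ t‖ = ‖ℓ t‖ := by rw [norm_mul, hω, one_mul]
    have h3 := Complex.abs_im_le_norm (ω * ℓ t)
    rw [hℓv, h2] at h3
    linarith
  obtain ⟨M, hM⟩ := hbd
  have hgap : ∀ t, ℓ t ∈ inside J → ∃ a b, a < t ∧ t < b ∧ ℓ a ∈ J ∧ ℓ b ∈ J ∧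
      ∀ s ∈ Ioo a b, ℓ s ∈ inside J := by
    intro t ht
    have hF : IsClosed {s | ℓ s ∉ inside J} := (hIo.preimage hℓc).isClosed_compl
    have hmem : ∀ s, M ≤ |s| → s ∈ {s | ℓ s ∉ inside J} := fun s hs h =>
      absurd (hM s h) (not_lt.mpr hs)
    have htM := abs_lt.mp (hM t ht)
    obtain ⟨a, ha, b, hb, -, hat, htb, -, hab⟩ := exists_gap hF (a := -M) (b := M) (s := t) (t := t)
      (hmem _ (by rw [abs_neg]; exact le_abs_self _)) (hmem _ (le_abs_self _)) htM.1.le htM.2.le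
      le_rfl (by
        ext s
        simp only [Icc_self, mem_inter_iff, mem_singleton_iff, mem_empty_iff_false, iff_false]
        rintro ⟨h, rfl⟩
        exact h ht)
    have hI : ∀ s ∈ Ioo a b, ℓ s ∈ inside J := fun s hs => by
      by_contra h
      exact (hab ▸ (⟨h, hs⟩ : s ∈ {s | ℓ s ∉ inside J} ∩ Ioo a b) : s ∈ (∅ : Set ℝ))
    have hcl : ∀ s ∈ Icc a b, ℓ s ∈ fill J := fun s hs => by
      rw [← closure_Ioo (hat.trans htb).ne] at hs
      rw [← hJ.closure_inside]
      exact map_mem_closure hℓc hs hI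
    exact ⟨a, b, hat, htb, (hcl a ⟨le_rfl, (hat.trans htb).le⟩).resolve_right ha,
      (hcl b ⟨(hat.trans htb).le, le_rfl⟩).resolve_right hb, hI⟩
  choose! a b hat htb haJ hbJ hab using hgap
  have hnotI : ∀ z ∈ J, z ∉ inside J := fun z hz h => h.1 hz
  have hJx : JoinedIn Jᶜ x y := hJ.joinedIn_inside hx hy
  have key : ∃ t, ℓ t ∈ inside J ∧ ¬ JoinedIn (J ∪ ℓ '' Icc (a t) (b t))ᶜ x y := by
    by_contra! hno
    obtain ⟨p, hp⟩ := hJx.inside hx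
    have hPc : IsCompact (range p ∩ {z | (ω * z).re = c}) :=
      (isCompact_range p.continuous).inter_right (isClosed_eq (by fun_prop) continuous_const)
    obtain ⟨F, hF⟩ := hPc.elim_finite_subcover
      (fun t : {t // ℓ t ∈ inside J} => {z : ℂ | (ω * z).im ∈ Ioo (a t) (b t)})
      (fun t => isOpen_Ioo.preimage (by fun_prop)) (by
        rintro z ⟨⟨s, rfl⟩, hz⟩
        have h1 : ℓ (ω * p s).im ∈ inside J := by rw [huℓ _ hz]; exact hp s
        exact mem_iUnion.mpr ⟨⟨_, h1⟩, hat _ h1, htb _ h1⟩)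
    have hends : ∀ t, ℓ t ∈ inside J → ∀ s ∈ Icc (a t) (b t), ℓ s ∉ J → s ∈ Ioo (a t) (b t) := by
      intro t ht s hs hsJ
      refine ⟨lt_of_le_of_ne hs.1 ?_, lt_of_le_of_ne hs.2 ?_⟩
      · rintro rfl; exact hsJ (haJ t ht)
      · rintro rfl; exact hsJ (hbJ t ht)
    set sg : {t // ℓ t ∈ inside J} → Set ℂ := fun t => ℓ '' Icc (a t) (b t) with hsg
    have hsgc : ∀ t, IsCompact (sg t) := fun t => isCompact_Icc.image hℓc
    have h1 : JoinedIn (J ∪ ⋃ t ∈ F, sg t)ᶜ x y := by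
      refine joinedIn_compl_union_biUnion hJc hJ.isConnected.isPreconnected hsgc ?_ F hJx
        fun t _ => hno t t.2
      intro t t'
      by_cases hsub : sg t ∩ sg t' ⊆ J
      · exact Or.inr hsub
      · left
        obtain ⟨z, ⟨⟨s, hs, rfl⟩, s', hs', hss⟩, hz⟩ := not_subset.mp hsub
        obtain rfl := hℓi hss
        have i1 := hends t t.2 _ hs hz
        have i2 := hends t' t'.2 _ hs' hz
        have e1 : a t = a t' := by
          refine le_antisymm (le_of_not_gt fun h => ?_) (le_of_not_gt fun h => ?_)
          · exact hnotI _ (haJ t t.2) (hab t' t'.2 _ ⟨h, i1.1.trans i2.2⟩)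
          · exact hnotI _ (haJ t' t'.2) (hab t t.2 _ ⟨h, i2.1.trans i1.2⟩)
        have e2 : b t = b t' := by
          refine le_antisymm (le_of_not_gt fun h => ?_) (le_of_not_gt fun h => ?_)
          · exact hnotI _ (hbJ t' t'.2) (hab t t.2 _ ⟨i1.1.trans i2.2, h⟩)
          · exact hnotI _ (hbJ t t.2) (hab t' t'.2 _ ⟨i2.1.trans i1.2, h⟩)
        rw [hsg]; beta_reduce; rw [e1, e2]
    set L : Set ℂ := {z | z ∈ fill J ∧ (ω * z).re = c ∧ ∀ t ∈ F, (ω * z).im ∉ Ioo (a t) (b t)} with hL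
    have hLc : IsCompact L := by
      refine (isCompact_fill hJc).of_isClosed_subset ?_ fun z hz => hz.1
      have : L = fill J ∩ ({z | (ω * z).re = c} ∩ ⋂ t ∈ F, {z | (ω * z).im ∈ Ioo (a t) (b t)}ᶜ) := by
        ext z; simp only [hL, mem_ofPred_eq, mem_inter_iff, mem_iInter, mem_compl_iff]
      rw [this]
      refine (isClosed_fill hJc.isClosed).inter
        ((isClosed_eq (by fun_prop) continuous_const).inter ?_)
      exact isClosed_biInter fun t _ => (isOpen_Ioo.preimage (by fun_prop)).isClosed_compl
    have h2 : JoinedIn (J ∪ L)ᶜ x y := by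
      refine ⟨p, fun s hs => ?_⟩
      rcases hs with hs | hs
      · exact hnotI _ hs (hp s)
      · obtain ⟨t, ht⟩ := mem_iUnion.mp (hF ⟨⟨s, rfl⟩, hs.2.1⟩)
        simp only [mem_iUnion] at ht
        obtain ⟨htF, ht⟩ := ht
        exact hs.2.2 t htF ht
    have e : (J ∪ ⋃ t ∈ F, sg t) ∩ (J ∪ L) = J := by
      rw [← union_inter_distrib_left]
      refine union_eq_self_of_subset_right ?_
      rintro z ⟨hz, hzL⟩
      simp only [mem_iUnion] at hz
      obtain ⟨t, htF, s, hs, rfl⟩ := hz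
      by_contra hsJ
      have := hzL.2.2 t htF
      rw [hℓv] at this
      exact this (hends t t.2 s hs hsJ)
    obtain ⟨q, hq⟩ := joinedIn_compl_union (hJc.union (F.isCompact_biUnion fun t _ => hsgc t))
      (hJc.union hLc) (by rw [e]; exact hJ.isConnected.isPreconnected) h1 h2
    have hcont : Continuous fun s => (ω * q s).re := by fun_prop
    obtain ⟨s, hs⟩ := mem_range_of_exists_le_of_exists_ge hcont (c := c)
      ⟨0, by rw [q.source]; exact hxc.le⟩ ⟨1, by rw [q.target]; exact hcy.le⟩
    have hs' : (ω * q s).re = c := hs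
    have hqI : q s ∈ inside J := by
      have hd : Disjoint (range q) J := disjoint_left.mpr fun _ ⟨s, h⟩ h' =>
        hq s (Or.inl (Or.inl (h ▸ h')))
      have := (isPreconnected_range q.continuous).subset_inside_or_disjoint hJc.isClosed hd
      exact (this.resolve_right fun h => disjoint_left.mp h ⟨0, q.source⟩ hx) ⟨s, rfl⟩
    by_cases hin : ∃ t ∈ F, (ω * q s).im ∈ Ioo (a t) (b t)
    · obtain ⟨t, htF, ht⟩ := hin
      refine hq s (Or.inl (Or.inr ?_))
      exact mem_biUnion htF ⟨_, Ioo_subset_Icc_self ht, huℓ _ hs'⟩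
    · push Not at hin
      exact hq s (Or.inr (Or.inr ⟨Or.inr hqI, hs', hin⟩))
  obtain ⟨t, ht, hsep⟩ := key
  have hlt : a t < b t := (hat t ht).trans (htb t ht)
  set α : ℝ → ℝ := fun s => a t + s * (b t - a t) with hα
  have hαI : α '' Icc 0 1 = Icc (a t) (b t) := by
    ext r
    constructor
    · rintro ⟨s, hs, rfl⟩
      constructor <;> rw [hα] <;> beta_reduce <;> nlinarith [hs.1, hs.2]
    · intro hr
      refine ⟨(r - a t) / (b t - a t), ⟨div_nonneg (by linarith [hr.1]) (by linarith),
        (div_le_one (by linarith)).mpr (by linarith [hr.2])⟩, ?_⟩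
      rw [hα]; beta_reduce
      rw [div_mul_cancel₀ _ (by linarith : b t - a t ≠ 0)]
      ring
  have hα0 : α 0 = a t := by simp [hα]
  have hα1 : α 1 = b t := by simp [hα]
  refine ⟨fun s => ℓ (α s), by fun_prop, ?_, ?_, ?_, fun s _ => hℓu _, fun s hs => ?_, ?_⟩
  · beta_reduce; rw [hα0]; exact haJ t ht
  · beta_reduce; rw [hα1]; exact hbJ t ht
  · beta_reduce; rw [hα0, hα1]; exact fun h => hlt.ne (hℓi h)
  · refine hab t ht _ ⟨?_, ?_⟩ <;> rw [hα] <;> beta_reduce <;> nlinarith [hs.1, hs.2]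
  beta_reduce
  rw [hα0, hα1]
  intro A B hA hB hAB hJAB
  have hβ : IsArc (ℓ '' Icc (a t) (b t)) (ℓ (a t)) (ℓ (b t)) :=
    isArc_image_Icc hlt hℓc.continuousOn hℓi.injOn
  have hβJ : ℓ '' Icc (a t) (b t) \ {ℓ (a t), ℓ (b t)} ⊆ inside (A ∪ B) := by
    rintro _ ⟨⟨s, hs, rfl⟩, hs'⟩
    rw [← hJAB]
    refine hab t ht s ⟨lt_of_le_of_ne hs.1 ?_, lt_of_le_of_ne hs.2 ?_⟩
    · rintro rfl; exact hs' (Or.inl rfl)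
    · rintro rfl; exact hs' (Or.inr rfl)
  have hnβ : ∀ z, (ω * z).re ≠ c → z ∉ ℓ '' Icc (a t) (b t) := by
    rintro _ hz ⟨s, -, rfl⟩
    exact hz (hℓu s)
  have hJA := theta_half hA hB hAB hβ hβJ
  have hJB := theta_half hB hA (by rwa [inter_comm]) hβ (by rwa [union_comm B A])
  have hcov := theta_cover hA hB hAB hβ hβJ
  rw [← hJAB] at hcov
  have one : ∀ C, IsJordanCurve (C ∪ ℓ '' Icc (a t) (b t)) →
      inside (C ∪ ℓ '' Icc (a t) (b t)) ⊆ inside J \ ℓ '' Icc (a t) (b t) →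
      x ∈ inside (C ∪ ℓ '' Icc (a t) (b t)) → y ∈ inside (C ∪ ℓ '' Icc (a t) (b t)) → False := by
    intro C hC hsub hx' hy'
    refine hsep ((hC.isPathConnected_inside.joinedIn x hx' y hy').mono fun z hz h => ?_)
    rcases h with h | h
    · exact hnotI z h (hsub hz).1
    · exact (hsub hz).2 h
  have low : ∀ C, IsJordanCurve (C ∪ ℓ '' Icc (a t) (b t)) → x ∈ inside (C ∪ ℓ '' Icc (a t) (b t)) →
      ∃ z ∈ C, (ω * z).re ≤ (ω * x).re ∨ (ω * y).re ≤ (ω * z).re := by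
    intro C hC hx'
    obtain ⟨z, hz, hzx⟩ := exists_re_le_of_mem_inside hC.isCompact.isBounded hω hx'
    exact ⟨z, hz.resolve_right (hnβ z (hzx.trans_lt hxc).ne), Or.inl hzx⟩
  have high : ∀ C, IsJordanCurve (C ∪ ℓ '' Icc (a t) (b t)) → y ∈ inside (C ∪ ℓ '' Icc (a t) (b t)) →
      ∃ z ∈ C, (ω * z).re ≤ (ω * x).re ∨ (ω * y).re ≤ (ω * z).re := by
    intro C hC hy'
    obtain ⟨z, hz, hzy⟩ := exists_le_re_of_mem_inside hC.isCompact.isBounded hω hy'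
    exact ⟨z, hz.resolve_right (hnβ z (hcy.trans_le hzy).ne'), Or.inr hzy⟩
  have hA' : inside (A ∪ ℓ '' Icc (a t) (b t)) ⊆ inside J \ ℓ '' Icc (a t) (b t) := by
    rw [hJAB]; exact hJA.2.2.1
  have hB' : inside (B ∪ ℓ '' Icc (a t) (b t)) ⊆ inside J \ ℓ '' Icc (a t) (b t) := by
    rw [hJAB, union_comm A B]; exact hJB.2.2.1
  have hxm : x ∈ inside J \ ℓ '' Icc (a t) (b t) := ⟨hx, hnβ x hxc.ne⟩
  have hym : y ∈ inside J \ ℓ '' Icc (a t) (b t) := ⟨hy, hnβ y hcy.ne'⟩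
  rw [hcov] at hxm hym
  rcases hxm with hxA | hxB <;> rcases hym with hyA | hyB
  · exact (one A hJA.1 hA' hxA hyA).elim
  · exact ⟨low A hJA.1 hxA, high B hJB.1 hyB⟩
  · exact ⟨high A hJA.1 hyA, low B hJB.1 hxB⟩
  · exact (one B hJB.1 hB' hxB hyB).elim

/-- A compact part of a Jordan curve is covered by finitely many connected parts of the curve inside
a given neighbourhood. -/
lemma IsJordanCurve.exists_finite_cover {J : Set ℂ} (hJ : IsJordanCurve J) {C U : Set ℂ}
    (hC : IsCompact C) (hCJ : C ⊆ J) (hU : IsOpen U) (hCU : C ⊆ U) :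
    ∃ ℱ : Finset (Set ℂ), (∀ F ∈ ℱ, IsPreconnected F ∧ F ⊆ J ∧ F ⊆ U) ∧
      ∀ z ∈ C, ∃ F ∈ ℱ, z ∈ F := by
  classical
  have h : ∀ p ∈ C, ∃ A B, IsPreconnected B ∧ B ⊆ J ∧ B ⊆ U ∧ J ⊆ A ∪ B ∧ Aᶜ ∈ 𝓝 p := by
    intro p hp
    obtain ⟨A, B, a, b, hA, hB, hAB, hJAB, hpB, hBU⟩ := hJ.small_arc (hCJ hp) (hU.mem_nhds (hCU hp))
    refine ⟨A, B, hB.isConnected.isPreconnected, hJAB ▸ subset_union_right, hBU, hJAB.le,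
      hA.isCompact.isClosed.isOpen_compl.mem_nhds fun hpA => hpB.2 ?_⟩
    rw [← hAB]
    exact ⟨hpA, hpB.1⟩
  choose! A B hB hBJ hBU hJ hA using h
  obtain ⟨t, htC, ht⟩ := hC.elim_nhds_subcover (fun p => (A p)ᶜ) hA
  refine ⟨t.image B, ?_, fun z hz => ?_⟩
  · intro F hF
    obtain ⟨p, hp, rfl⟩ := Finset.mem_image.mp hF
    exact ⟨hB p (htC p hp), hBJ p (htC p hp), hBU p (htC p hp)⟩
  · obtain ⟨p, hp, hz'⟩ := mem_iUnion₂.mp (ht hz)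
    exact ⟨B p, Finset.mem_image_of_mem _ hp, (hJ p (htC p hp) (hCJ hz)).resolve_left hz'⟩

section Mesh

variable {π π' : ℂ × ℂ → ℂ} {K K' : ℕ → Set ℂ} {Γ : Set (ℂ × ℂ)}

/-- No cell of a suitable subdivision crosses a given strip. -/
lemma IsCell.exists_subdiv_strip_aux (hp : IsProjPair π π') (hK : IsHoles K) (hK' : IsHoles K')
    {ω : ℂ} (hω : ‖ω‖ = 1) {c η e : ℝ} (he : 0 < e) (heη : 8 * e < η) (ℱ : Finset (Set ℂ))
    (hΓ : IsCell π π' K K' Γ)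
    (hsm : ∀ n, fill (K n) ⊆ inside (π '' Γ) → diam (fill (K n)) < e)
    (hℱ : ∀ F ∈ ℱ, IsPreconnected F ∧ F ⊆ π '' Γ ∧ F ⊆ {z | η / 2 < |(ω * z).re - c|})
    (hcov : ∀ z ∈ π '' Γ, 3 * η / 4 ≤ |(ω * z).re - c| → ∃ F ∈ ℱ, z ∈ F) :
    ∃ S, IsSubdiv π π' K K' Γ S ∧ ∀ Δ ∈ S, ∀ x ∈ fill (π '' Δ), ∀ y ∈ fill (π '' Δ),
      (ω * x).re ≤ c - η → (ω * y).re < c + η := by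
  classical
  obtain ⟨k, hk⟩ : ∃ k, ℱ.card = k := ⟨_, rfl⟩
  induction k using Nat.strong_induction_on generalizing Γ ℱ with
  | _ k ih =>
  by_cases hst : ∀ x ∈ fill (π '' Γ), ∀ y ∈ fill (π '' Γ), (ω * x).re ≤ c - η → (ω * y).re < c + η
  · exact ⟨{Γ}, IsSubdiv.refl hΓ, by rintro _ rfl; exact hst⟩
  push Not at hst
  obtain ⟨x, hx, y, hy, hxc, hyc⟩ := hst
  have hη : 0 < η := by linarith
  have hJ : IsJordanCurve (π '' Γ) := hΓ.jordan.image hp.continuous.continuousOn hΓ.inj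
  rw [← hJ.closure_inside] at hx hy
  obtain ⟨x', hx', hxi⟩ := mem_closure_iff.mp hx {z | (ω * z).re < c - 3 * η / 4}
    (isOpen_lt (by fun_prop) continuous_const) (by rw [mem_ofPred_eq]; linarith)
  obtain ⟨y', hy', hyi⟩ := mem_closure_iff.mp hy {z | c + 3 * η / 4 < (ω * z).re}
    (isOpen_lt continuous_const (by fun_prop)) (by rw [mem_ofPred_eq]; linarith)
  rw [mem_ofPred_eq] at hx' hy'
  obtain ⟨γ, hγ, h0, h1, hne, hγc, hγI, hfar⟩ := hJ.exists_segment hω hxi hyi (c := c)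
    (by linarith) (by linarith)
  obtain ⟨β, hβ, hβJ, hβK, hβγ⟩ := exists_arc_avoiding_near (isOpen_inside hJ.isCompact.isClosed)
    hK.null hΓ.good hγ.continuousOn hγI (fun h => h.1 h0) (fun h => h.1 h1) hne he hsm
  have hβc : ∀ z ∈ β, |(ω * z).re - c| < η / 2 := by
    intro z hz
    have h2 := hβγ hz
    rw [(isCompact_Icc.image hγ).cthickening_eq_biUnion_closedBall (by linarith)] at h2
    simp only [mem_iUnion] at h2
    obtain ⟨_, ⟨t, ht, rfl⟩, h2⟩ := h2
    rw [mem_closedBall, dist_eq_norm] at h2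
    have h3 := Complex.abs_re_le_norm (ω * (z - γ t))
    rw [norm_mul, hω, one_mul, mul_sub, Complex.sub_re, hγc t ht] at h3
    linarith
  obtain ⟨P, hP, hP0⟩ := h0
  obtain ⟨Q, hQ, hQ1⟩ := h1
  have hPQ : P ≠ Q := by rintro rfl; exact hne (hP0.symm.trans hQ1)
  obtain ⟨A₁, A₂, hA₁, hA₂, hA, rfl⟩ := hΓ.jordan.split hP hQ hPQ
  rw [← hP0, ← hQ1] at hβ hβJ hβK hfar
  obtain ⟨B, hB, hS⟩ := hΓ.exists_crosscut hp hK hK' hA₁ hA₂ hA hβ hβJ hβK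
  have hends : ∀ z ∈ ({π P, π Q} : Set ℂ), (ω * z).re = c := by
    rintro z (rfl | rfl)
    · rw [hP0]; exact hγc 0 (by simp)
    · rw [hQ1]; exact hγc 1 (by simp)
  have hinter : π '' A₁ ∩ π '' A₂ = {π P, π Q} := by
    rw [← hΓ.inj.image_inter subset_union_left subset_union_right, hA, image_pair]
  have hfar' := hfar (π '' A₁) (π '' A₂)
    (hA₁.image hp.continuous.continuousOn (hΓ.inj.mono subset_union_left))
    (hA₂.image hp.continuous.continuousOn (hΓ.inj.mono subset_union_right)) hinter (image_union _ _ _)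
  have hfar34 : ∀ z, (ω * z).re ≤ (ω * x').re ∨ (ω * y').re ≤ (ω * z).re →
      3 * η / 4 ≤ |(ω * z).re - c| := by
    rintro z (h | h)
    · exact le_trans (by linarith) (neg_le_abs _)
    · exact le_trans (by linarith) (le_abs_self _)
  have child : ∀ A A' : Set (ℂ × ℂ), A ∪ A' = A₁ ∪ A₂ → π '' A ∩ π '' A' = {π P, π Q} →
      IsCompact (π '' A) → IsCompact (π '' A') →
      (∃ z ∈ π '' A', (ω * z).re ≤ (ω * x').re ∨ (ω * y').re ≤ (ω * z).re) →
      A ∪ B ∈ ({A₁ ∪ B, A₂ ∪ B} : Set (Set (ℂ × ℂ))) →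
      ∃ S, IsSubdiv π π' K K' (A ∪ B) S ∧ ∀ Δ ∈ S, ∀ x ∈ fill (π '' Δ), ∀ y ∈ fill (π '' Δ),
        (ω * x).re ≤ c - η → (ω * y).re < c + η := by
    intro A A' hAA hinter hAc hAc' hz hmem
    have hnot : ∀ z, η / 2 < |(ω * z).re - c| → z ∈ π '' A → z ∉ π '' A' := by
      intro z hz h h'
      rw [hends z (hinter ▸ ⟨h, h'⟩), sub_self, abs_zero] at hz
      linarith
    have hdich : ∀ F ∈ ℱ, F ⊆ π '' A ∨ F ⊆ π '' A' := by
      intro F hF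
      obtain ⟨hF1, hF2, hF3⟩ := hℱ F hF
      refine isPreconnected_iff_subset_of_disjoint_closed.mp hF1 _ _ hAc.isClosed hAc'.isClosed
        (by rw [← image_union, hAA]; exact hF2) ?_
      ext z
      simp only [mem_inter_iff, mem_empty_iff_false, iff_false]
      exact fun h => hnot z (hF3 h.1) h.2.1 h.2.2
    refine ih (ℱ.filter (· ⊆ π '' A)).card ?_ (ℱ.filter (· ⊆ π '' A)) (hS.isCell hΓ hmem)
      (fun n hn => hsm n (hn.trans (hS.side.sub _ hmem))) ?_ ?_ rfl
    · obtain ⟨z, hz, hzf⟩ := hz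
      obtain ⟨F, hF, hzF⟩ := hcov z (hAA ▸ image_mono subset_union_right hz) (hfar34 z hzf)
      rw [← hk]
      refine Finset.card_lt_card (Finset.filter_ssubset.mpr ⟨F, hF, fun hFA => ?_⟩)
      exact hnot z ((hℱ F hF).2.2 hzF) (hFA hzF) hz
    · intro F hF
      obtain ⟨hF, hFA⟩ := Finset.mem_filter.mp hF
      exact ⟨(hℱ F hF).1, hFA.trans (image_mono subset_union_left), (hℱ F hF).2.2⟩
    · intro z hz hzc
      rw [image_union, hB] at hz
      have hzA : z ∈ π '' A := hz.resolve_right fun h => by linarith [hβc z h]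
      obtain ⟨F, hF, hzF⟩ := hcov z (hAA ▸ image_mono subset_union_left hzA) hzc
      exact ⟨F, Finset.mem_filter.mpr ⟨hF, (hdich F hF).resolve_right fun h =>
        hnot z ((hℱ F hF).2.2 hzF) hzA (h hzF)⟩, hzF⟩
  have hc₁ : IsCompact (π '' A₁) := hA₁.isCompact.image hp.continuous
  have hc₂ : IsCompact (π '' A₂) := hA₂.isCompact.image hp.continuous
  obtain ⟨T, hT, hTS⟩ := hS.bind hp.continuous hp.symm.continuous
    (Q := fun Δ => ∀ x ∈ fill (π '' Δ), ∀ y ∈ fill (π '' Δ),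
      (ω * x).re ≤ c - η → (ω * y).re < c + η) (by
      rintro Δ (rfl | rfl)
      · exact child A₁ A₂ rfl hinter hc₁ hc₂ hfar'.2 (Or.inl rfl)
      · exact child A₂ A₁ (union_comm _ _) (by rwa [inter_comm]) hc₂ hc₁ hfar'.1 (Or.inr rfl))
  exact ⟨T, hT, fun Δ hΔ => (hTS Δ hΔ).1⟩

lemma IsCell.exists_subdiv_strip (hp : IsProjPair π π') (hK : IsHoles K) (hK' : IsHoles K')
    {ω : ℂ} (hω : ‖ω‖ = 1) {c η e : ℝ} (he : 0 < e) (heη : 8 * e < η) (hΓ : IsCell π π' K K' Γ)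
    (hsm : ∀ n, fill (K n) ⊆ inside (π '' Γ) → diam (fill (K n)) < e) :
    ∃ S, IsSubdiv π π' K K' Γ S ∧ ∀ Δ ∈ S, ∀ x ∈ fill (π '' Δ), ∀ y ∈ fill (π '' Δ),
      (ω * x).re ≤ c - η → (ω * y).re < c + η := by
  have hJ : IsJordanCurve (π '' Γ) := hΓ.jordan.image hp.continuous.continuousOn hΓ.inj
  obtain ⟨ℱ, hℱ, hcov⟩ := hJ.exists_finite_cover
    (C := π '' Γ ∩ {z | 3 * η / 4 ≤ |(ω * z).re - c|}) (U := {z | η / 2 < |(ω * z).re - c|})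
    (hJ.isCompact.inter_right (isClosed_le continuous_const (by fun_prop))) inter_subset_left
    (isOpen_lt continuous_const (by fun_prop)) (fun z hz => by
      have := hz.2
      rw [mem_ofPred_eq] at this ⊢
      linarith)
  exact hΓ.exists_subdiv_strip_aux hp hK hK' hω he heη ℱ hsm hℱ fun z hz h => hcov z ⟨hz, h⟩

lemma IsCell.exists_subdiv_strips (hp : IsProjPair π π') (hK : IsHoles K) (hK' : IsHoles K')
    {η e : ℝ} (he : 0 < e) (heη : 8 * e < η) (L : Finset (ℂ × ℝ)) (hL : ∀ p ∈ L, ‖p.1‖ = 1)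
    (hΓ : IsCell π π' K K' Γ)
    (hsm : ∀ n, fill (K n) ⊆ inside (π '' Γ) → diam (fill (K n)) < e) :
    ∃ S, IsSubdiv π π' K K' Γ S ∧ ∀ Δ ∈ S, ∀ p ∈ L, ∀ x ∈ fill (π '' Δ), ∀ y ∈ fill (π '' Δ),
      (p.1 * x).re ≤ p.2 - η → (p.1 * y).re < p.2 + η := by
  classical
  induction L using Finset.induction_on generalizing Γ with
  | empty => exact ⟨{Γ}, IsSubdiv.refl hΓ, fun _ _ p hp => absurd hp (Finset.notMem_empty p)⟩
  | insert q L hq ih =>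
    obtain ⟨S, hS, hSq⟩ := hΓ.exists_subdiv_strip hp hK hK' (hL q (Finset.mem_insert_self q L))
      (c := q.2) he heη hsm
    obtain ⟨T, hT, hTS⟩ := hS.bind hp.continuous hp.symm.continuous
      (Q := fun Δ => ∀ p ∈ L, ∀ x ∈ fill (π '' Δ), ∀ y ∈ fill (π '' Δ),
        (p.1 * x).re ≤ p.2 - η → (p.1 * y).re < p.2 + η) fun Δ hΔ =>
        ih (fun p hp => hL p (Finset.mem_insert_of_mem hp)) (hS.isCell hΓ hΔ)
          (fun n hn => hsm n (hn.trans (hS.side.sub Δ hΔ)))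
    refine ⟨T, hT, fun C hC p hpL x hx y hy => ?_⟩
    obtain ⟨h1, Δ, hΔ, -, -, hf, -⟩ := hTS C hC
    rcases Finset.mem_insert.mp hpL with rfl | hpL
    · exact hSq Δ hΔ x (hf hx) y (hf hy)
    · exact h1 p hpL x hx y hy

/-- A cell can be subdivided into cells with small first projections. -/
lemma IsCell.exists_subdiv_mesh (hp : IsProjPair π π') (hK : IsHoles K) (hK' : IsHoles K')
    (hΓ : IsCell π π' K K' Γ) {ε : ℝ} (hε : 0 < ε) :
    ∃ S, IsSubdiv π π' K K' Γ S ∧ ∀ Δ ∈ S, ∀ x ∈ fill (π '' Δ), ∀ y ∈ fill (π '' Δ),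
      dist x y < ε := by
  classical
  set η : ℝ := ε / 8 with hη
  have hη0 : 0 < η := by positivity
  have hJ : IsJordanCurve (π '' Γ) := hΓ.jordan.image hp.continuous.continuousOn hΓ.inj
  obtain ⟨R, hR⟩ := (isBounded_fill hJ.isCompact.isBounded).subset_closedBall 0
  obtain ⟨M, hM⟩ := exists_nat_gt (R / η + 2)
  obtain ⟨S, hS, hSm⟩ := hΓ.exists_subdiv_holes_small hp hK hK' (ε := η / 9) (by positivity)
  set L : Finset (ℂ × ℝ) := (Finset.Icc (-(M:ℤ)) M ×ˢ {1, -Complex.I}).image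
    fun p => (p.2, (p.1 : ℝ) * η) with hL
  obtain ⟨T, hT, hTS⟩ := hS.bind hp.continuous hp.symm.continuous
    (Q := fun Δ => ∀ p ∈ L, ∀ x ∈ fill (π '' Δ), ∀ y ∈ fill (π '' Δ),
      (p.1 * x).re ≤ p.2 - η → (p.1 * y).re < p.2 + η) fun Δ hΔ => by
      refine (hS.isCell hΓ hΔ).exists_subdiv_strips hp hK hK' (e := η / 9) (by positivity)
        (by linarith) L ?_ (hSm Δ hΔ)
      intro p hpL
      obtain ⟨q, hq, rfl⟩ := Finset.mem_image.mp hpL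
      rcases Finset.mem_insert.mp (Finset.mem_product.mp hq).2 with h | h
      · rw [h]; simp
      · rw [Finset.mem_singleton.mp h]; simp
  refine ⟨T, hT, fun C hC => ?_⟩
  have hJC := hT.side.jordan hp.continuous hT.jordan hC
  have hCR : fill (π '' C) ⊆ closedBall 0 R :=
    (hJ.fill_subset_fill hJC (hT.side.sub C hC)).trans hR
  have key : ∀ ω : ℂ, (ω = 1 ∨ ω = -Complex.I) → ∀ x ∈ fill (π '' C), ∀ y ∈ fill (π '' C),
      (ω * y).re - (ω * x).re < 4 * η := by
    intro ω hω x hx y hy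
    have hω1 : ‖ω‖ = 1 := by rcases hω with rfl | rfl <;> simp
    have hxR : |(ω * x).re| ≤ R := by
      refine (Complex.abs_re_le_norm _).trans ?_
      rw [norm_mul, hω1, one_mul]
      exact mem_closedBall_zero_iff.mp (hCR hx)
    obtain ⟨hx1, hx2⟩ := abs_le.mp hxR
    set k : ℤ := ⌈(ω * x).re / η⌉ + 1 with hk
    have hk1 : (ω * x).re / η + 1 ≤ k := by
      rw [hk]; push_cast; linarith [Int.le_ceil ((ω * x).re / η)]
    have hk2 : (k : ℝ) < (ω * x).re / η + 2 := by
      rw [hk]; push_cast; linarith [Int.ceil_lt_add_one ((ω * x).re / η)]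
    have hb1 : (ω * x).re / η ≤ R / η := div_le_div_of_nonneg_right hx2 hη0.le
    have hb2 : -(R / η) ≤ (ω * x).re / η := by
      rw [← neg_div]; exact div_le_div_of_nonneg_right hx1 hη0.le
    have hkM : k ∈ Finset.Icc (-(M:ℤ)) M := by
      rw [Finset.mem_Icc]
      constructor
      · have : -(M:ℝ) ≤ k := by linarith
        exact_mod_cast this
      · have : (k:ℝ) ≤ M := by linarith
        exact_mod_cast this
    have hmem : ((ω, (k:ℝ) * η) : ℂ × ℝ) ∈ L := by
      refine Finset.mem_image.mpr ⟨(k, ω), Finset.mem_product.mpr ⟨hkM, ?_⟩, rfl⟩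
      rcases hω with rfl | rfl <;> simp
    have e : (ω * x).re / η * η = (ω * x).re := div_mul_cancel₀ _ hη0.ne'
    have h := (hTS C hC).1 _ hmem x hx y hy (by
      nlinarith [mul_le_mul_of_nonneg_right hk1 hη0.le])
    have h2 := mul_lt_mul_of_pos_right hk2 hη0
    change (ω * y).re < k * η + η at h
    nlinarith
  intro x hx y hy
  rw [dist_eq_norm]
  refine (Complex.norm_le_abs_re_add_abs_im _).trans_lt ?_
  have hr : |(x - y).re| < 4 * η := by
    have h1 := key 1 (Or.inl rfl) x hx y hy
    have h2 := key 1 (Or.inl rfl) y hy x hx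
    rw [one_mul, one_mul] at h1 h2
    rw [Complex.sub_re, abs_lt]
    constructor <;> linarith
  have hi : |(x - y).im| < 4 * η := by
    have h1 := key _ (Or.inr rfl) x hx y hy
    have h2 := key _ (Or.inr rfl) y hy x hx
    simp only [neg_mul, Complex.neg_re, Complex.mul_re, Complex.I_re, Complex.I_im] at h1 h2
    rw [Complex.sub_im, abs_lt]
    constructor <;> linarith
  linarith

/-- A cell can be subdivided into cells with both projections small. -/
lemma IsCell.exists_subdiv_mesh_both (hp : IsProjPair π π') (hK : IsHoles K) (hK' : IsHoles K')
    (hΓ : IsCell π π' K K' Γ) {ε : ℝ} (hε : 0 < ε) :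
    ∃ S, IsSubdiv π π' K K' Γ S ∧ ∀ Δ ∈ S,
      (∀ x ∈ fill (π '' Δ), ∀ y ∈ fill (π '' Δ), dist x y < ε) ∧
      ∀ x ∈ fill (π' '' Δ), ∀ y ∈ fill (π' '' Δ), dist x y < ε := by
  obtain ⟨S, hS, hSε⟩ := hΓ.exists_subdiv_mesh hp hK hK' hε
  obtain ⟨T, hT, hTS⟩ := hS.bind hp.continuous hp.symm.continuous
    (Q := fun Δ => ∀ x ∈ fill (π' '' Δ), ∀ y ∈ fill (π' '' Δ), dist x y < ε) fun Δ hΔ => by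
      obtain ⟨T, hT, hTε⟩ := (hS.isCell hΓ hΔ).symm.exists_subdiv_mesh hp.symm hK' hK hε
      exact ⟨T, hT.symm, hTε⟩
  refine ⟨T, hT, fun C hC => ⟨fun x hx y hy => ?_, (hTS C hC).1⟩⟩
  obtain ⟨-, Δ, hΔ, -, -, hf, -⟩ := hTS C hC
  exact hSε Δ hΔ x (hf hx) y (hf hy)

end Mesh

section Limit

variable {π π' : ℂ × ℂ → ℂ} {K K' : ℕ → Set ℂ} {Γ : Set (ℂ × ℂ)} {S : Set (Set (ℂ × ℂ))}

/-- The pairs of points which lie in the two projections of a common cell. -/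
def cellPairs (π π' : ℂ × ℂ → ℂ) (S : Set (Set (ℂ × ℂ))) : Set (ℂ × ℂ) :=
  {P | ∃ Δ ∈ S, π P ∈ fill (π '' Δ) ∧ π' P ∈ fill (π' '' Δ)}

lemma cellPairs_comm (π π' : ℂ × ℂ → ℂ) (S : Set (Set (ℂ × ℂ))) :
    cellPairs π π' S = cellPairs π' π S := by
  ext P
  simp only [cellPairs, mem_ofPred_eq, and_comm]

lemma IsProjPair.exists_pair (hp : IsProjPair π π') (z w : ℂ) : ∃ P, π P = z ∧ π' P = w := by
  rcases hp with ⟨rfl, rfl⟩ | ⟨rfl, rfl⟩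
  · exact ⟨(z, w), rfl, rfl⟩
  · exact ⟨(w, z), rfl, rfl⟩

lemma IsProjPair.ext (hp : IsProjPair π π') {P Q : ℂ × ℂ} (h : π P = π Q) (h' : π' P = π' Q) :
    P = Q := by
  rcases hp with ⟨rfl, rfl⟩ | ⟨rfl, rfl⟩
  · exact Prod.ext h h'
  · exact Prod.ext h' h

lemma IsProjPair.isCompact (hp : IsProjPair π π') {X Y : Set ℂ} (hX : IsCompact X)
    (hY : IsCompact Y) : IsCompact {P | π P ∈ X ∧ π' P ∈ Y} := by
  rcases hp with ⟨rfl, rfl⟩ | ⟨rfl, rfl⟩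
  · exact hX.prod hY
  · convert hY.prod hX using 1
    ext P
    exact and_comm

lemma IsSubdiv.isCompact_cellPairs (hS : IsSubdiv π π' K K' Γ S) (hp : IsProjPair π π') :
    IsCompact (cellPairs π π' S) := by
  have : cellPairs π π' S = ⋃ Δ ∈ S, {P | π P ∈ fill (π '' Δ) ∧ π' P ∈ fill (π' '' Δ)} := by
    ext P
    simp only [cellPairs, mem_ofPred_eq, mem_iUnion, exists_prop]
  rw [this]
  exact hS.finite.isCompact_biUnion fun Δ hΔ => hp.isCompact
    (isCompact_fill ((hS.jordan Δ hΔ).isCompact.image hp.continuous))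
    (isCompact_fill ((hS.jordan Δ hΔ).isCompact.image hp.symm.continuous))

lemma IsSubdiv.dist_lt (hS : IsSubdiv π π' K K' Γ S) (hp : IsProjPair π π') {ε : ℝ}
    (hε : ∀ Δ ∈ S, ∀ x ∈ fill (π' '' Δ), ∀ y ∈ fill (π' '' Δ), dist x y < ε) {P Q : ℂ × ℂ}
    (hP : P ∈ cellPairs π π' S) (hQ : Q ∈ cellPairs π π' S) (h : π P = π Q) :
    dist (π' P) (π' Q) < 2 * ε := by
  obtain ⟨Δ₁, h₁, hP, hP'⟩ := hP
  obtain ⟨Δ₂, h₂, hQ, hQ'⟩ := hQ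
  by_cases hne : Δ₁ = Δ₂
  · subst hne
    have h3 := hε Δ₁ h₁ _ hP' _ hQ'
    have h4 := (dist_nonneg).trans_lt h3
    linarith
  · rw [← h] at hQ
    have J₁ := hS.side.jordan hp.continuous hS.jordan h₁
    have J₂ := hS.side.jordan hp.continuous hS.jordan h₂
    have hd := hS.side.disj Δ₁ h₁ Δ₂ h₂ hne
    obtain ⟨X, hX, hX'⟩ := J₁.mem_of_mem_fill J₂ hd hP hQ
    obtain ⟨Y, hY, hY'⟩ := J₂.mem_of_mem_fill J₁ hd.symm hQ hP
    obtain rfl := hS.side.inj ⟨Δ₁, h₁, hX⟩ ⟨Δ₂, h₂, hY⟩ (hX'.trans hY'.symm)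
    have h3 := hε Δ₁ h₁ _ hP' _ (Or.inl (mem_image_of_mem π' hX))
    have h4 := hε Δ₂ h₂ _ (Or.inl (mem_image_of_mem π' hY)) _ hQ'
    linarith [dist_triangle (π' P) (π' X) (π' Q)]

/-- The limit of a sequence of finer and finer subdivisions. -/
lemma limit_side (hp : IsProjPair π π') (hK : IsHoles K) {g : ℕ → Set (Set (ℂ × ℂ))}
    (hJ : IsJordanCurve (π '' Γ))
    (hg : ∀ n, IsSubdiv π π' K K' Γ (g n))
    (hε : ∀ n, ∀ C ∈ g (n + 1),
      (∀ x ∈ fill (π '' C), ∀ y ∈ fill (π '' C), dist x y < 1 / ((n : ℝ) + 1)) ∧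
      ∀ x ∈ fill (π' '' C), ∀ y ∈ fill (π' '' C), dist x y < 1 / ((n : ℝ) + 1))
    (hanti : ∀ n, cellPairs π π' (g (n + 1)) ⊆ cellPairs π π' (g n)) :
    InjOn π (⋂ n, cellPairs π π' (g n)) ∧
      π '' (⋂ n, cellPairs π π' (g n)) = fill (π '' Γ) \ ⋃ n, inside (K n) := by
  have hcpt : ∀ n, IsCompact (cellPairs π π' (g n)) := fun n => (hg n).isCompact_cellPairs hp
  refine ⟨fun P hP Q hQ h => hp.ext h ?_, Subset.antisymm ?_ ?_⟩
  · rw [mem_iInter] at hP hQ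
    rw [← dist_le_zero]
    have hlim : Tendsto (fun n : ℕ => 2 * (1 / ((n : ℝ) + 1))) atTop (𝓝 0) := by
      simpa using (tendsto_one_div_add_atTop_nhds_zero_nat (𝕜 := ℝ)).const_mul 2
    exact ge_of_tendsto' hlim fun n => ((hg (n + 1)).dist_lt hp (fun Δ hΔ => (hε n Δ hΔ).2)
      (hP (n + 1)) (hQ (n + 1)) h).le
  · rintro _ ⟨P, hP, rfl⟩
    rw [mem_iInter] at hP
    constructor
    · obtain ⟨Δ, hΔ, h, -⟩ := hP 0
      exact hJ.fill_subset_fill ((hg 0).side.jordan hp.continuous (hg 0).jordan hΔ)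
        ((hg 0).side.sub Δ hΔ) h
    · intro hmem
      obtain ⟨m, hm⟩ := mem_iUnion.mp hmem
      have hKm : IsJordanCurve (K m) := (hK.curve m).resolve_left fun h0 => by
        rw [h0, inside_empty] at hm
        exact hm
      obtain ⟨p, hpK⟩ := hKm.isConnected.nonempty
      obtain ⟨q, hqK, hpq⟩ := exists_ne_mem_jordan hKm (p := p)
      obtain ⟨n, hn⟩ := exists_nat_one_div_lt (dist_pos.mpr hpq)
      obtain ⟨Δ, hΔ, h, -⟩ := hP (n + 1)
      have hJΔ := (hg (n + 1)).side.jordan hp.continuous (hg (n + 1)).jordan hΔ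
      rw [← hJΔ.closure_inside] at h
      obtain ⟨w, hw, hw'⟩ := mem_closure_iff.mp h _ (isOpen_inside hKm.isCompact.isClosed) hm
      have hsub := ((hg (n + 1)).side.good Δ hΔ m).resolve_right fun h =>
        disjoint_left.mp h (Or.inr hw) hw'
      have := (hε n Δ hΔ).1 p (Or.inr (hsub (Or.inl hpK))) q (Or.inr (hsub (Or.inl hqK)))
      linarith
  · rintro z ⟨hz, hzK⟩
    have hcl : IsClosed {P | π P = z} := isClosed_eq hp.continuous continuous_const
    obtain ⟨P, hP⟩ := IsCompact.nonempty_iInter_of_sequence_nonempty_isCompact_isClosed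
      (fun n => cellPairs π π' (g n) ∩ {P | π P = z}) (fun n => inter_subset_inter_left _ (hanti n))
      (fun n => by
        obtain ⟨Δ, hΔ, hzΔ⟩ := (hg n).side.cover z hz hzK
        obtain ⟨X, hX⟩ := ((hg n).jordan Δ hΔ).isConnected.nonempty
        obtain ⟨P, rfl, hP⟩ := hp.exists_pair z (π' X)
        exact ⟨P, ⟨Δ, hΔ, hzΔ, hP ▸ Or.inl (mem_image_of_mem π' hX)⟩, rfl⟩)
      ((hcpt 0).inter_right hcl) (fun n => (hcpt n).isClosed.inter hcl)
    rw [mem_iInter] at hP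
    exact ⟨P, mem_iInter.mpr fun n => (hP n).1, (hP 0).2⟩

end Limit

/-- Extension of a homeomorphism between Jordan curves to the complements of the holes inside:
the graph of the boundary homeomorphism extends to the graph of a homeomorphism. -/
theorem IsCell.exists_graph {K K' : ℕ → Set ℂ} (hK : IsHoles K) (hK' : IsHoles K')
    {Γ : Set (ℂ × ℂ)} (hΓ : IsCell Prod.fst Prod.snd K K' Γ) :
    ∃ R : Set (ℂ × ℂ), IsCompact R ∧ Γ ⊆ R ∧ InjOn Prod.fst R ∧ InjOn Prod.snd R ∧
      Prod.fst '' R = fill (Prod.fst '' Γ) \ ⋃ n, inside (K n) ∧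
      Prod.snd '' R = fill (Prod.snd '' Γ) \ ⋃ n, inside (K' n) := by
  have hp : IsProjPair Prod.fst Prod.snd := Or.inl ⟨rfl, rfl⟩
  obtain ⟨g, -, hg⟩ := exists_seq_step (a := {Γ}) (P := IsSubdiv Prod.fst Prod.snd K K' Γ)
    (R := fun n S T => ∀ C ∈ T,
      ((∀ x ∈ fill (Prod.fst '' C), ∀ y ∈ fill (Prod.fst '' C), dist x y < 1 / ((n : ℝ) + 1)) ∧
      ∀ x ∈ fill (Prod.snd '' C), ∀ y ∈ fill (Prod.snd '' C), dist x y < 1 / ((n : ℝ) + 1)) ∧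
      ∃ Δ ∈ S, inside (Prod.fst '' C) ⊆ inside (Prod.fst '' Δ) ∧
        inside (Prod.snd '' C) ⊆ inside (Prod.snd '' Δ) ∧
        fill (Prod.fst '' C) ⊆ fill (Prod.fst '' Δ) ∧ fill (Prod.snd '' C) ⊆ fill (Prod.snd '' Δ))
    (IsSubdiv.refl hΓ) fun n S hS => hS.bind continuous_fst continuous_snd fun Δ hΔ =>
      (hS.isCell hΓ hΔ).exists_subdiv_mesh_both hp hK hK' (by positivity)
  have hanti : ∀ n, cellPairs Prod.fst Prod.snd (g (n + 1)) ⊆ cellPairs Prod.fst Prod.snd (g n) := by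
    rintro n P ⟨C, hC, h1, h2⟩
    obtain ⟨-, Δ, hΔ, -, -, hf, hf'⟩ := (hg n).2 C hC
    exact ⟨Δ, hΔ, hf h1, hf' h2⟩
  obtain ⟨hi, himg⟩ := limit_side hp hK (hΓ.jordan.image continuous_fst.continuousOn hΓ.inj)
    (fun n => (hg n).1) (fun n C hC => ((hg n).2 C hC).1) hanti
  obtain ⟨hi', himg'⟩ := limit_side hp.symm hK'
    (hΓ.jordan.image continuous_snd.continuousOn hΓ.inj')
    (fun n => (hg n).1.symm) (fun n C hC => ((hg n).2 C hC).1.symm)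
    (fun n => by simpa only [cellPairs_comm Prod.snd Prod.fst] using hanti n)
  simp only [cellPairs_comm Prod.snd Prod.fst] at hi' himg'
  refine ⟨⋂ n, cellPairs Prod.fst Prod.snd (g n), ?_, ?_, hi, hi', himg, himg'⟩
  · exact ((hg 0).1.isCompact_cellPairs hp).of_isClosed_subset
      (isClosed_iInter fun n => ((hg n).1.isCompact_cellPairs hp).isClosed) (iInter_subset _ 0)
  · intro P hP
    rw [mem_iInter]
    intro n
    obtain ⟨Δ, hΔ, hPΔ⟩ := (hg n).1.bdry hP
    exact ⟨Δ, hΔ, Or.inl (mem_image_of_mem _ hPΔ), Or.inl (mem_image_of_mem _ hPΔ)⟩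

/-! ### Stereographic charts of the sphere -/

/-- The stereographic projection from `p` as a partial homeomorphism onto the complex plane. -/
noncomputable def stereo (p : Sphere2) : OpenPartialHomeomorph Sphere2 ℂ :=
  have : Fact (Module.finrank ℝ (EuclideanSpace ℝ (Fin 3)) = 2 + 1) :=
    ⟨finrank_euclideanSpace_fin⟩
  (stereographic' 2 p).transHomeomorph
    Complex.orthonormalBasisOneI.repr.symm.toHomeomorph

/-- The stereographic projection from `p` to the complex plane. -/
noncomputable def chart (p : Sphere2) : Sphere2 → ℂ := stereo p

/-- The inverse of the stereographic projection from `p`. -/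
noncomputable def unchart (p : Sphere2) : ℂ → Sphere2 := (stereo p).symm

theorem stereo_source (p : Sphere2) : (stereo p).source = {p}ᶜ := by
  simp [stereo]

theorem stereo_target (p : Sphere2) : (stereo p).target = univ := by
  simp [stereo]

theorem continuousOn_chart (p : Sphere2) : ContinuousOn (chart p) {p}ᶜ := by
  rw [← stereo_source]; exact (stereo p).continuousOn

theorem continuous_unchart (p : Sphere2) : Continuous (unchart p) := by
  have h := (stereo p).continuousOn_symm
  rwa [stereo_target, continuousOn_univ] at h

theorem unchart_ne (p : Sphere2) (z : ℂ) : unchart p z ≠ p := by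
  have h : unchart p z ∈ (stereo p).source :=
    (stereo p).map_target (by rw [stereo_target]; trivial)
  rwa [stereo_source] at h

@[simp] theorem chart_unchart (p : Sphere2) (z : ℂ) : chart p (unchart p z) = z :=
  (stereo p).right_inv (by rw [stereo_target]; trivial)

theorem unchart_chart {p x : Sphere2} (h : x ≠ p) : unchart p (chart p x) = x :=
  (stereo p).left_inv (by rw [stereo_source]; exact h)

theorem injective_unchart (p : Sphere2) : Function.Injective (unchart p) :=
  Function.LeftInverse.injective (chart_unchart p)

theorem injOn_chart (p : Sphere2) : InjOn (chart p) {p}ᶜ := fun x hx y hy h => by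
  rw [← unchart_chart hx, h, unchart_chart hy]

theorem unchart_image_chart_image {p : Sphere2} {A : Set Sphere2} (h : p ∉ A) :
    unchart p '' (chart p '' A) = A := by
  rw [image_image]
  calc (fun x => unchart p (chart p x)) '' A = id '' A :=
        image_congr fun x hx => unchart_chart (fun e => h (e ▸ hx))
    _ = A := image_id A

theorem chart_image_unchart_image (p : Sphere2) (A : Set ℂ) :
    chart p '' (unchart p '' A) = A := by
  simp [image_image]

theorem isOpen_unchart_image (p : Sphere2) {A : Set ℂ} (hA : IsOpen A) :
    IsOpen (unchart p '' A) :=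
  ((stereo p).symm.isOpen_image_iff_of_subset_source (by simp [stereo_target])).2 hA

theorem compl_singleton_mem {p : Sphere2} {A : Set Sphere2} (h : p ∉ A) : A ⊆ {p}ᶜ :=
  fun _ hx e => h (e ▸ hx)

theorem continuousOn_chart_of_notMem {p : Sphere2} {A : Set Sphere2} (h : p ∉ A) :
    ContinuousOn (chart p) A := (continuousOn_chart p).mono (compl_singleton_mem h)

theorem injOn_chart_of_notMem {p : Sphere2} {A : Set Sphere2} (h : p ∉ A) :
    InjOn (chart p) A := (injOn_chart p).mono (compl_singleton_mem h)

theorem exists_ne_sphere (x : Sphere2) : ∃ p : Sphere2, x ≠ p := by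
  have := unchart_ne x 0
  exact ⟨_, this.symm⟩

/-! ### Invariance of domain on the sphere -/

theorem not_continuous_injective_sphere (g : Sphere2 → ℂ) (hc : Continuous g)
    (hi : Function.Injective g) : False := by
  obtain ⟨x₀⟩ : Nonempty Sphere2 := ⟨⟨EuclideanSpace.single 0 1, by simp⟩⟩
  have hcomp : CompactSpace Sphere2 := isCompact_iff_compactSpace.1 (isCompact_sphere _ _)
  have hcpt : IsCompact (range g) := isCompact_range hc
  have hopen : IsOpen (range g) := by
    rw [isOpen_iff_mem_nhds]
    rintro _ ⟨x, rfl⟩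
    obtain ⟨p, hp⟩ := exists_ne_sphere x
    set f : ℂ → ℂ := fun w => g (unchart p (chart p x + w)) with hf
    have hfc : Continuous f := hc.comp ((continuous_unchart p).comp (continuous_const.add continuous_id))
    have hfi : Function.Injective f := fun a b h => by
      have := injective_unchart p (hi h)
      simpa using this
    obtain ⟨hJ, hb, -⟩ := image_ball_eq_inside hfc.continuousOn (hfi.injOn (s := closedBall 0 1))
    have ho : IsOpen (f '' ball 0 1) := hb ▸ isOpen_inside hJ.isCompact.isClosed
    refine mem_of_superset (ho.mem_nhds ⟨0, by simp, ?_⟩) ?_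
    · simp [hf, unchart_chart hp]
    · rintro _ ⟨w, -, rfl⟩; exact mem_range_self _
  have := IsClopen.eq_univ ⟨hcpt.isClosed, hopen⟩ ⟨_, mem_range_self x₀⟩
  rw [this] at hcpt
  exact noncompact_univ ℂ hcpt

theorem surjective_of_continuous_injective_sphere {F : Sphere2 → Sphere2} (hc : Continuous F)
    (hi : Function.Injective F) : Function.Surjective F := by
  intro p
  by_contra! h
  exact not_continuous_injective_sphere (fun x => chart p (F x))
    ((continuousOn_chart p).comp_continuous hc h) fun x y e => hi (injOn_chart p (h x) (h y) e)

/-! ### Closed discs in the sphere -/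

/-- A closed disc in the sphere, parametrised by the closed unit disc of the complex plane. -/
def IsDisk (E : Set Sphere2) : Prop :=
  ∃ e : ℂ → Sphere2, ContinuousOn e (closedBall 0 1) ∧ InjOn e (closedBall 0 1) ∧
    e '' closedBall 0 1 = E

theorem IsClosedDisk.isDisk {E : Set Sphere2} (h : IsClosedDisk E) : IsDisk E := by
  obtain ⟨e⟩ := h
  let r := Complex.orthonormalBasisOneI.repr
  have hr : ∀ z ∈ closedBall (0 : ℂ) 1, r z ∈ UnitDisk2 := fun z hz => by simpa using hz
  obtain ⟨x₀⟩ : Nonempty Sphere2 := ⟨⟨EuclideanSpace.single 0 1, by simp⟩⟩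
  classical
  let g : ℂ → Sphere2 := fun z => if h : r z ∈ UnitDisk2 then (e.symm ⟨r z, h⟩ : Sphere2) else x₀
  have hg : ∀ z (h : r z ∈ UnitDisk2), g z = e.symm ⟨r z, h⟩ := fun z h => dif_pos h
  refine ⟨g, ?_, ?_, ?_⟩
  · rw [continuousOn_iff_continuous_domRestrict]
    have : (closedBall (0 : ℂ) 1).domRestrict g =
        fun z : closedBall (0 : ℂ) 1 => ((e.symm ⟨r z, hr z z.2⟩ : E) : Sphere2) := by
      ext1 z; exact hg z (hr z z.2)
    rw [this]
    fun_prop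
  · intro a ha b hb hab
    rw [hg a (hr a ha), hg b (hr b hb)] at hab
    simpa using e.symm.injective (Subtype.ext hab)
  · ext x
    constructor
    · rintro ⟨z, hz, rfl⟩
      rw [hg z (hr z hz)]; exact Subtype.coe_prop _
    · intro hx
      have h2 := (e ⟨x, hx⟩).2
      refine ⟨r.symm (e ⟨x, hx⟩), by simpa [-Subtype.coe_prop] using mem_closedBall_zero_iff.1 h2, ?_⟩
      rw [hg _ (by simp)]
      simp

theorem IsDisk.isCompact {E : Set Sphere2} (h : IsDisk E) : IsCompact E := by
  obtain ⟨e, hc, -, rfl⟩ := h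
  exact (isCompact_closedBall _ _).image_of_continuousOn hc

theorem IsDisk.exists_notMem {E : Set Sphere2} (h : IsDisk E) : ∃ p, p ∉ E := by
  obtain ⟨e, hc, hi, rfl⟩ := h
  by_contra! hu
  have hu' : e '' closedBall 0 1 = univ := eq_univ_of_forall hu
  have hg := continuousOn_invFunOn_of_isCompact (isCompact_closedBall (0 : ℂ) 1) hc hi
  rw [hu', continuousOn_univ] at hg
  refine not_continuous_injective_sphere _ hg fun x y hxy => ?_
  rw [← Function.invFunOn_eq (hu x), ← Function.invFunOn_eq (hu y), hxy]

theorem IsDisk.exists_param {E : Set Sphere2} (h : IsDisk E) :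
    ∃ e : ℂ → Sphere2, ContinuousOn e (closedBall 0 1) ∧ InjOn e (closedBall 0 1) ∧
      e '' closedBall 0 1 = E ∧ e '' ball 0 1 = interior E ∧ e '' sphere 0 1 = frontier E ∧
      ∀ p ∉ E, IsJordanCurve (chart p '' frontier E) ∧
        chart p '' interior E = inside (chart p '' frontier E) ∧
        chart p '' E = fill (chart p '' frontier E) := by
  have hcpt := h.isCompact
  have h' := h
  obtain ⟨e, hc, hi, he⟩ := h
  have key : ∀ p ∉ E, IsJordanCurve (chart p '' (e '' sphere 0 1)) ∧
        chart p '' (e '' ball 0 1) = inside (chart p '' (e '' sphere 0 1)) ∧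
        chart p '' E = fill (chart p '' (e '' sphere 0 1)) := by
    intro p hp
    have := image_ball_eq_inside (f := fun z => chart p (e z))
      ((continuousOn_chart_of_notMem hp).comp hc (he ▸ mapsTo_image _ _))
      ((injOn_chart_of_notMem hp).comp hi (he ▸ mapsTo_image _ _))
    rw [← he]
    simpa only [image_image] using this
  obtain ⟨p, hp⟩ := h'.exists_notMem
  obtain ⟨hJ, hin, hfill⟩ := key p hp
  have hbE : e '' ball 0 1 ⊆ E := he ▸ image_mono ball_subset_closedBall
  have hsE : e '' sphere 0 1 ⊆ E := he ▸ image_mono sphere_subset_closedBall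
  have hopen : IsOpen (e '' ball 0 1) := by
    rw [← unchart_image_chart_image fun h => hp (hbE h), hin]
    exact isOpen_unchart_image p (isOpen_inside hJ.isCompact.isClosed)
  have hinter : e '' ball 0 1 = interior E := by
    refine (interior_maximal hbE hopen).antisymm fun x hx => ?_
    have hxE := interior_subset hx
    rw [← he] at hxE
    obtain ⟨z, hz, rfl⟩ := hxE
    rw [← ball_union_sphere] at hz
    rcases hz with hz | hz
    · exact mem_image_of_mem _ hz
    · exfalso
      have hcl := hJ.subset_closure.2 (mem_image_of_mem (chart p) (mem_image_of_mem e hz))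
      have hne : e z ≠ p := fun h => hp (h ▸ interior_subset hx)
      have hN : unchart p ⁻¹' interior E ∈ 𝓝 (chart p (e z)) :=
        (isOpen_interior.preimage (continuous_unchart p)).mem_nhds
          (by rw [mem_preimage, unchart_chart hne]; exact hx)
      obtain ⟨w, hw, hwo⟩ := mem_closure_iff_nhds.1 hcl _ hN
      have : w ∈ chart p '' E := ⟨_, interior_subset hw, chart_unchart p w⟩
      rw [hfill, fill_eq_compl_outside] at this
      exact this hwo
  have hfr : e '' sphere 0 1 = frontier E := by
    rw [hcpt.isClosed.frontier_eq, ← hinter, ← he, ← hi.image_sdiff_subset ball_subset_closedBall,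
      closedBall_sdiff_ball]
  refine ⟨e, hc, hi, he, hinter, hfr, ?_⟩
  rw [← hinter, ← hfr]
  exact key

theorem IsDisk.closure_interior {E : Set Sphere2} (h : IsDisk E) : closure (interior E) = E := by
  obtain ⟨e, hc, hi, he, hinter, -, -⟩ := h.exists_param
  refine h.isCompact.isClosed.closure_interior_subset.antisymm ?_
  rw [← hinter, ← he]
  rw [← closure_ball (0 : ℂ) one_ne_zero] at hc ⊢
  exact hc.image_closure

theorem IsDisk.isConnected_interior {E : Set Sphere2} (h : IsDisk E) :
    IsConnected (interior E) := by
  obtain ⟨e, hc, hi, he, hinter, -, -⟩ := h.exists_param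
  rw [← hinter]
  exact ((convex_ball 0 1).isConnected ⟨0, by simp⟩).image _ (hc.mono ball_subset_closedBall)

theorem IsDisk.frontier_eq {E : Set Sphere2} (h : IsDisk E) : frontier E = E \ interior E :=
  h.isCompact.isClosed.frontier_eq

theorem IsDisk.frontier_subset {E : Set Sphere2} (h : IsDisk E) : frontier E ⊆ E :=
  h.frontier_eq ▸ sdiff_subset

theorem IsDisk.interior_union_frontier {E : Set Sphere2} (h : IsDisk E) :
    interior E ∪ frontier E = E := by
  rw [h.frontier_eq, union_sdiff_cancel interior_subset]

theorem IsDisk.isJordanCurve_frontier {E : Set Sphere2} (h : IsDisk E) :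
    IsJordanCurve (frontier E) := by
  obtain ⟨p, hp⟩ := h.exists_notMem
  obtain ⟨e, -, -, -, -, -, hch⟩ := h.exists_param
  have := (hch p hp).1.image (continuous_unchart p).continuousOn (injective_unchart p).injOn
  rwa [unchart_image_chart_image fun h' => hp (h.frontier_subset h')] at this

theorem IsDisk.nonempty_homeomorph_frontier {E : Set Sphere2} (h : IsDisk E) :
    Nonempty (frontier E ≃ₜ UnitCircle) := by
  obtain ⟨e, hc, hi, he, hinter, hfr, -⟩ := h.exists_param
  let r := Complex.orthonormalBasisOneI.repr
  have hr : ∀ z : UnitCircle, r.symm z ∈ sphere (0 : ℂ) 1 := fun z => by simp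
  let g : UnitCircle → frontier E := fun z => ⟨e (r.symm z), hfr ▸ mem_image_of_mem e (hr z)⟩
  have hgc : Continuous g := by
    refine Continuous.subtype_mk ((hc.mono sphere_subset_closedBall).comp_continuous ?_ hr) _
    exact r.symm.continuous.comp continuous_subtype_val
  have hgb : Function.Bijective g := by
    constructor
    · intro a b hab
      have := hi (sphere_subset_closedBall (hr a)) (sphere_subset_closedBall (hr b))
        (congrArg Subtype.val hab)
      exact Subtype.ext (by simpa using this)
    · rintro ⟨x, hx⟩
      rw [← hfr] at hx
      obtain ⟨z, hz, rfl⟩ := hx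
      exact ⟨⟨r z, by simpa using hz⟩, Subtype.ext (by simp [g])⟩
  have : CompactSpace UnitCircle := isCompact_iff_compactSpace.1 (isCompact_sphere _ _)
  exact ⟨(Continuous.homeoOfEquivCompactToT2 (f := Equiv.ofBijective g hgb) hgc).symm⟩

/-! ### Null families of closed sets -/

theorem tendsto_diam_image {A B : Type*} [PseudoMetricSpace A] [PseudoMetricSpace B] {g : A → B}
    {L : Set A} (hL : IsCompact L) (hg : ContinuousOn g L) {E : ℕ → Set A} (hE : ∀ n, E n ⊆ L)
    (hd : Tendsto (fun n => diam (E n)) atTop (𝓝 0)) :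
    Tendsto (fun n => diam (g '' E n)) atTop (𝓝 0) := by
  have hu := hL.uniformContinuousOn_of_continuous hg
  rw [Metric.tendsto_atTop]
  intro ε hε
  obtain ⟨δ, hδ, h⟩ := Metric.uniformContinuousOn_iff.1 hu (ε / 2) (half_pos hε)
  obtain ⟨N, hN⟩ := Metric.tendsto_atTop.1 hd δ hδ
  refine ⟨N, fun n hn => ?_⟩
  have h1 := hN n hn
  rw [Real.dist_0_eq_abs, abs_of_nonneg diam_nonneg] at h1 ⊢
  refine lt_of_le_of_lt (diam_le_of_forall_dist_le (half_pos hε).le ?_) (half_lt_self hε)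
  rintro _ ⟨x, hx, rfl⟩ _ ⟨y, hy, rfl⟩
  exact (h x (hE n hx) y (hE n hy)
    ((dist_le_diam_of_mem (hL.isBounded.subset (hE n)) hx hy).trans_lt h1)).le

/-- Removing the interiors of a null family of disjoint closed sets with connected boundaries
preserves connectedness. -/
theorem IsPreconnected.diff_iUnion_interior {Y : Type*} [MetricSpace Y] [CompactSpace Y]
    {O : Set Y} (hO : IsOpen O) (hc : IsPreconnected O) {E : ℕ → Set Y}
    (hcl : ∀ n, IsClosed (E n)) (hsub : ∀ n, E n ⊆ O)
    (hdisj : Pairwise fun i j => Disjoint (E i) (E j))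
    (hd : Tendsto (fun n => diam (E n)) atTop (𝓝 0))
    (hfr : ∀ n, (E n).Nonempty → IsConnected (frontier (E n))) :
    IsPreconnected (O \ ⋃ n, interior (E n)) := by
  set W := O \ ⋃ n, interior (E n) with hW
  have hfrE : ∀ n, frontier (E n) ⊆ E n := fun n => (hcl n).frontier_subset
  have hfrW : ∀ n, frontier (E n) ⊆ W := by
    intro n x hx
    refine ⟨hsub n (hfrE n hx), fun h => ?_⟩
    obtain ⟨m, hm⟩ := mem_iUnion.1 h
    rw [(hcl n).frontier_eq] at hx
    rcases eq_or_ne m n with rfl | hmn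
    · exact hx.2 hm
    · exact disjoint_left.1 (hdisj hmn) (interior_subset hm) hx.1
  have hWE : ∀ n, ∀ x ∈ W, x ∈ E n → x ∈ frontier (E n) := fun n x hx hxE => by
    rw [(hcl n).frontier_eq]
    exact ⟨hxE, fun h => hx.2 (mem_iUnion.2 ⟨n, h⟩)⟩
  intro u v hu hv huv hWu hWv
  by_contra hne
  rw [not_nonempty_iff_eq_empty] at hne
  have hside : ∀ n, frontier (E n) ⊆ u ∨ frontier (E n) ⊆ v := fun n => by
    rcases (E n).eq_empty_or_nonempty with h | h
    · simp [h]
    · refine isPreconnected_iff_subset_of_disjoint.1 (hfr n h).isPreconnected u v hu hv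
        ((hfrW n).trans huv) (subset_empty_iff.1 (hne ▸ inter_subset_inter_left _ (hfrW n)))
  have hnot : ∀ x ∈ W, x ∈ u → x ∈ v → False := fun x hx h1 h2 =>
    notMem_empty x (hne ▸ ⟨hx, h1, h2⟩)
  have hopen : ∀ u v : Set Y, IsOpen u → (∀ n, frontier (E n) ⊆ u ∨ frontier (E n) ⊆ v) →
      (∀ x ∈ W, x ∈ u → x ∈ v → False) →
      IsOpen ((W ∩ u) ∪ ⋃ n, ⋃ (_ : frontier (E n) ⊆ u), E n) := by
    clear! u v
    intro u v hu hside hnot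
    rw [isOpen_iff_mem_nhds]
    have hbd : ∀ n x, x ∈ interior (E n) → frontier (E n) ⊆ u →
        (W ∩ u) ∪ (⋃ n, ⋃ (_ : frontier (E n) ⊆ u), E n) ∈ 𝓝 x := fun n x hx hn =>
      mem_of_superset (isOpen_interior.mem_nhds hx) fun y hy =>
        Or.inr (mem_iUnion₂.2 ⟨n, hn, interior_subset hy⟩)
    have hWu : ∀ x ∈ W, x ∈ u →
        (W ∩ u) ∪ (⋃ n, ⋃ (_ : frontier (E n) ⊆ u), E n) ∈ 𝓝 x := by
      intro x hxW hxu
      obtain ⟨r, hr, hball⟩ := Metric.mem_nhds_iff.1 ((hu.inter hO).mem_nhds ⟨hxu, hxW.1⟩)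
      obtain ⟨N, hN⟩ := Metric.tendsto_atTop.1 hd (r / 2) (half_pos hr)
      have hfin : (⋂ n ∈ {n | n < N ∧ x ∉ E n}, (E n)ᶜ) ∈ 𝓝 x :=
        (biInter_mem ((finite_lt_nat N).subset fun n hn => hn.1)).2 fun n hn =>
          (hcl n).isOpen_compl.mem_nhds hn.2
      filter_upwards [hfin, ball_mem_nhds x (half_pos hr)] with y hy hyb
      have hyr := hball (ball_subset_ball (half_le_self hr.le) hyb)
      by_cases hyW : y ∈ W
      · exact Or.inl ⟨hyW, hyr.1⟩
      have hyn : y ∈ ⋃ n, interior (E n) := by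
        by_contra h; exact hyW ⟨hyr.2, h⟩
      obtain ⟨n, hn⟩ := mem_iUnion.1 hyn
      refine Or.inr (mem_iUnion₂.2 ⟨n, ?_, interior_subset hn⟩)
      by_cases hxn : x ∈ E n
      · exact (hside n).resolve_right fun h => hnot x hxW hxu (h (hWE n x hxW hxn))
      · have hnN : N ≤ n := by
          by_contra h
          exact mem_iInter₂.1 hy n ⟨not_le.1 h, hxn⟩ (interior_subset hn)
        have h1 := hN n hnN
        rw [Real.dist_0_eq_abs, abs_of_nonneg diam_nonneg] at h1
        intro z hz
        refine (hball ?_).1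
        have h2 := dist_le_diam_of_mem (hcl n).isCompact.isBounded (hfrE n hz) (interior_subset hn)
        have h3 := dist_triangle z y x
        rw [mem_ball] at hyb ⊢
        linarith
    rintro x (⟨hxW, hxu⟩ | hx)
    · exact hWu x hxW hxu
    · obtain ⟨n, hn, hx⟩ := mem_iUnion₂.1 hx
      by_cases hxi : x ∈ interior (E n)
      · exact hbd n x hxi hn
      · have : x ∈ frontier (E n) := by rw [(hcl n).frontier_eq]; exact ⟨hx, hxi⟩
        exact hWu x (hfrW n this) (hn this)
  have hOu := hopen u v hu hside hnot
  have hOv := hopen v u hv (fun n => (hside n).symm) fun x hx h1 h2 => hnot x hx h2 h1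
  obtain ⟨x, hxO, hxu, hxv⟩ := hc _ _ hOu hOv (fun x hx => by
    by_cases hxW : x ∈ W
    · exact (huv hxW).imp (fun h => Or.inl ⟨hxW, h⟩) (fun h => Or.inl ⟨hxW, h⟩)
    · have hyn : x ∈ ⋃ n, interior (E n) := by
        by_contra h; exact hxW ⟨hx, h⟩
      obtain ⟨n, hn⟩ := mem_iUnion.1 hyn
      exact (hside n).imp (fun h => Or.inr (mem_iUnion₂.2 ⟨n, h, interior_subset hn⟩))
        (fun h => Or.inr (mem_iUnion₂.2 ⟨n, h, interior_subset hn⟩)))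
    (hWu.imp fun x hx => ⟨hx.1.1, Or.inl hx⟩) (hWv.imp fun x hx => ⟨hx.1.1, Or.inl hx⟩)
  rcases hxu with ⟨h1, h2⟩ | h1
  · rcases hxv with ⟨-, h4⟩ | h3
    · exact hnot x h1 h2 h4
    · obtain ⟨n, hn, hx⟩ := mem_iUnion₂.1 h3
      exact hnot x h1 h2 (hn (hWE n x h1 hx))
  · obtain ⟨n, hn, hx⟩ := mem_iUnion₂.1 h1
    rcases hxv with ⟨h3, h4⟩ | h3
    · exact hnot x h3 (hn (hWE n x h3 hx)) h4
    · obtain ⟨m, hm, hx'⟩ := mem_iUnion₂.1 h3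
      have : m = n := by
        by_contra h; exact disjoint_left.1 (hdisj h) hx' hx
      subst this
      obtain ⟨z, hz⟩ := (hfr m ⟨x, hx⟩).nonempty
      exact hnot z (hfrW m hz) (hn hz) (hm hz)

/-! ### Families of discs -/

/-- A null family of disjoint discs in the sphere. -/
structure IsDiskFamily (E : ℕ → Set Sphere2) : Prop where
  disk : ∀ n, IsDisk (E n)
  disjoint : Pairwise fun i j => Disjoint (E i) (E j)
  diam : Tendsto (fun n => diam (E n)) atTop (𝓝 0)

/-- The complement of the interiors of a family of discs. -/
def carpet (E : ℕ → Set Sphere2) : Set Sphere2 := (⋃ n, interior (E n))ᶜ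

theorem isCompact_carpet (E : ℕ → Set Sphere2) : IsCompact (carpet E) :=
  (isOpen_iUnion fun _ => isOpen_interior).isClosed_compl.isCompact

theorem IsSierpinskiFamily.exists_isDiskFamily {D : ℕ → Set Sphere2} (h : IsSierpinskiFamily D) :
    ∃ E, IsDiskFamily E ∧ Dense (⋃ n, E n) ∧ ∀ n, D n = interior (E n) := by
  obtain ⟨h1, h2, h3, h4⟩ := h
  choose E hE hD using h1
  have hc : ∀ n, closure (D n) = E n := fun n => by
    rw [hD, (hE n).isDisk.closure_interior]
  simp only [hc] at h2 h4
  refine ⟨E, ⟨fun n => (hE n).isDisk, h2, ?_⟩, h4, hD⟩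
  simpa only [← hc, Metric.diam_closure] using h3

theorem not_isOpen_singleton_sphere (p : Sphere2) : ¬ IsOpen ({p} : Set Sphere2) := fun h => by
  have h1 : IsCompact ({p}ᶜ : Set Sphere2) := h.isClosed_compl.isCompact
  have h2 := h1.image_of_continuousOn (continuousOn_chart p)
  have h3 : chart p '' {p}ᶜ = univ := eq_univ_of_forall fun z => ⟨_, unchart_ne p z, chart_unchart p z⟩
  exact noncompact_univ ℂ (h3 ▸ h2)

theorem IsDisk.isConnected_compl {E : Set Sphere2} (h : IsDisk E) : IsConnected Eᶜ := by
  obtain ⟨p, hp⟩ := h.exists_notMem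
  obtain ⟨e, -, -, -, -, -, hch⟩ := h.exists_param
  obtain ⟨hJ, -, hfill⟩ := hch p hp
  refine ⟨⟨p, hp⟩, ?_⟩
  set O := unchart p '' outside (chart p '' frontier E)
  have hO : O = Eᶜ \ {p} := by
    have : outside (chart p '' frontier E) = (chart p '' E)ᶜ := by
      rw [hfill, fill_eq_compl_outside, compl_compl]
    ext x
    constructor
    · rintro ⟨z, hz, rfl⟩
      rw [this] at hz
      exact ⟨fun h => hz ⟨_, h, chart_unchart p z⟩, unchart_ne p z⟩
    · rintro ⟨hx, hxp⟩
      refine ⟨chart p x, ?_, unchart_chart hxp⟩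
      rw [this]
      rintro ⟨y, hy, hxy⟩
      have := injOn_chart p (fun e => hp (e ▸ hy)) hxp hxy
      exact hx (this ▸ hy)
  have hc : IsPreconnected O := (isPathConnected_outside hJ.isCompact.isBounded).isConnected.isPreconnected.image _
    (continuous_unchart p).continuousOn
  refine hc.subset_closure (hO ▸ sdiff_subset) fun x hx => ?_
  rw [hO]
  by_cases hxp : x = p
  · subst hxp
    rw [_root_.mem_closure_iff]
    intro V hV hxV
    by_contra hne
    refine not_isOpen_singleton_sphere x ?_
    have : V ∩ Eᶜ = {x} := by
      refine Subset.antisymm (fun y hy => ?_) (by rintro y rfl; exact ⟨hxV, hx⟩)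
      by_contra hyx
      exact hne ⟨y, hy.1, hy.2, hyx⟩
    exact this ▸ hV.inter h.isCompact.isClosed.isOpen_compl
  · exact subset_closure ⟨hx, hxp⟩

theorem IsDiskFamily.frontier_subset_carpet {E : ℕ → Set Sphere2} (h : IsDiskFamily E) (j : ℕ) :
    frontier (E j) ⊆ carpet E := by
  intro x hx hx'
  obtain ⟨m, hm⟩ := mem_iUnion.1 hx'
  rw [(h.disk j).frontier_eq] at hx
  rcases eq_or_ne m j with rfl | hmj
  · exact hx.2 hm
  · exact disjoint_left.1 (h.disjoint hmj) (interior_subset hm) hx.1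

theorem IsDiskFamily.isConnected_carpet_diff {E : ℕ → Set Sphere2} (h : IsDiskFamily E) (j : ℕ) :
    IsConnected (carpet E \ frontier (E j)) := by
  classical
  constructor
  · obtain ⟨x, hx⟩ := (h.disk (j + 1)).isJordanCurve_frontier.isConnected.nonempty
    refine ⟨x, h.frontier_subset_carpet _ hx, fun hx' => ?_⟩
    exact disjoint_left.1 (h.disjoint (Nat.succ_ne_self j)) ((h.disk _).frontier_subset hx)
      ((h.disk _).frontier_subset hx')
  · have := IsPreconnected.diff_iUnion_interior (O := (E j)ᶜ)
      (h.disk j).isCompact.isClosed.isOpen_compl (h.disk j).isConnected_compl.isPreconnected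
      (E := fun n => if n = j then ∅ else E n) ?_ ?_ ?_ ?_ ?_
    · convert! this using 1
      ext x
      simp only [carpet, Set.mem_sdiff, mem_compl_iff, mem_iUnion, not_exists,
        (h.disk j).frontier_eq]
      constructor
      · rintro ⟨h1, h2⟩
        refine ⟨fun h => h2 ⟨h, h1 j⟩, fun n hn => ?_⟩
        split_ifs at hn
        · simp at hn
        · exact h1 n hn
      · rintro ⟨h1, h2⟩
        refine ⟨fun n hn => ?_, fun h => h1 h.1⟩
        by_cases hnj : n = j
        · subst hnj; exact h1 (interior_subset hn)
        · have := h2 n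
          rw [if_neg hnj] at this
          exact this hn
    · intro n
      split_ifs
      · exact isClosed_empty
      · exact (h.disk n).isCompact.isClosed
    · intro n
      split_ifs with hn
      · exact empty_subset _
      · exact (h.disjoint hn).subset_compl_right
    · intro i k hik
      split_ifs <;> simp [h.disjoint hik]
    · refine squeeze_zero (fun n => diam_nonneg) (fun n => ?_) h.diam
      split_ifs
      · rw [diam_empty]; exact diam_nonneg
      · exact le_rfl
    · intro n
      split_ifs
      · simp
      · exact fun _ => (h.disk n).isJordanCurve_frontier.isConnected

/-! ### Regions bounded by curves in the sphere -/

/-- The part of the sphere which `γ` separates from `p`. -/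
def region (p : Sphere2) (γ : Set Sphere2) : Set Sphere2 := unchart p '' inside (chart p '' γ)

section Region

variable {p : Sphere2} {γ : Set Sphere2}

theorem union_region_eq (h : p ∉ γ) : γ ∪ region p γ = unchart p '' fill (chart p '' γ) := by
  rw [fill, image_union, unchart_image_chart_image h, region]

theorem notMem_region : p ∉ region p γ := by
  rintro ⟨z, -, h⟩; exact unchart_ne p z h

theorem isCompact_chart_image (hγ : IsCompact γ) (h : p ∉ γ) : IsCompact (chart p '' γ) :=
  hγ.image_of_continuousOn (continuousOn_chart_of_notMem h)

theorem isOpen_region (hγ : IsCompact γ) (h : p ∉ γ) : IsOpen (region p γ) :=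
  isOpen_unchart_image p (isOpen_inside (isCompact_chart_image hγ h).isClosed)

theorem isCompact_union_region (hγ : IsCompact γ) (h : p ∉ γ) : IsCompact (γ ∪ region p γ) := by
  rw [union_region_eq h]
  exact (isCompact_fill (isCompact_chart_image hγ h)).image (continuous_unchart p)

theorem disjoint_region (h : p ∉ γ) : Disjoint γ (region p γ) := by
  rw [← unchart_image_chart_image h, region, chart_image_unchart_image]
  exact (disjoint_image_iff (injective_unchart p)).2 (disjoint_inside_self _).symm

theorem IsPreconnected.subset_region_or {S : Set Sphere2} (hS : IsPreconnected S)
    (hγ : IsCompact γ) (h : p ∉ γ) (hd : Disjoint S γ) :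
    S ⊆ region p γ ∨ Disjoint S (γ ∪ region p γ) := by
  have h1 := hS.subset_or_subset (isOpen_region hγ h)
    (isCompact_union_region hγ h).isClosed.isOpen_compl
    (disjoint_compl_right.mono_left subset_union_right) (fun x hx => ?_)
  · exact h1.imp_right fun h => disjoint_left.2 h
  · by_cases hx' : x ∈ region p γ
    · exact Or.inl hx'
    · exact Or.inr fun h => h.elim (disjoint_left.1 hd hx) hx'

theorem isJordanCurve_chart_image (hγ : IsJordanCurve γ) (h : p ∉ γ) :
    IsJordanCurve (chart p '' γ) :=
  hγ.image (continuousOn_chart_of_notMem h) (injOn_chart_of_notMem h)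

theorem isConnected_region (hγ : IsJordanCurve γ) (h : p ∉ γ) : IsConnected (region p γ) :=
  (isJordanCurve_chart_image hγ h).isPathConnected_inside.isConnected.image _
    (continuous_unchart p).continuousOn

theorem subset_closure_region (hγ : IsJordanCurve γ) (h : p ∉ γ) : γ ⊆ closure (region p γ) := by
  have := (isJordanCurve_chart_image hγ h).subset_closure.1
  rw [← unchart_image_chart_image h]
  refine (image_mono this).trans ?_
  rw [region, chart_image_unchart_image]
  exact image_closure_subset_closure_image (continuous_unchart p)

end Region

/-- The side of a small curve in the sphere which misses two given points is small. -/
theorem exists_diam_region_le {ε : ℝ} (hε : 0 < ε) {a b : Sphere2} (hab : ε ≤ dist a b) :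
    ∃ δ > 0, ∀ (p : Sphere2) (γ : Set Sphere2), IsCompact γ → γ.Nonempty → p ∉ γ →
      diam γ < δ → a ∉ region p γ → b ∉ region p γ → diam (γ ∪ region p γ) ≤ ε := by
  have hN : ∀ x : Sphere2, ∃ R : ℝ, (unchart x '' closedBall 0 R)ᶜ ⊆ ball x (ε / 2) := by
    intro x
    have h1 : IsCompact (ball x (ε / 2))ᶜ := isOpen_ball.isClosed_compl.isCompact
    have hx : x ∉ (ball x (ε / 2))ᶜ := fun h => h (mem_ball_self (half_pos hε))
    obtain ⟨R, hR⟩ := (isCompact_chart_image h1 hx).isBounded.subset_closedBall 0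
    refine ⟨R, fun y hy => ?_⟩
    by_contra hyb
    exact hy ⟨chart x y, hR ⟨y, hyb, rfl⟩, unchart_chart fun e => hx (e ▸ hyb)⟩
  choose R hR using hN
  have hL : ∀ x, IsCompact (unchart x '' closedBall 0 (R x)) := fun x =>
    (isCompact_closedBall _ _).image (continuous_unchart x)
  obtain ⟨δ, hδ, hleb⟩ := lebesgue_number_lemma_of_metric (isCompact_univ (X := Sphere2))
    (c := fun x => (unchart x '' closedBall 0 (R x))ᶜ)
    (fun x => (hL x).isClosed.isOpen_compl)
    (fun x _ => mem_iUnion.2 ⟨x, by rintro ⟨z, -, h⟩; exact unchart_ne x z h⟩)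
  refine ⟨δ, hδ, fun p γ hγ hne hp hd ha hb => ?_⟩
  obtain ⟨y, hy⟩ := hne
  obtain ⟨x, hx⟩ := hleb y trivial
  have hγN : γ ⊆ (unchart x '' closedBall 0 (R x))ᶜ := fun z hz =>
    hx ((dist_le_diam_of_mem hγ.isBounded hz hy).trans_lt hd)
  have hpre : IsPreconnected (unchart x '' closedBall 0 (R x)) :=
    (convex_closedBall _ _).isPreconnected.image _ (continuous_unchart x).continuousOn
  rcases hpre.subset_region_or hγ hp (disjoint_left.2 fun z hz hz' => hγN hz' hz) with h | h
  · have h1 := hR x fun h' => ha (h h')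
    have h2 := hR x fun h' => hb (h h')
    rw [mem_ball] at h1 h2
    have h3 := dist_triangle_right a b x
    linarith
  · refine diam_le_of_forall_dist_le hε.le fun z hz w hw => ?_
    have h1 := hR x fun h' => disjoint_left.1 h h' hz
    have h2 := hR x fun h' => disjoint_left.1 h h' hw
    rw [mem_ball] at h1 h2
    have h3 := dist_triangle_right z w x
    linarith

/-- The poles `P j` pick out the complementary regions of the boundary curves of an embedded
carpet. -/
structure IsRegions (E : ℕ → Set Sphere2) (f : Sphere2 → Sphere2) (P : ℕ → Sphere2) : Prop where
  pole : ∀ j, P j ∈ f '' (carpet E \ frontier (E j))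
  notMem : ∀ j, P j ∉ f '' frontier (E j)
  disjoint_carpet : ∀ j, Disjoint (f '' (carpet E \ frontier (E j)))
    (f '' frontier (E j) ∪ region (P j) (f '' frontier (E j)))
  disjoint : Pairwise fun i j => Disjoint
    (f '' frontier (E i) ∪ region (P i) (f '' frontier (E i)))
    (f '' frontier (E j) ∪ region (P j) (f '' frontier (E j)))
  diam : Tendsto (fun j => diam (f '' frontier (E j) ∪ region (P j) (f '' frontier (E j))))
    atTop (𝓝 0)

theorem IsDiskFamily.isJordanCurve_image {E : ℕ → Set Sphere2} (h : IsDiskFamily E)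
    {Y : Type*} [TopologicalSpace Y] [T2Space Y]
    {f : Sphere2 → Y} (hf : ContinuousOn f (carpet E)) (hi : InjOn f (carpet E)) (j : ℕ) :
    IsJordanCurve (f '' frontier (E j)) :=
  (h.disk j).isJordanCurve_frontier.image (hf.mono (h.frontier_subset_carpet j))
    (hi.mono (h.frontier_subset_carpet j))

theorem IsDiskFamily.exists_isRegions {E : ℕ → Set Sphere2} (h : IsDiskFamily E)
    {f : Sphere2 → Sphere2} (hf : ContinuousOn f (carpet E)) (hi : InjOn f (carpet E)) :
    ∃ P, IsRegions E f P := by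
  have hfr := h.frontier_subset_carpet
  have hP : ∀ j, ∃ p, p ∈ f '' (carpet E \ frontier (E j)) := fun j =>
    (h.isConnected_carpet_diff j).nonempty.image f
  choose P hP using hP
  have hJ := h.isJordanCurve_image hf hi
  have hd0 : ∀ j, Disjoint (f '' (carpet E \ frontier (E j))) (f '' frontier (E j)) := by
    intro j
    rw [disjoint_left]
    rintro _ ⟨x, hx, rfl⟩ ⟨y, hy, hxy⟩
    have := hi (hfr j hy) hx.1 hxy
    exact hx.2 (this ▸ hy)
  have hnot : ∀ j, P j ∉ f '' frontier (E j) := fun j => disjoint_left.1 (hd0 j) (hP j)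
  have hdc : ∀ j, Disjoint (f '' (carpet E \ frontier (E j)))
      (f '' frontier (E j) ∪ region (P j) (f '' frontier (E j))) := fun j => by
    have hpre : IsPreconnected (f '' (carpet E \ frontier (E j))) :=
      (h.isConnected_carpet_diff j).isPreconnected.image _ (hf.mono sdiff_subset)
    exact (hpre.subset_region_or (hJ j).isCompact (hnot j) (hd0 j)).resolve_left
      fun h' => notMem_region (h' (hP j))
  have hfrd : ∀ i j, i ≠ j → frontier (E i) ⊆ carpet E \ frontier (E j) := fun i j hij x hx =>
    ⟨hfr i hx, fun hx' => disjoint_left.1 (h.disjoint hij) ((h.disk i).frontier_subset hx)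
      ((h.disk j).frontier_subset hx')⟩
  have hγ : ∀ i j, i ≠ j → Disjoint (f '' frontier (E i))
      (f '' frontier (E j) ∪ region (P j) (f '' frontier (E j))) := fun i j hij =>
    (hdc j).mono_left (image_mono (hfrd i j hij))
  refine ⟨P, hP, hnot, hdc, fun i j hij => ?_, ?_⟩
  · refine disjoint_union_left.2 ⟨hγ i j hij, ?_⟩
    rcases (isConnected_region (hJ i) (hnot i)).isPreconnected.subset_region_or (hJ j).isCompact
      (hnot j) (((hγ j i hij.symm).mono_right subset_union_right).symm) with h1 | h1
    · exfalso
      obtain ⟨x, hx⟩ := (hJ i).isConnected.nonempty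
      have h2 := closure_mono h1 (subset_closure_region (hJ i) (hnot i) hx)
      have h3 := closure_minimal subset_union_right
        (isCompact_union_region (hJ j).isCompact (hnot j)).isClosed h2
      exact disjoint_left.1 (hγ i j hij) hx h3
    · exact h1
  · obtain ⟨a, ha, b, hb, hab⟩ : ∃ a ∈ carpet E, ∃ b ∈ carpet E, f a ≠ f b := by
      obtain ⟨x, hx⟩ := (h.disk 0).isJordanCurve_frontier.isConnected.nonempty
      obtain ⟨y, hy⟩ := (h.disk 1).isJordanCurve_frontier.isConnected.nonempty
      refine ⟨x, hfr 0 hx, y, hfr 1 hy, fun e => ?_⟩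
      have := hi (hfr 0 hx) (hfr 1 hy) e
      subst this
      exact (hfrd 0 1 zero_ne_one hx).2 hy
    have hcr : ∀ j, ∀ c ∈ carpet E, f c ∉ region (P j) (f '' frontier (E j)) := by
      intro j c hc hc'
      by_cases hcj : c ∈ frontier (E j)
      · exact disjoint_left.1 (disjoint_region (hnot j)) ⟨c, hcj, rfl⟩ hc'
      · exact disjoint_left.1 (hdc j) ⟨c, ⟨hc, hcj⟩, rfl⟩ (Or.inr hc')
    have hd1 : Tendsto (fun j => Metric.diam (f '' frontier (E j))) atTop (𝓝 0) :=
      tendsto_diam_image (isCompact_carpet E) hf hfr (squeeze_zero (fun n => diam_nonneg)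
        (fun n => diam_mono (h.disk n).frontier_subset (h.disk n).isCompact.isBounded) h.diam)
    rw [Metric.tendsto_atTop]
    intro ε hε
    have hε' : 0 < min (ε / 2) (dist (f a) (f b)) := lt_min (half_pos hε) (dist_pos.2 hab)
    obtain ⟨δ, hδ, hreg⟩ := exists_diam_region_le hε' (min_le_right (ε / 2) (dist (f a) (f b)))
    obtain ⟨N, hN⟩ := Metric.tendsto_atTop.1 hd1 δ hδ
    refine ⟨N, fun n hn => ?_⟩
    have h1 := hN n hn
    rw [Real.dist_0_eq_abs, abs_of_nonneg diam_nonneg] at h1 ⊢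
    have h2 := hreg (P n) _ (hJ n).isCompact (hJ n).isConnected.nonempty (hnot n) h1
      (hcr n a ha) (hcr n b hb)
    have h3 := min_le_left (ε / 2) (dist (f a) (f b))
    linarith

/-! ### Matching regions of the sphere with holes -/

/-- A null family of disjoint sets, each of them empty or a disc. -/
structure IsHoleFamily (H : ℕ → Set Sphere2) : Prop where
  disk : ∀ n, H n = ∅ ∨ IsDisk (H n)
  disjoint : Pairwise fun i j => Disjoint (H i) (H j)
  diam : Tendsto (fun n => diam (H n)) atTop (𝓝 0)

theorem IsDiskFamily.isHoleFamily {E : ℕ → Set Sphere2} (h : IsDiskFamily E) : IsHoleFamily E :=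
  ⟨fun n => Or.inr (h.disk n), h.disjoint, h.diam⟩

theorem isHoleFamily_empty : IsHoleFamily fun _ => ∅ :=
  ⟨fun _ => Or.inl rfl, fun _ _ _ => disjoint_bot_left, by simp⟩

theorem IsHoleFamily.exists_isHoles {H : ℕ → Set Sphere2} (hH : IsHoleFamily H) {p : Sphere2}
    {γ : Set Sphere2} (hγ : IsCompact γ) (hp : p ∉ γ)
    (hsub : ∀ n, H n ⊆ region p γ ∨ Disjoint (H n) (γ ∪ region p γ)) :
    ∃ K, IsHoles K ∧ IsGood K (chart p '' γ) ∧ ((∃ n, (K n).Nonempty) → ∃ n, (H n).Nonempty) ∧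
      (Dense (⋃ n, H n) → inside (chart p '' γ) ⊆ closure (⋃ n, fill (K n))) ∧
      unchart p '' (fill (chart p '' γ) \ ⋃ n, inside (K n)) =
        (γ ∪ region p γ) \ ⋃ n, interior (H n) := by
  classical
  set A : ℕ → Set Sphere2 := fun n => if H n ⊆ region p γ then H n else ∅ with hA
  have hAH : ∀ n, A n ⊆ H n := fun n => by
    simp only [hA]; split_ifs
    · exact Subset.rfl
    · exact empty_subset _
  have hAr : ∀ n, A n ⊆ region p γ := fun n => by
    simp only [hA]; split_ifs with h
    · exact h
    · exact empty_subset _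
  have hAd : ∀ n, A n = ∅ ∨ IsDisk (A n) := fun n => by
    simp only [hA]; split_ifs
    · exact hH.disk n
    · exact Or.inl rfl
  have hpA : ∀ n, p ∉ A n := fun n h => notMem_region (hAr n h)
  have hpr : p ∉ γ ∪ region p γ := fun h => h.elim hp notMem_region
  have hAK : ∀ n, (chart p '' frontier (A n) = ∅ ∨ IsJordanCurve (chart p '' frontier (A n))) ∧
      fill (chart p '' frontier (A n)) = chart p '' A n ∧
      inside (chart p '' frontier (A n)) = chart p '' interior (A n) := fun n => by
    rcases hAd n with h | h
    · simp [h, fill_empty, inside_empty]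
    · obtain ⟨e, -, -, -, -, -, hch⟩ := h.exists_param
      obtain ⟨h1, h2, h3⟩ := hch p (hpA n)
      exact ⟨Or.inr h1, h3.symm, h2.symm⟩
  have hAc : ∀ n, IsCompact (A n) := fun n => by
    rcases hAd n with h | h
    · rw [h]; exact isCompact_empty
    · exact h.isCompact
  have hAin : ∀ n, chart p '' A n ⊆ inside (chart p '' γ) := fun n => by
    have := image_mono (f := chart p) (hAr n)
    rwa [region, chart_image_unchart_image] at this
  refine ⟨fun n => chart p '' frontier (A n), ⟨fun n => (hAK n).1, ?_⟩, fun n => Or.inl ?_, ?_, ?_, ?_⟩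
  · refine ⟨fun n => ?_, fun i j hij => ?_, ?_, fun n x y hx hy => ?_⟩
    · rw [(hAK n).2.1]; exact isCompact_chart_image (hAc n) (hpA n)
    · beta_reduce
      rw [(hAK i).2.1, (hAK j).2.1, disjoint_left]
      rintro _ ⟨x, hx, rfl⟩ ⟨y, hy, hxy⟩
      have := injOn_chart p (fun e => hpA j (e ▸ hy)) (fun e => hpA i (e ▸ hx)) hxy
      subst this
      exact disjoint_left.1 (hH.disjoint hij) (hAH i hx) (hAH j hy)
    · simp only [(hAK _).2.1]
      refine tendsto_diam_image (isCompact_union_region hγ hp) (continuousOn_chart_of_notMem hpr)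
        (fun n => (hAr n).trans subset_union_right) (squeeze_zero (fun n => diam_nonneg)
        (fun n => diam_mono (hAH n) ?_) hH.diam)
      exact isCompact_univ.isBounded.subset (subset_univ _)
    · rw [fill_eq_compl_outside, notMem_compl_iff] at hx hy
      have hb : Bornology.IsBounded (chart p '' frontier (A n)) := by
        refine (isCompact_chart_image (hAc n) (hpA n)).isBounded.subset (image_mono ?_)
        exact (hAc n).isClosed.frontier_subset
      have := (isPathConnected_outside hb).joinedIn x hx y hy
      rwa [fill_eq_compl_outside, compl_compl]
  · rw [(hAK n).2.1]; exact hAin n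
  · rintro ⟨n, hn⟩
    obtain ⟨x, hx⟩ := hn.of_image
    exact ⟨n, x, hAH n ((hAc n).isClosed.frontier_subset hx)⟩
  · intro hd z hz
    rw [_root_.mem_closure_iff]
    intro V hV hzV
    have hopen : IsOpen (unchart p '' (V ∩ inside (chart p '' γ))) :=
      isOpen_unchart_image p (hV.inter (isOpen_inside (isCompact_chart_image hγ hp).isClosed))
    obtain ⟨x, ⟨w, ⟨hwV, hwi⟩, rfl⟩, hx⟩ := hd.inter_open_nonempty _ hopen ⟨_, z, ⟨hzV, hz⟩, rfl⟩
    obtain ⟨n, hn⟩ := mem_iUnion.1 hx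
    refine ⟨w, hwV, mem_iUnion.2 ⟨n, ?_⟩⟩
    rw [(hAK n).2.1]
    refine ⟨unchart p w, ?_, chart_unchart p w⟩
    have hnr : H n ⊆ region p γ := (hsub n).resolve_right fun h =>
      disjoint_left.1 h hn (Or.inr ⟨w, hwi, rfl⟩)
    simp only [hA, if_pos hnr, hn]
  · rw [image_sdiff (injective_unchart p), ← union_region_eq hp, image_iUnion]
    ext x
    simp only [(hAK _).2.2]
    have hpi : ∀ n, p ∉ interior (A n) := fun n h => hpA n (interior_subset h)
    simp only [unchart_image_chart_image (hpi _), Set.mem_sdiff, mem_iUnion, not_exists]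
    refine and_congr_right fun hx => forall_congr' fun n => not_congr ?_
    simp only [hA]
    split_ifs with h
    · rfl
    · have := (hsub n).resolve_left h
      simp only [interior_empty, mem_empty_iff_false, false_iff]
      exact fun h' => disjoint_left.1 this (interior_subset h') hx

theorem exists_graph_region {Γ : Set (Sphere2 × Sphere2)} (hΓ : IsJordanCurve Γ)
    (hi : InjOn Prod.fst Γ) (hi' : InjOn Prod.snd Γ) {p p' : Sphere2} (hp : p ∉ Prod.fst '' Γ)
    (hp' : p' ∉ Prod.snd '' Γ) {H H' : ℕ → Set Sphere2} (hH : IsHoleFamily H)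
    (hH' : IsHoleFamily H')
    (hsub : ∀ n, H n ⊆ region p (Prod.fst '' Γ) ∨
      Disjoint (H n) (Prod.fst '' Γ ∪ region p (Prod.fst '' Γ)))
    (hsub' : ∀ n, H' n ⊆ region p' (Prod.snd '' Γ) ∨
      Disjoint (H' n) (Prod.snd '' Γ ∪ region p' (Prod.snd '' Γ)))
    (hd : (∃ n, (H' n).Nonempty) → Dense (⋃ n, H n))
    (hd' : (∃ n, (H n).Nonempty) → Dense (⋃ n, H' n)) :
    ∃ R : Set (Sphere2 × Sphere2), IsCompact R ∧ Γ ⊆ R ∧ InjOn Prod.fst R ∧ InjOn Prod.snd R ∧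
      Prod.fst '' R = (Prod.fst '' Γ ∪ region p (Prod.fst '' Γ)) \ ⋃ n, interior (H n) ∧
      Prod.snd '' R = (Prod.snd '' Γ ∪ region p' (Prod.snd '' Γ)) \ ⋃ n, interior (H' n) := by
  obtain ⟨K, hK, hg, hn, hdn, he⟩ :=
    hH.exists_isHoles (hΓ.isCompact.image continuous_fst) hp hsub
  obtain ⟨K', hK', hg', hn', hdn', he'⟩ :=
    hH'.exists_isHoles (hΓ.isCompact.image continuous_snd) hp' hsub'
  set g : Sphere2 × Sphere2 → ℂ × ℂ := Prod.map (chart p) (chart p') with hgdef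
  set u : ℂ × ℂ → Sphere2 × Sphere2 := Prod.map (unchart p) (unchart p') with hu
  have hug : ∀ x ∈ Γ, u (g x) = x := fun x hx => Prod.ext
    (unchart_chart fun e => hp ⟨x, hx, e⟩) (unchart_chart fun e => hp' ⟨x, hx, e⟩)
  have hui : Function.Injective u := (injective_unchart p).prodMap (injective_unchart p')
  have hf1 : Prod.fst '' (g '' Γ) = chart p '' (Prod.fst '' Γ) := by
    rw [image_image, image_image]; rfl
  have hf2 : Prod.snd '' (g '' Γ) = chart p' '' (Prod.snd '' Γ) := by
    rw [image_image, image_image]; rfl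
  have hu1 : ∀ R : Set (ℂ × ℂ), Prod.fst '' (u '' R) = unchart p '' (Prod.fst '' R) := fun R => by
    rw [image_image, image_image]; rfl
  have hu2 : ∀ R : Set (ℂ × ℂ), Prod.snd '' (u '' R) = unchart p' '' (Prod.snd '' R) := fun R => by
    rw [image_image, image_image]; rfl
  have hcell : IsCell Prod.fst Prod.snd K K' (g '' Γ) := by
    refine ⟨hΓ.image ?_ (LeftInvOn.injOn hug), ?_, ?_, hf1 ▸ hg, hf2 ▸ hg', ?_, ?_⟩
    · refine ContinuousOn.prodMk ?_ ?_
      · exact (continuousOn_chart_of_notMem hp).comp continuous_fst.continuousOn (mapsTo_image _ _)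
      · exact (continuousOn_chart_of_notMem hp').comp continuous_snd.continuousOn (mapsTo_image _ _)
    · rintro _ ⟨x, hx, rfl⟩ _ ⟨y, hy, rfl⟩ hxy
      rw [hi hx hy (injOn_chart_of_notMem hp ⟨x, hx, rfl⟩ ⟨y, hy, rfl⟩ hxy)]
    · rintro _ ⟨x, hx, rfl⟩ _ ⟨y, hy, rfl⟩ hxy
      rw [hi' hx hy (injOn_chart_of_notMem hp' ⟨x, hx, rfl⟩ ⟨y, hy, rfl⟩ hxy)]
    · exact fun h => hf1 ▸ hdn (hd (hn' h))
    · exact fun h => hf2 ▸ hdn' (hd' (hn h))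
  obtain ⟨R, h1, h2, h3, h4, h5, h6⟩ := hcell.exists_graph hK hK'
  refine ⟨u '' R, h1.image ((continuous_unchart p).prodMap (continuous_unchart p')), ?_, ?_, ?_,
    ?_, ?_⟩
  · exact fun x hx => ⟨g x, h2 ⟨x, hx, rfl⟩, hug x hx⟩
  · rintro _ ⟨x, hx, rfl⟩ _ ⟨y, hy, rfl⟩ hxy
    rw [h3 hx hy (injective_unchart p hxy)]
  · rintro _ ⟨x, hx, rfl⟩ _ ⟨y, hy, rfl⟩ hxy
    rw [h4 hx hy (injective_unchart p' hxy)]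
  · rw [hu1, h5, hf1, he]
  · rw [hu2, h6, hf2, he']

/-! ### Gluing graphs -/

theorem isCompact_union_iUnion_of_diam {Y : Type*} [MetricSpace Y] [CompactSpace Y]
    {G₀ : Set Y} {G : ℕ → Set Y} (h₀ : IsCompact G₀) (h : ∀ j, IsCompact (G j))
    (hne : ∀ j, (G₀ ∩ G j).Nonempty) (hd : Tendsto (fun j => diam (G j)) atTop (𝓝 0)) :
    IsCompact (G₀ ∪ ⋃ j, G j) := by
  refine IsClosed.isCompact ?_
  rw [← isOpen_compl_iff, Metric.isOpen_iff]
  intro x hx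
  have hx0 : x ∈ G₀ᶜ := fun h => hx (Or.inl h)
  obtain ⟨r, hr, hball⟩ := Metric.isOpen_iff.1 h₀.isClosed.isOpen_compl x hx0
  obtain ⟨N, hN⟩ := Metric.tendsto_atTop.1 hd (r / 2) (half_pos hr)
  have hfin : IsClosed (⋃ j ∈ {j | j < N}, G j) :=
    (finite_lt_nat N).isClosed_biUnion fun j _ => (h j).isClosed
  obtain ⟨s, hs, hball'⟩ := Metric.isOpen_iff.1 hfin.isOpen_compl x fun h => by
    obtain ⟨j, -, hj⟩ := mem_iUnion₂.1 h
    exact hx (Or.inr (mem_iUnion.2 ⟨j, hj⟩))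
  refine ⟨min (r / 2) s, lt_min (half_pos hr) hs, fun y hy hy' => ?_⟩
  rw [mem_ball, lt_min_iff] at hy
  rcases hy' with hy' | hy'
  · exact hball (mem_ball.2 (hy.1.trans (half_lt_self hr))) hy'
  · obtain ⟨j, hj⟩ := mem_iUnion.1 hy'
    rcases lt_or_ge j N with hjN | hjN
    · exact hball' (mem_ball.2 hy.2) (mem_iUnion₂.2 ⟨j, hjN, hj⟩)
    · have h1 := hN j hjN
      rw [Real.dist_0_eq_abs, abs_of_nonneg diam_nonneg] at h1
      obtain ⟨z, hz0, hz⟩ := hne j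
      have h2 := dist_le_diam_of_mem (h j).isBounded hz hj
      have h3 := dist_triangle z y x
      exact hball (mem_ball.2 (by linarith)) hz0

theorem injOn_union_iUnion {Y A : Type*} {π : Y → A} {G₀ : Set Y} {G Γ : ℕ → Set Y}
    (h₀ : InjOn π G₀) (h : ∀ j, InjOn π (G j)) (hΓ₀ : ∀ j, Γ j ⊆ G₀) (hΓ : ∀ j, Γ j ⊆ G j)
    (hinter : ∀ j, π '' G₀ ∩ π '' G j ⊆ π '' Γ j)
    (hdisj : Pairwise fun i j => Disjoint (π '' G i) (π '' G j)) :
    InjOn π (G₀ ∪ ⋃ j, G j) := by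
  have hmix : ∀ j, ∀ x ∈ G₀, ∀ y ∈ G j, π x = π y → x = y := fun j x hx y hy hxy => by
    obtain ⟨z, hz, hzx⟩ := hinter j ⟨⟨x, hx, rfl⟩, ⟨y, hy, hxy.symm⟩⟩
    rw [← h₀ (hΓ₀ j hz) hx hzx, ← h j (hΓ j hz) hy (hzx.trans hxy)]
  rintro x (hx | hx) y (hy | hy) hxy
  · exact h₀ hx hy hxy
  · obtain ⟨j, hj⟩ := mem_iUnion.1 hy
    exact hmix j x hx y hj hxy
  · obtain ⟨j, hj⟩ := mem_iUnion.1 hx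
    exact (hmix j y hy x hj hxy.symm).symm
  · obtain ⟨i, hi⟩ := mem_iUnion.1 hx
    obtain ⟨j, hj⟩ := mem_iUnion.1 hy
    rcases eq_or_ne i j with rfl | hij
    · exact h i hi hj hxy
    · exact (disjoint_left.1 (hdisj hij) ⟨x, hi, rfl⟩ ⟨y, hj, hxy.symm⟩).elim

theorem exists_homeomorph_of_graph {A B : Type*} [TopologicalSpace A] [TopologicalSpace B]
    [T2Space A] [T2Space B] {G : Set (A × B)} (hG : IsCompact G) (h1 : InjOn Prod.fst G)
    (h2 : InjOn Prod.snd G) :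
    ∃ h : Prod.fst '' G ≃ₜ Prod.snd '' G, ∀ x (hx : x ∈ G),
      (h ⟨x.1, x, hx, rfl⟩ : B) = x.2 := by
  have : CompactSpace G := isCompact_iff_compactSpace.1 hG
  let e₁ : G ≃ₜ Prod.fst '' G := Continuous.homeoOfEquivCompactToT2
    (f := Equiv.Set.imageOfInjOn _ _ h1)
    ((continuous_fst.comp continuous_subtype_val).subtype_mk _)
  let e₂ : G ≃ₜ Prod.snd '' G := Continuous.homeoOfEquivCompactToT2
    (f := Equiv.Set.imageOfInjOn _ _ h2)
    ((continuous_snd.comp continuous_subtype_val).subtype_mk _)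
  refine ⟨e₁.symm.trans e₂, fun x hx => ?_⟩
  have h3 : e₁ ⟨x, hx⟩ = ⟨x.1, x, hx, rfl⟩ := rfl
  rw [← h3, Homeomorph.trans_apply, Homeomorph.symm_apply_apply]
  rfl

theorem IsRegions.notMem_region {E : ℕ → Set Sphere2} {f : Sphere2 → Sphere2} {P : ℕ → Sphere2}
    (h : IsRegions E f P) {c : Sphere2} (hc : c ∈ carpet E) (j : ℕ) :
    f c ∉ region (P j) (f '' frontier (E j)) := fun hc' => by
  by_cases hcj : c ∈ frontier (E j)
  · exact disjoint_left.1 (disjoint_region (h.notMem j)) ⟨c, hcj, rfl⟩ hc'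
  · exact disjoint_left.1 (h.disjoint_carpet j) ⟨c, ⟨hc, hcj⟩, rfl⟩ (Or.inr hc')

theorem IsRegions.subset_or {E : ℕ → Set Sphere2} {f : Sphere2 → Sphere2} {P : ℕ → Sphere2}
    (h : IsRegions E f P) {A : Set Sphere2}
    (hA : A = ∅ ∨ ∃ j, A ⊆ region (P j) (f '' frontier (E j))) (j : ℕ) :
    A ⊆ region (P j) (f '' frontier (E j)) ∨
      Disjoint A (f '' frontier (E j) ∪ region (P j) (f '' frontier (E j))) := by
  rcases hA with rfl | ⟨k, hk⟩
  · exact Or.inl (empty_subset _)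
  · rcases eq_or_ne k j with rfl | hkj
    · exact Or.inl hk
    · exact Or.inr ((h.disjoint hkj).mono_left (hk.trans subset_union_right))

theorem IsRegions.inter_subset {E : ℕ → Set Sphere2} {f : Sphere2 → Sphere2} {P : ℕ → Sphere2}
    (h : IsRegions E f P) (j : ℕ) :
    f '' carpet E ∩ (f '' frontier (E j) ∪ region (P j) (f '' frontier (E j))) ⊆
      f '' frontier (E j) := by
  rintro _ ⟨⟨c, hc, rfl⟩, hc' | hc'⟩
  · exact hc'
  · exact (h.notMem_region hc j hc').elim

theorem IsRegions.union_diff_eq {E : ℕ → Set Sphere2} {f : Sphere2 → Sphere2} {P : ℕ → Sphere2}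
    (hE : IsDiskFamily E) (h : IsRegions E f P) {H : ℕ → Set Sphere2}
    (hsub : ∀ n, H n = ∅ ∨ ∃ j, H n ⊆ region (P j) (f '' frontier (E j))) :
    (f '' carpet E ∪ ⋃ j, (f '' frontier (E j) ∪ region (P j) (f '' frontier (E j))) \
      ⋃ n, interior (H n)) =
    (f '' carpet E ∪ ⋃ j, region (P j) (f '' frontier (E j))) \ ⋃ n, interior (H n) := by
  have hfc : ∀ x ∈ f '' carpet E, x ∉ ⋃ n, interior (H n) := by
    rintro _ ⟨c, hc, rfl⟩ hx
    obtain ⟨n, hn⟩ := mem_iUnion.1 hx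
    rcases hsub n with h0 | ⟨j, hj⟩
    · rw [h0, interior_empty] at hn; exact hn
    · exact h.notMem_region hc j (hj (interior_subset hn))
  ext x
  constructor
  · rintro (hx | hx)
    · exact ⟨Or.inl hx, hfc x hx⟩
    · obtain ⟨j, hx1 | hx1, hx2⟩ := mem_iUnion.1 hx
      · exact ⟨Or.inl (image_mono (hE.frontier_subset_carpet j) hx1), hx2⟩
      · exact ⟨Or.inr (mem_iUnion.2 ⟨j, hx1⟩), hx2⟩
  · rintro ⟨hx | hx, hx2⟩
    · exact Or.inl hx
    · obtain ⟨j, hx1⟩ := mem_iUnion.1 hx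
      exact Or.inr (mem_iUnion.2 ⟨j, Or.inr hx1, hx2⟩)

theorem IsDiskFamily.exists_graph {E : ℕ → Set Sphere2} (hE : IsDiskFamily E)
    {f f' : Sphere2 → Sphere2} (hf : ContinuousOn f (carpet E)) (hi : InjOn f (carpet E))
    (hf' : ContinuousOn f' (carpet E)) (hi' : InjOn f' (carpet E)) {P P' : ℕ → Sphere2}
    (hP : IsRegions E f P) (hP' : IsRegions E f' P') {H H' : ℕ → Set Sphere2}
    (hH : IsHoleFamily H) (hH' : IsHoleFamily H')
    (hsub : ∀ n, H n = ∅ ∨ ∃ j, H n ⊆ region (P j) (f '' frontier (E j)))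
    (hsub' : ∀ n, H' n = ∅ ∨ ∃ j, H' n ⊆ region (P' j) (f' '' frontier (E j)))
    (hd : (∃ n, (H' n).Nonempty) → Dense (⋃ n, H n))
    (hd' : (∃ n, (H n).Nonempty) → Dense (⋃ n, H' n)) :
    ∃ G : Set (Sphere2 × Sphere2), IsCompact G ∧ InjOn Prod.fst G ∧ InjOn Prod.snd G ∧
      (∀ c ∈ carpet E, (f c, f' c) ∈ G) ∧
      Prod.fst '' G = (f '' carpet E ∪ ⋃ j, region (P j) (f '' frontier (E j))) \
        ⋃ n, interior (H n) ∧
      Prod.snd '' G = (f' '' carpet E ∪ ⋃ j, region (P' j) (f' '' frontier (E j))) \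
        ⋃ n, interior (H' n) := by
  set k : Sphere2 → Sphere2 × Sphere2 := fun c => (f c, f' c) with hk
  have hkc : ContinuousOn k (carpet E) := hf.prodMk hf'
  have hki : InjOn k (carpet E) := fun x hx y hy hxy => hi hx hy (congrArg Prod.fst hxy)
  have hk1 : ∀ A, Prod.fst '' (k '' A) = f '' A := fun A => by rw [image_image]
  have hk2 : ∀ A, Prod.snd '' (k '' A) = f' '' A := fun A => by rw [image_image]
  have hfr := hE.frontier_subset_carpet
  have hk1i : InjOn Prod.fst (k '' carpet E) := by
    rintro _ ⟨x, hx, rfl⟩ _ ⟨y, hy, rfl⟩ hxy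
    rw [hi hx hy hxy]
  have hk2i : InjOn Prod.snd (k '' carpet E) := by
    rintro _ ⟨x, hx, rfl⟩ _ ⟨y, hy, rfl⟩ hxy
    rw [hi' hx hy hxy]
  have hex : ∀ j, ∃ R : Set (Sphere2 × Sphere2), IsCompact R ∧ k '' frontier (E j) ⊆ R ∧
      InjOn Prod.fst R ∧ InjOn Prod.snd R ∧
      Prod.fst '' R = (f '' frontier (E j) ∪ region (P j) (f '' frontier (E j))) \
        ⋃ n, interior (H n) ∧
      Prod.snd '' R = (f' '' frontier (E j) ∪ region (P' j) (f' '' frontier (E j))) \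
        ⋃ n, interior (H' n) := fun j => by
    have := exists_graph_region (hE.isJordanCurve_image hkc hki j)
      (hk1i.mono (image_mono (hfr j))) (hk2i.mono (image_mono (hfr j)))
      (p := P j) (p' := P' j) (by rw [hk1]; exact hP.notMem j) (by rw [hk2]; exact hP'.notMem j)
      hH hH' (by rw [hk1]; exact fun n => hP.subset_or (hsub n) j)
      (by rw [hk2]; exact fun n => hP'.subset_or (hsub' n) j) hd hd'
    rwa [hk1, hk2] at this
  choose R hRc hRΓ hR1 hR2 hRf hRs using hex
  have hRf' : ∀ j, Prod.fst '' R j ⊆ f '' frontier (E j) ∪ region (P j) (f '' frontier (E j)) :=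
    fun j => hRf j ▸ sdiff_subset
  have hRs' : ∀ j, Prod.snd '' R j ⊆ f' '' frontier (E j) ∪ region (P' j) (f' '' frontier (E j)) :=
    fun j => hRs j ▸ sdiff_subset
  have hbdd : ∀ A : Set Sphere2, Bornology.IsBounded A := fun A =>
    isCompact_univ.isBounded.subset (subset_univ A)
  have hdiam : Tendsto (fun j => Metric.diam (R j)) atTop (𝓝 0) := by
    have hsum := hP.diam.add hP'.diam
    rw [add_zero] at hsum
    refine squeeze_zero (fun j => diam_nonneg) (fun j => ?_) hsum
    refine diam_le_of_forall_dist_le (add_nonneg diam_nonneg diam_nonneg) fun x hx y hy => ?_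
    have h1 := dist_le_diam_of_mem (hbdd _) (hRf' j ⟨x, hx, rfl⟩) (hRf' j ⟨y, hy, rfl⟩)
    have h2 := dist_le_diam_of_mem (hbdd _) (hRs' j ⟨x, hx, rfl⟩) (hRs' j ⟨y, hy, rfl⟩)
    rw [Prod.dist_eq]
    exact max_le (h1.trans (le_add_of_nonneg_right diam_nonneg))
      (h2.trans (le_add_of_nonneg_left diam_nonneg))
  refine ⟨k '' carpet E ∪ ⋃ j, R j, ?_, ?_, ?_, fun c hc => Or.inl ⟨c, hc, rfl⟩, ?_, ?_⟩
  · refine isCompact_union_iUnion_of_diam ((isCompact_carpet E).image_of_continuousOn hkc) hRc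
      (fun j => ?_) hdiam
    obtain ⟨x, hx⟩ := (hE.disk j).isJordanCurve_frontier.isConnected.nonempty
    exact ⟨k x, ⟨x, hfr j hx, rfl⟩, hRΓ j ⟨x, hx, rfl⟩⟩
  · refine injOn_union_iUnion hk1i hR1 (fun j => image_mono (hfr j)) hRΓ (fun j => ?_)
      fun i j hij => (hP.disjoint hij).mono (hRf' i) (hRf' j)
    rw [hk1, hk1]
    exact (inter_subset_inter_right _ (hRf' j)).trans (hP.inter_subset j)
  · refine injOn_union_iUnion hk2i hR2 (fun j => image_mono (hfr j)) hRΓ (fun j => ?_)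
      fun i j hij => (hP'.disjoint hij).mono (hRs' i) (hRs' j)
    rw [hk2, hk2]
    exact (inter_subset_inter_right _ (hRs' j)).trans (hP'.inter_subset j)
  · rw [image_union, image_iUnion, hk1]
    simp only [hRf]
    exact hP.union_diff_eq hE hsub
  · rw [image_union, image_iUnion, hk2]
    simp only [hRs]
    exact hP'.union_diff_eq hE hsub'

theorem IsRegions.union_eq_univ {E : ℕ → Set Sphere2} (hE : IsDiskFamily E)
    {f : Sphere2 → Sphere2} (hf : ContinuousOn f (carpet E)) (hi : InjOn f (carpet E))
    {P : ℕ → Sphere2} (hP : IsRegions E f P) :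
    f '' carpet E ∪ ⋃ j, region (P j) (f '' frontier (E j)) = univ := by
  obtain ⟨Q, hQ⟩ := hE.exists_isRegions continuousOn_id (injOn_id _)
  have hreg : ∀ j, region (Q j) (id '' frontier (E j)) = interior (E j) := fun j => by
    have hQj : Q j ∉ E j := fun h => by
      have h1 := hQ.pole j
      rw [image_id, (hE.disk j).frontier_eq] at h1
      exact h1.2 ⟨h, fun h' => h1.1 (mem_iUnion.2 ⟨j, h'⟩)⟩
    obtain ⟨e, -, -, -, -, -, hch⟩ := (hE.disk j).exists_param
    rw [image_id, region, ← (hch _ hQj).2.1,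
      unchart_image_chart_image fun h => hQj (interior_subset h)]
  obtain ⟨G, hG, h1, h2, -, h3, h4⟩ := hE.exists_graph hf hi continuousOn_id (injOn_id _) hP hQ
    isHoleFamily_empty isHoleFamily_empty (fun _ => Or.inl rfl) (fun _ => Or.inl rfl)
    (fun h => by simp at h) (fun h => by simp at h)
  have h4' : Prod.snd '' G = univ := by
    rw [h4]
    simp only [hreg]
    simp only [image_id, interior_empty, iUnion_empty, sdiff_empty]
    exact compl_union_self _
  simp only [interior_empty, iUnion_empty, sdiff_empty] at h3
  rw [← h3]
  obtain ⟨h, hh⟩ := exists_homeomorph_of_graph hG h1 h2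
  have hmem : ∀ x, x ∈ Prod.snd '' G := fun x => h4' ▸ mem_univ x
  let F : Sphere2 → Sphere2 := fun x => h.symm ⟨x, hmem x⟩
  have hF : Function.Surjective F := by
    refine surjective_of_continuous_injective_sphere ?_ fun x y hxy => ?_
    · exact continuous_subtype_val.comp (h.symm.continuous.comp (continuous_id.subtype_mk _))
    · exact congrArg Subtype.val (h.symm.injective (Subtype.ext hxy))
  refine eq_univ_of_forall fun y => ?_
  obtain ⟨x, rfl⟩ := hF y
  exact Subtype.coe_prop _

theorem IsRegions.exists_subset {E : ℕ → Set Sphere2} (hE : IsDiskFamily E)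
    {f : Sphere2 → Sphere2} (hf : ContinuousOn f (carpet E)) (hi : InjOn f (carpet E))
    {P : ℕ → Sphere2} (hP : IsRegions E f P) {A : Set Sphere2} (hA : IsDisk A)
    (h : Disjoint (f '' carpet E) (interior A))
    (hfr : ∀ j, Disjoint (f '' frontier (E j)) (frontier A)) :
    ∃ j, A ⊆ region (P j) (f '' frontier (E j)) := by
  obtain ⟨x, hx⟩ := hA.isConnected_interior.nonempty
  have hxu : x ∈ f '' carpet E ∪ ⋃ j, region (P j) (f '' frontier (E j)) :=
    hP.union_eq_univ hE hf hi ▸ mem_univ x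
  obtain ⟨j, hj⟩ := mem_iUnion.1 (hxu.resolve_left fun h' => disjoint_left.1 h h' hx)
  have hJ := hE.isJordanCurve_image hf hi j
  have hγ : Disjoint (f '' frontier (E j)) (interior A) :=
    h.mono_left (image_mono (hE.frontier_subset_carpet j))
  have hin : interior A ⊆ region (P j) (f '' frontier (E j)) :=
    (hA.isConnected_interior.isPreconnected.subset_region_or hJ.isCompact (hP.notMem j)
      hγ.symm).resolve_right fun h' => disjoint_left.1 h' hx (Or.inr hj)
  refine ⟨j, fun y hy => ?_⟩
  have hcl : A ⊆ f '' frontier (E j) ∪ region (P j) (f '' frontier (E j)) := by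
    rw [← hA.closure_interior]
    exact closure_minimal (hin.trans subset_union_right)
      (isCompact_union_region hJ.isCompact (hP.notMem j)).isClosed
  refine (hcl hy).resolve_left fun hyγ => ?_
  rw [← hA.interior_union_frontier] at hy
  exact hy.elim (disjoint_left.1 hγ hyγ) (disjoint_left.1 (hfr j) hyγ)

/-- Two embeddings of a carpet into carpets, with no boundary curve meeting the boundary of an
ambient hole, differ by a homeomorphism of the ambient carpets. -/
theorem IsDiskFamily.exists_homeomorph_carpet {E D D' : ℕ → Set Sphere2} (hE : IsDiskFamily E)
    (hD : IsDiskFamily D) (hD' : IsDiskFamily D') (hdD : Dense (⋃ n, D n))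
    (hdD' : Dense (⋃ n, D' n)) {f f' : Sphere2 → Sphere2} (hf : ContinuousOn f (carpet E))
    (hi : InjOn f (carpet E)) (hf' : ContinuousOn f' (carpet E)) (hi' : InjOn f' (carpet E))
    (hm : MapsTo f (carpet E) (carpet D)) (hm' : MapsTo f' (carpet E) (carpet D'))
    (hfr : ∀ i j, Disjoint (f '' frontier (E j)) (frontier (D i)))
    (hfr' : ∀ i j, Disjoint (f' '' frontier (E j)) (frontier (D' i))) :
    ∃ h : carpet D ≃ₜ carpet D', ∀ c (hc : c ∈ carpet E), (h ⟨f c, hm hc⟩ : Sphere2) = f' c := by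
  obtain ⟨P, hP⟩ := hE.exists_isRegions hf hi
  obtain ⟨P', hP'⟩ := hE.exists_isRegions hf' hi'
  have hdis : ∀ (f : Sphere2 → Sphere2) (D : ℕ → Set Sphere2),
      MapsTo f (carpet E) (carpet D) → ∀ i, Disjoint (f '' carpet E) (interior (D i)) := by
    intro f D hm i
    rw [disjoint_left]
    rintro _ ⟨c, hc, rfl⟩ h
    exact hm hc (mem_iUnion.2 ⟨i, h⟩)
  obtain ⟨G, hG, h1, h2, hmem, h3, h4⟩ := hE.exists_graph hf hi hf' hi' hP hP' hD.isHoleFamily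
    hD'.isHoleFamily
    (fun n => Or.inr (hP.exists_subset hE hf hi (hD.disk n) (hdis f D hm n) (hfr n)))
    (fun n => Or.inr (hP'.exists_subset hE hf' hi' (hD'.disk n) (hdis f' D' hm' n) (hfr' n)))
    (fun _ => hdD) (fun _ => hdD')
  rw [hP.union_eq_univ hE hf hi, ← compl_eq_univ_sdiff] at h3
  rw [hP'.union_eq_univ hE hf' hi', ← compl_eq_univ_sdiff] at h4
  obtain ⟨h, hh⟩ := exists_homeomorph_of_graph hG h1 h2
  refine ⟨(Homeomorph.setCongr h3).symm.trans (h.trans (Homeomorph.setCongr h4)),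
    fun c hc => hh _ (hmem c hc)⟩

/-! ### Peripheral circles -/

theorem IsDiskFamily.isPeriphCircle {E : ℕ → Set Sphere2} (hE : IsDiskFamily E) {Y : Type*}
    [TopologicalSpace Y] (e : Y ≃ₜ carpet E) (j : ℕ) :
    IsPeriphCircle Y {y | (e y : Sphere2) ∈ frontier (E j)} := by
  obtain ⟨c⟩ := (hE.disk j).nonempty_homeomorph_frontier
  constructor
  · let g : {y | (e y : Sphere2) ∈ frontier (E j)} ≃ₜ frontier (E j) :=
      { toFun := fun y => ⟨e y, y.2⟩
        invFun := fun x => ⟨e.symm ⟨x, hE.frontier_subset_carpet j x.2⟩, by simp⟩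
        left_inv := fun y => by simp
        right_inv := fun x => by simp
        continuous_toFun := by fun_prop
        continuous_invFun := by fun_prop }
    exact ⟨g.trans c⟩
  · obtain ⟨hne, hpre⟩ := hE.isConnected_carpet_diff j
    have h1 : IsConnected ((↑) ⁻¹' (carpet E \ frontier (E j)) : Set (carpet E)) := by
      obtain ⟨x, hx⟩ := hne
      refine ⟨⟨⟨x, hx.1⟩, hx⟩, ?_⟩
      rw [← Topology.IsInducing.subtypeVal.isPreconnected_image, Subtype.image_preimage_coe,
        inter_eq_right.2 sdiff_subset]
      exact hpre
    have h2 := h1.image e.symm e.symm.continuous.continuousOn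
    convert! h2 using 1
    ext y
    rw [e.symm.image_eq_preimage_symm]
    simp

theorem exists_continuousOn_carpet {E : ℕ → Set Sphere2} {Y : Type*} [TopologicalSpace Y]
    (e : Y ≃ₜ carpet E) {g : Y → Sphere2} (hg : Continuous g) (hi : Function.Injective g) :
    ∃ f : Sphere2 → Sphere2, ContinuousOn f (carpet E) ∧ InjOn f (carpet E) ∧
      ∀ y, f (e y) = g y := by
  classical
  let f : Sphere2 → Sphere2 := fun x => if hx : x ∈ carpet E then g (e.symm ⟨x, hx⟩) else x
  have hf : ∀ x (hx : x ∈ carpet E), f x = g (e.symm ⟨x, hx⟩) := fun x hx => dif_pos hx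
  refine ⟨f, ?_, fun x hx y hy hxy => ?_, fun y => ?_⟩
  · rw [continuousOn_iff_continuous_domRestrict]
    have : (carpet E).domRestrict f = g ∘ e.symm := by
      ext1 x; exact hf x x.2
    rw [this]
    exact hg.comp e.symm.continuous
  · rw [hf x hx, hf y hy] at hxy
    simpa using e.symm.injective (hi hxy)
  · rw [hf _ (e y).2]; simp

theorem IsSierpinskiCurve.exists_isDiskFamily {Y : Type*} [TopologicalSpace Y]
    (h : IsSierpinskiCurve Y) :
    ∃ E, IsDiskFamily E ∧ Dense (⋃ n, E n) ∧ Nonempty (Y ≃ₜ carpet E) := by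
  obtain ⟨D, hD, ⟨e⟩⟩ := h
  obtain ⟨E, hE, hd, hDE⟩ := hD.exists_isDiskFamily
  have : (⋃ i, D i)ᶜ = carpet E := by simp only [carpet, hDE]
  exact ⟨E, hE, hd, ⟨e.trans (Homeomorph.setCongr this)⟩⟩

/-- The boundary curves of an entwined carpet avoid the boundaries of the ambient holes. -/
theorem disjoint_frontier_of_entwined {T : Type*} [TopologicalSpace T]
    {S : Set T} (h : ∀ γ δ : Set T, IsPeriphCircleIn S γ → IsPeriphCircle T δ → Disjoint γ δ)
    {E D : ℕ → Set Sphere2} (hE : IsDiskFamily E) (hD : IsDiskFamily D) (τ : T ≃ₜ carpet D)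
    (σ : S ≃ₜ carpet E) {f : Sphere2 → Sphere2} (hf : ∀ s : S, f (σ s) = τ s) (i j : ℕ) :
    Disjoint (f '' frontier (E j)) (frontier (D i)) := by
  have hγ : IsPeriphCircleIn S (Subtype.val '' {s : S | (σ s : Sphere2) ∈ frontier (E j)}) := by
    refine ⟨?_, ?_⟩
    · rintro _ ⟨s, -, rfl⟩; exact s.2
    · rw [preimage_image_eq _ Subtype.val_injective]
      exact hE.isPeriphCircle σ j
  have hd := h _ _ hγ (hD.isPeriphCircle τ i)
  rw [disjoint_left]
  rintro _ ⟨c, hc, rfl⟩ hcD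
  obtain ⟨s, hs⟩ := σ.surjective ⟨c, hE.frontier_subset_carpet j hc⟩
  have hs' : (σ s : Sphere2) = c := congrArg Subtype.val hs
  refine disjoint_left.1 hd ⟨s, ?_, rfl⟩ ?_
  · rw [mem_ofPred_eq, hs']; exact hc
  · rw [mem_ofPred_eq, ← hf, hs']; exact hcD

theorem stmt7 {T T' : Type*} [TopologicalSpace T] [TopologicalSpace T']
    (hT : IsSierpinskiCurve T) (hT' : IsSierpinskiCurve T')
    (S : Set T) (hS : IsSierpinskiCurve ↥S)
    (hentwined : ∀ γ δ : Set T, IsPeriphCircleIn S γ → IsPeriphCircle T δ → Disjoint γ δ)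
    (S' : Set T') (hS' : IsSierpinskiCurve ↥S')
    (hentwined' : ∀ γ δ : Set T', IsPeriphCircleIn S' γ → IsPeriphCircle T' δ → Disjoint γ δ)
    (φ : ↥S ≃ₜ ↥S') :
    ∃ ψ : T ≃ₜ T', ∀ x : ↥S, ψ ↑x = ↑(φ x) := by
  obtain ⟨D, hD, hdD, ⟨τ⟩⟩ := hT.exists_isDiskFamily
  obtain ⟨D', hD', hdD', ⟨τ'⟩⟩ := hT'.exists_isDiskFamily
  obtain ⟨E, hE, -, ⟨σ⟩⟩ := hS.exists_isDiskFamily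
  obtain ⟨f, hf, hi, hfσ⟩ := exists_continuousOn_carpet σ (g := fun s => (τ s : Sphere2))
    (by fun_prop) fun x y hxy => Subtype.ext (τ.injective (Subtype.ext hxy))
  obtain ⟨f', hf', hi', hfσ'⟩ := exists_continuousOn_carpet σ (g := fun s => (τ' (φ s) : Sphere2))
    (by fun_prop) fun x y hxy => φ.injective (Subtype.ext (τ'.injective (Subtype.ext hxy)))
  have hm : MapsTo f (carpet E) (carpet D) := fun c hc => by
    obtain ⟨s, hs⟩ := σ.surjective ⟨c, hc⟩
    have hs' : (σ s : Sphere2) = c := congrArg Subtype.val hs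
    rw [← hs', hfσ]; exact Subtype.coe_prop _
  have hm' : MapsTo f' (carpet E) (carpet D') := fun c hc => by
    obtain ⟨s, hs⟩ := σ.surjective ⟨c, hc⟩
    have hs' : (σ s : Sphere2) = c := congrArg Subtype.val hs
    rw [← hs', hfσ']; exact Subtype.coe_prop _
  obtain ⟨h, hh⟩ := hE.exists_homeomorph_carpet hD hD' hdD hdD' hf hi hf' hi' hm hm'
    (disjoint_frontier_of_entwined hentwined hE hD τ σ hfσ)
    (disjoint_frontier_of_entwined hentwined' hE hD' τ' (φ.symm.trans σ)
      fun s => by rw [Homeomorph.trans_apply, hfσ', φ.apply_symm_apply])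
  refine ⟨τ.trans (h.trans τ'.symm), fun s => ?_⟩
  rw [Homeomorph.trans_apply, Homeomorph.trans_apply, Homeomorph.symm_apply_eq]
  have h1 : (⟨f (σ s), hm (σ s).2⟩ : carpet D) = τ s := Subtype.ext (hfσ s)
  refine Subtype.ext ?_
  rw [← h1, hh _ (σ s).2, hfσ']
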